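/- There exist constants ᾱ ∈ (0,1) and C > 0 depending only on λ and Λ such that the following holds. Let F be uniformly elliptic with constants λ, Λ and satisfy F(0) = 0, and let u be continuous on the closed unit disk B̄₁ ⊂ ℝ² and a viscosity solution of F(D²u) = 0 in B₁. Then u is of class C^{2,ᾱ} on B̄_{1/2} and ‖u‖_{C^{2,ᾱ}(B̄_{1/2})} ≤ C‖u‖_{L^∞(B₁)}. -/

import Mathlib

open Metric Set Real
open scoped Classical

noncomputable section

abbrev E2 : Type := EuclideanSpace ℝ (Fin 2)
abbrev Mat2 : Type := Matrix (Fin 2) (Fin 2) ℝ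

/-- `‖A⁺‖`: the sum of the positive parts of the eigenvalues of a symmetric matrix `A`. -/
noncomputable def posNorm (A : Mat2) : ℝ :=
  if h : A.IsHermitian then ∑ i, max (h.eigenvalues i) 0 else 0

/-- `‖A⁻‖`: the sum of the negative parts of the eigenvalues of a symmetric matrix `A`. -/
noncomputable def negNorm (A : Mat2) : ℝ :=
  if h : A.IsHermitian then ∑ i, max (-(h.eigenvalues i)) 0 else 0

/-- A norm on 2×2 matrices: sum of absolute values of entries. -/
noncomputable def matNorm (A : Mat2) : ℝ := ∑ i, ∑ j, |A i j|

/-- `F` is uniformly elliptic with constants `0 < lam ≤ Lam`: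
`F M - F N ≤ Lam ‖(M-N)⁺‖ - lam ‖(M-N)⁻‖` for all symmetric `M, N`. -/
def UniformlyElliptic (lam Lam : ℝ) (F : Mat2 → ℝ) : Prop :=
  ∀ M N : Mat2, M.IsHermitian → N.IsHermitian →
    F M - F N ≤ Lam * posNorm (M - N) - lam * negNorm (M - N)

/-- The Hessian matrix `D²u(x)` of `u : ℝ² → ℝ` at `x`. -/
noncomputable def hess (u : E2 → ℝ) (x : E2) : Mat2 :=
  Matrix.of fun i j =>
    fderiv ℝ (fun y => fderiv ℝ u y (EuclideanSpace.single j 1)) x (EuclideanSpace.single i 1)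

/-- `u` is a viscosity solution of `F(D²u) = 0` on `Ω`: for every `C²` test function `φ`
touching from above (local max of `u - φ`) one has `F(D²φ(x₀)) ≥ 0`, and from below
(local min of `u - φ`) one has `F(D²φ(x₀)) ≤ 0`. -/
def IsViscositySol (F : Mat2 → ℝ) (u : E2 → ℝ) (Ω : Set E2) : Prop :=
  ∀ φ : E2 → ℝ, ContDiff ℝ 2 φ → ∀ x₀ ∈ Ω,
    (IsLocalMax (fun x => u x - φ x) x₀ → 0 ≤ F (hess φ x₀)) ∧
    (IsLocalMin (fun x => u x - φ x) x₀ → F (hess φ x₀) ≤ 0)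

/-- `sup_Ω |u|`, the `L^∞` norm of `u` on `s`. -/
noncomputable def supAbs (u : E2 → ℝ) (s : Set E2) : ℝ := ⨆ x ∈ s, |u x|

/-! ## Discrete calculus on the lattice -/

def gA (w : ℤ → ℤ → ℝ) (i j : ℤ) : ℝ := w (i+1) j - 2 * w i j + w (i-1) j
def gB (w : ℤ → ℤ → ℝ) (i j : ℤ) : ℝ := w i (j+1) - 2 * w i j + w i (j-1)
def gC (w : ℤ → ℤ → ℝ) (i j : ℤ) : ℝ := w (i+1) (j+1) - w (i+1) j - w i (j+1) + w i j
def d1 (w : ℤ → ℤ → ℝ) (i j : ℤ) : ℝ := w (i+1) j - w i j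
def d2 (w : ℤ → ℤ → ℝ) (i j : ℤ) : ℝ := w i (j+1) - w i j
def en (w : ℤ → ℤ → ℝ) (i j : ℤ) : ℝ := gA w i j ^ 2 + gB w i j ^ 2 + 2 * gC w i j ^ 2
/-- discrete quasiconformality condition -/
def QC (K : ℝ) (w : ℤ → ℤ → ℝ) (i j : ℤ) : Prop :=
  en w i j ≤ K * (gC w i j ^ 2 - gA w i j * gB w i j)

/-- square box of radius `r` around `(x,y)` -/
def box (x y r : ℤ) : Finset (ℤ × ℤ) :=
  Finset.Icc (x - r) (x + r) ×ˢ Finset.Icc (y - r) (y + r)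

lemma mem_box {x y r : ℤ} {p : ℤ × ℤ} :
    p ∈ box x y r ↔ (x - r ≤ p.1 ∧ p.1 ≤ x + r) ∧ (y - r ≤ p.2 ∧ p.2 ≤ y + r) := by
  simp [box]

/-- box sum -/
def Phi (w : ℤ → ℤ → ℝ) (x y r : ℤ) : ℝ := ∑ p ∈ box x y r, en w p.1 p.2

lemma en_nonneg (w : ℤ → ℤ → ℝ) (i j : ℤ) : 0 ≤ en w i j := by unfold en; positivity

lemma Phi_nonneg (w : ℤ → ℤ → ℝ) (x y r : ℤ) : 0 ≤ Phi w x y r :=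
  Finset.sum_nonneg fun _ _ => en_nonneg _ _ _

lemma Phi_mono (w : ℤ → ℤ → ℝ) {x y r x' y' r' : ℤ} (h : box x y r ⊆ box x' y' r') :
    Phi w x y r ≤ Phi w x' y' r' :=
  Finset.sum_le_sum_of_subset_of_nonneg h fun _ _ _ => en_nonneg _ _ _

lemma tele (G : ℤ → ℝ) (m n : ℤ) (h : m ≤ n + 1) :
    ∑ i ∈ Finset.Icc m n, (G (i+1) - G i) = G (n+1) - G m := by
  obtain ⟨k, hk⟩ : ∃ k : ℕ, n + 1 = m + k := ⟨(n + 1 - m).toNat, by omega⟩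
  have hn : n = m + k - 1 := by omega
  subst hn
  clear h hk
  induction k with
  | zero =>
    rw [Finset.Icc_eq_empty (by push_cast; omega)]; simp
  | succ k ih =>
    have : Finset.Icc m (m + ((k+1 : ℕ):ℤ) - 1) = insert (m + k) (Finset.Icc m (m + (k:ℤ) - 1)) := by
      ext z; simp only [Finset.mem_Icc, Finset.mem_insert]; push_cast; omega
    rw [this, Finset.sum_insert (by simp), ih]
    have h1 : m + (k:ℤ) - 1 + 1 = m + k := by ring
    have h2 : m + ((k+1:ℕ):ℤ) - 1 + 1 = m + k + 1 := by push_cast; ring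
    rw [h1, h2]; ring

/-- walking along a segment -/
lemma walk (G : ℤ → ℝ) (m n i j : ℤ) (hi : m ≤ i) (hij : i ≤ j) (hj : j ≤ n + 1) :
    |G j - G i| ≤ ∑ l ∈ Finset.Icc m n, |G (l+1) - G l| := by
  have h := tele G i (j-1) (by omega)
  have e : j - 1 + 1 = j := by ring
  rw [e] at h
  rw [← h]
  refine (Finset.abs_sum_le_sum_abs _ _).trans ?_
  apply Finset.sum_le_sum_of_subset_of_nonneg
  · intro z; simp only [Finset.mem_Icc]; omega
  · intros; positivity

lemma flux_box (w : ℤ → ℤ → ℝ) (c : ℝ) (x1 x2 y1 y2 : ℤ) (hx : x1 ≤ x2 + 1) (hy : y1 ≤ y2 + 1) :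
    ∑ p ∈ Finset.Icc x1 x2 ×ˢ Finset.Icc y1 y2,
        (gC w p.1 p.2 ^ 2 - gA w p.1 p.2 * gB w p.1 p.2)
      = ∑ j ∈ Finset.Icc y1 y2, ((d1 w (x1-1) j - c) * gB w x1 j - (d1 w x2 j - c) * gB w (x2+1) j)
        + ∑ i ∈ Finset.Icc x1 x2,
          ((d1 w i (y2+1) - c) * gC w i y2 - (d1 w i y1 - c) * gC w i (y1-1)) := by
  have key : ∀ i j : ℤ, gC w i j ^ 2 - gA w i j * gB w i j
      = -(((d1 w (i+1-1) j - c) * gB w (i+1) j) - ((d1 w (i-1) j - c) * gB w i j))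
        + (((d1 w i (j+1) - c) * gC w i (j+1-1)) - ((d1 w i j - c) * gC w i (j-1))) := by
    intro i j
    simp only [gA, gB, gC, d1, add_sub_cancel_right, sub_add_cancel]
    ring
  have e1 : ∀ j, ∑ i ∈ Finset.Icc x1 x2, (((d1 w (i+1-1) j - c) * gB w (i+1) j) - ((d1 w (i-1) j - c) * gB w i j)) = (d1 w x2 j - c) * gB w (x2+1) j - (d1 w (x1-1) j - c) * gB w x1 j := by
    intro j
    have := tele (fun i => (d1 w (i-1) j - c) * gB w i j) x1 x2 hx
    simp only [add_sub_cancel_right] at this ⊢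
    exact this
  have e2 : ∀ i, ∑ j ∈ Finset.Icc y1 y2, (((d1 w i (j+1) - c) * gC w i (j+1-1)) - ((d1 w i j - c) * gC w i (j-1))) = (d1 w i (y2+1) - c) * gC w i y2 - (d1 w i y1 - c) * gC w i (y1-1) := by
    intro i
    have := tele (fun j => (d1 w i j - c) * gC w i (j-1)) y1 y2 hy
    simp only [add_sub_cancel_right] at this ⊢
    exact this
  rw [Finset.sum_congr rfl (fun p _ => key p.1 p.2), Finset.sum_add_distrib]
  congr 1
  · rw [Finset.sum_product_right]
    apply Finset.sum_congr rfl
    intro j _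
    simp only [Finset.sum_neg_distrib]
    rw [e1]; ring
  · rw [Finset.sum_product]
    exact Finset.sum_congr rfl fun i _ => e2 i

lemma flux_cut (w z : ℤ → ℤ → ℝ) (x1 x2 y1 y2 : ℤ) (hx : x1 ≤ x2 + 1) (hy : y1 ≤ y2 + 1)
    (h1 : ∀ j, z x1 j = 0) (h2 : ∀ j, z (x2+1) j = 0) (h3 : ∀ i, z i y1 = 0)
    (h4 : ∀ i, z i (y2+1) = 0) :
    ∑ p ∈ Finset.Icc x1 x2 ×ˢ Finset.Icc y1 y2,
        z p.1 p.2 * (gC w p.1 p.2 ^ 2 - gA w p.1 p.2 * gB w p.1 p.2)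
      = ∑ p ∈ Finset.Icc x1 x2 ×ˢ Finset.Icc y1 y2,
        (d1 w p.1 p.2 * gB w (p.1+1) p.2 * (z (p.1+1) p.2 - z p.1 p.2)
          - d1 w p.1 (p.2+1) * gC w p.1 p.2 * (z p.1 (p.2+1) - z p.1 p.2)) := by
  have key : ∀ i j : ℤ, z i j * (gC w i j ^ 2 - gA w i j * gB w i j)
      = (d1 w i j * gB w (i+1) j * (z (i+1) j - z i j)
          - d1 w i (j+1) * gC w i j * (z i (j+1) - z i j))
      + (-((z (i+1) j * d1 w (i+1-1) j * gB w (i+1) j) - (z i j * d1 w (i-1) j * gB w i j))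
        + ((z i (j+1) * d1 w i (j+1) * gC w i (j+1-1)) - (z i j * d1 w i j * gC w i (j-1)))) := by
    intro i j
    simp only [gA, gB, gC, d1, add_sub_cancel_right, sub_add_cancel]
    ring
  rw [Finset.sum_congr rfl (fun p _ => key p.1 p.2), Finset.sum_add_distrib, Finset.sum_add_distrib]
  have e1 : ∑ p ∈ Finset.Icc x1 x2 ×ˢ Finset.Icc y1 y2, -((z (p.1+1) p.2 * d1 w (p.1+1-1) p.2 * gB w (p.1+1) p.2) - (z p.1 p.2 * d1 w (p.1-1) p.2 * gB w p.1 p.2)) = 0 := by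
    rw [Finset.sum_neg_distrib, Finset.sum_product_right, neg_eq_zero]
    apply Finset.sum_eq_zero
    intro j _
    have := tele (fun i => z i j * d1 w (i-1) j * gB w i j) x1 x2 hx
    rw [h1, h2] at this
    simp only at this ⊢
    rw [this]; ring
  have e2 : ∑ p ∈ Finset.Icc x1 x2 ×ˢ Finset.Icc y1 y2, ((z p.1 (p.2+1) * d1 w p.1 (p.2+1) * gC w p.1 (p.2+1-1)) - (z p.1 p.2 * d1 w p.1 p.2 * gC w p.1 (p.2-1))) = 0 := by
    rw [Finset.sum_product]
    apply Finset.sum_eq_zero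
    intro i _
    have := tele (fun j => z i j * d1 w i j * gC w i (j-1)) y1 y2 hy
    rw [h3, h4] at this
    simp only at this ⊢
    rw [this]; ring
  rw [e1, e2]; ring

lemma cs_seg (f : ℤ → ℝ) (m n : ℤ) (N : ℝ) (hN : ((n + 1 - m : ℤ) : ℝ) ≤ N) (h : m ≤ n + 1) :
    (∑ i ∈ Finset.Icc m n, |f i|) ^ 2 ≤ N * ∑ i ∈ Finset.Icc m n, f i ^ 2 := by
  have h1 := sq_sum_le_card_mul_sum_sq (s := Finset.Icc m n) (f := fun i => |f i|)
  simp only [sq_abs] at h1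
  refine h1.trans ?_
  have : ((Finset.Icc m n).card : ℝ) ≤ N := by
    rw [Int.card_Icc]
    have : (((n + 1 - m).toNat : ℤ) : ℝ) = ((n + 1 - m : ℤ) : ℝ) := by
      rw [Int.toNat_of_nonneg (by omega)]
    calc (((n + 1 - m).toNat : ℕ) : ℝ) = (((n + 1 - m).toNat : ℤ) : ℝ) := (Int.cast_natCast _).symm
      _ ≤ N := by rw [this]; exact hN
  exact mul_le_mul_of_nonneg_right this (Finset.sum_nonneg fun _ _ => sq_nonneg _)

lemma sq_le_en (w : ℤ → ℤ → ℝ) (i j : ℤ) :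
    gA w i j ^ 2 ≤ en w i j ∧ gB w i j ^ 2 ≤ en w i j ∧ gC w i j ^ 2 ≤ en w i j := by
  unfold en
  refine ⟨?_, ?_, ?_⟩ <;> nlinarith [sq_nonneg (gA w i j), sq_nonneg (gB w i j), sq_nonneg (gC w i j)]

lemma seg_v (w : ℤ → ℤ → ℝ) (s : Finset (ℤ × ℤ)) (b y1 y2 : ℤ)
    (h : ∀ j, y1 ≤ j → j ≤ y2 → (b, j) ∈ s) (f : ℤ → ℝ) (hf : ∀ j, f j ^ 2 ≤ en w b j) :
    ∑ j ∈ Finset.Icc y1 y2, f j ^ 2 ≤ ∑ p ∈ s, en w p.1 p.2 := by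
  calc ∑ j ∈ Finset.Icc y1 y2, f j ^ 2 ≤ ∑ j ∈ Finset.Icc y1 y2, en w b j :=
        Finset.sum_le_sum fun j _ => hf j
    _ = ∑ p ∈ ({b} : Finset ℤ) ×ˢ Finset.Icc y1 y2, en w p.1 p.2 := by
        rw [Finset.sum_product]; simp
    _ ≤ _ := by
        apply Finset.sum_le_sum_of_subset_of_nonneg
        · rintro ⟨i, j⟩ hp
          simp only [Finset.mem_product, Finset.mem_singleton, Finset.mem_Icc] at hp
          obtain ⟨rfl, h1, h2⟩ := hp
          exact h j h1 h2
        · intros; exact en_nonneg _ _ _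

lemma seg_h (w : ℤ → ℤ → ℝ) (s : Finset (ℤ × ℤ)) (b y1 y2 : ℤ)
    (h : ∀ i, y1 ≤ i → i ≤ y2 → (i, b) ∈ s) (f : ℤ → ℝ) (hf : ∀ i, f i ^ 2 ≤ en w i b) :
    ∑ i ∈ Finset.Icc y1 y2, f i ^ 2 ≤ ∑ p ∈ s, en w p.1 p.2 := by
  calc ∑ j ∈ Finset.Icc y1 y2, f j ^ 2 ≤ ∑ i ∈ Finset.Icc y1 y2, en w i b :=
        Finset.sum_le_sum fun j _ => hf j
    _ = ∑ p ∈ Finset.Icc y1 y2 ×ˢ ({b} : Finset ℤ), en w p.1 p.2 := by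
        rw [Finset.sum_product]; simp
    _ ≤ _ := by
        apply Finset.sum_le_sum_of_subset_of_nonneg
        · rintro ⟨i, j⟩ hp
          simp only [Finset.mem_product, Finset.mem_singleton, Finset.mem_Icc] at hp
          obtain ⟨⟨h1, h2⟩, rfl⟩ := hp
          exact h i h1 h2
        · intros; exact en_nonneg _ _ _

lemma ring_aux (s1 s2 s3 s4 t1 t2 t3 t4 D : ℝ) (h1 : s1 ^ 2 ≤ D) (h2 : s2 ^ 2 ≤ D) (h3 : s3 ^ 2 ≤ D)
    (h4 : s4 ^ 2 ≤ D) (g1 : t1 ^ 2 ≤ D) (g2 : t2 ^ 2 ≤ D) (g3 : t3 ^ 2 ≤ D)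
    (g4 : t4 ^ 2 ≤ D) : (s1 + s2 + s3 + s4) * (t1 + t2 + t3 + t4) ≤ 16 * D := by
  have hs : (s1 + s2 + s3 + s4) ^ 2 ≤ 16 * D := by
    nlinarith [sq_nonneg (s1 - s2), sq_nonneg (s1 - s3), sq_nonneg (s1 - s4), sq_nonneg (s2 - s3),
      sq_nonneg (s2 - s4), sq_nonneg (s3 - s4)]
  have ht : (t1 + t2 + t3 + t4) ^ 2 ≤ 16 * D := by
    nlinarith [sq_nonneg (t1 - t2), sq_nonneg (t1 - t3), sq_nonneg (t1 - t4), sq_nonneg (t2 - t3),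
      sq_nonneg (t2 - t4), sq_nonneg (t3 - t4)]
  nlinarith [sq_nonneg ((s1 + s2 + s3 + s4) - (t1 + t2 + t3 + t4))]

lemma ring_flux (w : ℤ → ℤ → ℝ) (x y r : ℤ) (hr : 0 ≤ r) :
    ∑ p ∈ box x y r, (gC w p.1 p.2 ^ 2 - gA w p.1 p.2 * gB w p.1 p.2)
      ≤ 16 * ((2 * r + 1) * (Phi w x y (r+1) - Phi w x y (r-1))) := by
  set s := box x y (r+1) \ box x y (r-1) with hs
  have hring : Phi w x y (r+1) - Phi w x y (r-1) = ∑ p ∈ s, en w p.1 p.2 := by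
    unfold Phi
    rw [hs, ← Finset.sum_sdiff (s₁ := box x y (r-1)) (s₂ := box x y (r+1))]
    · ring
    · intro p; simp only [mem_box]; omega
  have hmem : ∀ i j : ℤ, (i, j) ∈ s ↔ ((x - (r+1) ≤ i ∧ i ≤ x + (r+1)) ∧ (y - (r+1) ≤ j ∧ j ≤ y + (r+1))) ∧
     ¬ ((x - (r-1) ≤ i ∧ i ≤ x + (r-1)) ∧ (y - (r-1) ≤ j ∧ j ≤ y + (r-1))) := by
    intro i j; simp [hs, mem_box]
  rw [hring]
  set D := (2 * (r:ℝ) + 1) * ∑ p ∈ s, en w p.1 p.2 with hD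
  have hNx : (((x + r) + 1 - (x - r) : ℤ) : ℝ) ≤ 2 * (r:ℝ) + 1 := by push_cast; linarith
  have hNy : (((y + r) + 1 - (y - r) : ℤ) : ℝ) ≤ 2 * (r:ℝ) + 1 := by push_cast; linarith
  have hN0 : (0:ℝ) ≤ 2 * (r:ℝ) + 1 := by
    have : (0:ℝ) ≤ r := by exact_mod_cast hr
    linarith
  have V : ∀ (f : ℤ → ℝ) (b : ℤ), (∀ j, f j ^ 2 ≤ en w b j) →
      (b = x - r - 1 ∨ b = x - r ∨ b = x + r ∨ b = x + r + 1) →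
      (∑ j ∈ Finset.Icc (y - r) (y + r), |f j|) ^ 2 ≤ D := by
    intro f b hf hb
    refine (cs_seg f _ _ _ hNy (by omega)).trans ?_
    refine mul_le_mul_of_nonneg_left (seg_v w s b _ _ ?_ f hf) hN0
    intro j h1 h2; rw [hmem]; omega
  have H : ∀ (f : ℤ → ℝ) (b : ℤ), (∀ i, f i ^ 2 ≤ en w i b) →
      (b = y - r - 1 ∨ b = y - r ∨ b = y + r ∨ b = y + r + 1) →
      (∑ i ∈ Finset.Icc (x - r) (x + r), |f i|) ^ 2 ≤ D := by
    intro f b hf hb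
    refine (cs_seg f _ _ _ hNx (by omega)).trans ?_
    refine mul_le_mul_of_nonneg_left (seg_h w s b _ _ ?_ f hf) hN0
    intro j h1 h2; rw [hmem]; omega
  set c := d1 w (x + r) (y + r + 1) with hc
  rw [show box x y r = Finset.Icc (x - r) (x + r) ×ˢ Finset.Icc (y - r) (y + r) from rfl,
    flux_box w c _ _ _ _ (by omega) (by omega)]
  set s1 := ∑ j ∈ Finset.Icc (y - r) (y + r), |gC w (x + r) j| with hs1
  set s2 := ∑ i ∈ Finset.Icc (x - r) (x + r), |gA w i (y + r + 1)| with hs2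
  set s3 := ∑ j ∈ Finset.Icc (y - r) (y + r), |gC w (x - r - 1) j| with hs3
  set s4 := ∑ i ∈ Finset.Icc (x - r) (x + r), |gA w i (y - r)| with hs4
  have p1 : 0 ≤ s1 := Finset.sum_nonneg fun _ _ => abs_nonneg _
  have p2 : 0 ≤ s2 := Finset.sum_nonneg fun _ _ => abs_nonneg _
  have p3 : 0 ≤ s3 := Finset.sum_nonneg fun _ _ => abs_nonneg _
  have p4 : 0 ≤ s4 := Finset.sum_nonneg fun _ _ => abs_nonneg _
  have right : ∀ j, y - r ≤ j → j ≤ y + r → |d1 w (x + r) j - c| ≤ s1 := by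
    intro j h1 h2
    have := walk (fun j => d1 w (x + r) j) (y - r) (y + r) j (y + r + 1) h1 (by omega) (by omega)
    rw [abs_sub_comm]
    refine this.trans (le_of_eq (Finset.sum_congr rfl fun l _ => ?_))
    simp only [d1, gC]; congr 1; ring
  have top : ∀ i, x - r - 1 ≤ i → i ≤ x + r → |d1 w i (y + r + 1) - c| ≤ s2 := by
    intro i h1 h2
    have := walk (fun i => d1 w (i - 1) (y + r + 1)) (x - r) (x + r) (i+1) (x + r + 1) (by omega) (by omega) (by omega)
    rw [abs_sub_comm]
    simp only [add_sub_cancel_right] at this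
    refine this.trans (le_of_eq (Finset.sum_congr rfl fun l _ => ?_))
    simp only [d1, gA, sub_add_cancel]; congr 1; ring
  have left : ∀ j, y - r ≤ j → j ≤ y + r → |d1 w (x - r - 1) j - c| ≤ s3 + s2 := by
    intro j h1 h2
    have h := walk (fun j => d1 w (x - r - 1) j) (y - r) (y + r) j (y + r + 1) h1 (by omega) (by omega)
    rw [abs_sub_comm] at h
    have h' : ∑ l ∈ Finset.Icc (y - r) (y + r), |d1 w (x - r - 1) (l + 1) - d1 w (x - r - 1) l| = s3 := by
      refine (Finset.sum_congr rfl fun l _ => ?_)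
      simp only [d1, gC]; congr 1; ring
    rw [h'] at h
    have h2 := top (x - r - 1) le_rfl (by omega)
    calc |d1 w (x - r - 1) j - c| ≤ _ := abs_sub_le _ (d1 w (x - r - 1) (y + r + 1)) _
      _ ≤ _ := add_le_add h h2
  have bot : ∀ i, x - r ≤ i → i ≤ x + r → |d1 w i (y - r) - c| ≤ s4 + s1 := by
    intro i h1 h2
    have h := walk (fun i => d1 w (i - 1) (y - r)) (x - r) (x + r) (i+1) (x + r + 1) (by omega) (by omega) (by omega)
    rw [abs_sub_comm] at h
    simp only [add_sub_cancel_right] at h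
    have h' : ∑ l ∈ Finset.Icc (x - r) (x + r), |d1 w l (y - r) - d1 w (l - 1) (y - r)| = s4 := by
      refine (Finset.sum_congr rfl fun l _ => ?_)
      simp only [d1, gA, sub_add_cancel]; congr 1; ring
    rw [h'] at h
    have h2 := right (y - r) le_rfl (by omega)
    calc |d1 w i (y - r) - c| ≤ _ := abs_sub_le _ (d1 w (x + r) (y - r)) _
      _ ≤ _ := add_le_add h h2
  set S := s1 + s2 + s3 + s4 with hS
  have prod : ∀ a b : ℝ, |a| ≤ S → a * b ≤ S * |b| := by
    intro a b h
    calc a * b ≤ |a * b| := le_abs_self _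
      _ = |a| * |b| := abs_mul _ _
      _ ≤ _ := mul_le_mul_of_nonneg_right h (abs_nonneg _)
  have prod' : ∀ a b : ℝ, |a| ≤ S → -(a * b) ≤ S * |b| := by
    intro a b h
    have := prod (-a) b (by rwa [abs_neg]); linarith
  calc _ ≤ ∑ j ∈ Finset.Icc (y - r) (y + r), (S * |gB w (x - r) j| + S * |gB w (x + r + 1) j|)
        + ∑ i ∈ Finset.Icc (x - r) (x + r), (S * |gC w i (y + r)| + S * |gC w i (y - r - 1)|) := by
        apply add_le_add
        · apply Finset.sum_le_sum
          intro j hj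
          rw [Finset.mem_Icc] at hj
          have a1 := prod (d1 w (x - r - 1) j - c) (gB w (x - r) j) ((left j hj.1 hj.2).trans (by linarith))
          have a2 := prod' (d1 w (x + r) j - c) (gB w (x + r + 1) j) ((right j hj.1 hj.2).trans (by linarith))
          linarith
        · apply Finset.sum_le_sum
          intro i hi
          rw [Finset.mem_Icc] at hi
          have a1 := prod (d1 w i (y + r + 1) - c) (gC w i (y + r)) ((top i (by omega) hi.2).trans (by linarith))
          have a2 := prod' (d1 w i (y - r) - c) (gC w i (y - r - 1)) ((bot i hi.1 hi.2).trans (by linarith))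
          linarith
    _ = S * (∑ j ∈ Finset.Icc (y - r) (y + r), |gB w (x - r) j| + ∑ j ∈ Finset.Icc (y - r) (y + r), |gB w (x + r + 1) j|
        + ∑ i ∈ Finset.Icc (x - r) (x + r), |gC w i (y + r)| + ∑ i ∈ Finset.Icc (x - r) (x + r), |gC w i (y - r - 1)|) := by
        simp only [Finset.sum_add_distrib, ← Finset.mul_sum]; ring
    _ ≤ 16 * D := by
        apply ring_aux
        · exact V _ (x + r) (fun j => (sq_le_en w _ j).2.2) (by simp)
        · exact H _ (y + r + 1) (fun j => (sq_le_en w j _).1) (by simp)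
        · exact V _ (x - r - 1) (fun j => (sq_le_en w _ j).2.2) (by simp)
        · exact H _ (y - r) (fun j => (sq_le_en w j _).1) (by simp)
        · exact V _ (x - r) (fun j => (sq_le_en w _ j).2.1) (by simp)
        · exact V _ (x + r + 1) (fun j => (sq_le_en w _ j).2.1) (by simp)
        · exact H _ (y + r) (fun j => (sq_le_en w j _).2.2) (by simp)
        · exact H _ (y - r - 1) (fun j => (sq_le_en w j _).2.2) (by simp)

/-- one-step decay -/
lemma Phi_step (K : ℝ) (hK : 0 ≤ K) (w : ℤ → ℤ → ℝ) (x y : ℤ) (r : ℕ) (hr : 2 ≤ r)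
    (hq : ∀ p ∈ box x y (2 * r), QC K w p.1 p.2) :
    Phi w x y r ≤ 256 * K * (Phi w x y (2 * r) - Phi w x y r) := by
  have mono : ∀ s t : ℤ, s ≤ t → Phi w x y s ≤ Phi w x y t := by
    intro s t h
    apply Phi_mono; intro p; simp only [mem_box]; omega
  have step : ∀ l : ℕ, l < r - 1 → Phi w x y r ≤ 64 * K * r * ((Phi w x y (r + l + 2) - Phi w x y (r + l))) := by
    intro l hl
    have h1 : Phi w x y (r + l + 1) ≤ K * (16 * ((2 * ((r + l + 1 : ℤ):ℝ) + 1) * (Phi w x y (r + l + 1 + 1) - Phi w x y (r + l + 1 - 1)))) := by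
      refine le_trans ?_ (mul_le_mul_of_nonneg_left (ring_flux w x y (r + l + 1) (by omega)) hK)
      rw [Finset.mul_sum]
      apply Finset.sum_le_sum
      intro p hp
      apply hq
      rw [mem_box] at hp ⊢; omega
    have e1 : (r + l + 1 + 1 : ℤ) = r + l + 2 := by ring
    have e2 : (r + l + 1 - 1 : ℤ) = r + l := by ring
    rw [e1, e2] at h1
    have h3 := mono (r + l) (r + l + 2) (by omega)
    have h4 : (2 * ((r + l + 1 : ℤ):ℝ) + 1) ≤ 4 * r := by
      have : 2 * (r + l + 1) + 1 ≤ 4 * r := by omega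
      exact_mod_cast this
    refine (mono r (r + l + 1) (by omega)).trans (h1.trans ?_)
    have := mul_le_mul_of_nonneg_right h4 (sub_nonneg.2 h3)
    nlinarith
  have tot : ∀ m : ℕ, m ≤ r - 1 → (m:ℝ) * Phi w x y r ≤ 64 * K * r * (Phi w x y (r + m + 1) + Phi w x y (r + m) - Phi w x y r - Phi w x y (r + 1)) := by
    intro m
    induction m with
    | zero => intro _; simp
    | succ m ih =>
      intro hm
      have a := ih (by omega)
      have b := step m (by omega)
      have e : ((r:ℤ) + ((m+1:ℕ):ℤ) + 1) = r + m + 2 := by push_cast; ring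
      have e' : ((r:ℤ) + ((m+1:ℕ):ℤ)) = r + m + 1 := by push_cast; ring
      rw [e, e']; push_cast
      nlinarith
  have h := tot (r - 1) le_rfl
  have m1 := mono (r + (r - 1 : ℕ) + 1) (2 * r) (by omega)
  have m2 := mono (r + (r - 1 : ℕ)) (2 * r) (by omega)
  have m3 := mono r (r + 1) (by omega)
  have hc : (r:ℝ) / 2 ≤ ((r - 1 : ℕ) : ℝ) := by
    rw [Nat.cast_sub (by omega)]; push_cast
    have : (2:ℝ) ≤ r := by exact_mod_cast hr
    linarith
  have hr0 : (0:ℝ) < r := by positivity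
  have hP := Phi_nonneg w x y r
  have h5 : (r:ℝ) / 2 * Phi w x y r ≤ 64 * K * r * (2 * (Phi w x y (2 * r) - Phi w x y r)) := by
    refine (mul_le_mul_of_nonneg_right hc hP).trans (h.trans ?_)
    apply mul_le_mul_of_nonneg_left _ (by positivity)
    linarith
  have h6 : (r:ℝ) * (Phi w x y r) ≤ r * (256 * K * (Phi w x y (2 * r) - Phi w x y r)) := by nlinarith
  exact le_of_mul_le_mul_left h6 hr0

lemma Phi_decay (K θ : ℝ) (hK : 0 ≤ K) (hθ : θ = 256 * K / (1 + 256 * K)) (w : ℤ → ℤ → ℝ) (x y : ℤ) (n : ℕ)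
    (hq : ∀ p ∈ box x y (2 ^ n), QC K w p.1 p.2) (l : ℕ) (hl : l + 1 ≤ n) :
    Phi w x y (2 ^ l) ≤ θ ^ (n - l - 1) * Phi w x y (2 ^ n) := by
  have hθ0 : 0 ≤ θ := by rw [hθ]; positivity
  have mono : ∀ s t : ℤ, s ≤ t → Phi w x y s ≤ Phi w x y t := by
    intro s t h
    apply Phi_mono; intro p; simp only [mem_box]; omega
  have one : ∀ l : ℕ, 1 ≤ l → l + 1 ≤ n → Phi w x y (2 ^ l) ≤ θ * Phi w x y (2 ^ (l + 1)) := by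
    intro l h1 h2
    have hp : (2:ℤ) ^ (l+1) ≤ 2 ^ n := pow_le_pow_right₀ (by norm_num) h2
    have h := Phi_step K hK w x y (2 ^ l) (by calc 2 = 2 ^ 1 := rfl
                                               _ ≤ 2 ^ l := Nat.pow_le_pow_right (by norm_num) h1) (by
      intro p hp'
      apply hq
      rw [mem_box] at hp' ⊢
      push_cast at hp'
      rw [pow_succ] at hp
      omega)
    have e : (2:ℤ) * ((2 ^ l : ℕ) : ℤ) = 2 ^ (l + 1) := by push_cast; ring
    rw [e] at h
    push_cast at h
    rw [hθ, div_mul_eq_mul_div, le_div_iff₀ (by positivity)]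
    nlinarith
  have main : ∀ m l : ℕ, 1 ≤ l → l + m = n → Phi w x y (2 ^ l) ≤ θ ^ m * Phi w x y (2 ^ n) := by
    intro m
    induction m with
    | zero => intro l _ h; simp at h; subst h; simp
    | succ m ih =>
      intro l h1 h2
      have a := one l h1 (by omega)
      have b := ih (l+1) (by omega) (by omega)
      calc _ ≤ _ := a
        _ ≤ θ * (θ ^ m * Phi w x y (2 ^ n)) := mul_le_mul_of_nonneg_left b hθ0
        _ = _ := by ring
  have h := main (n - l - 1) (l + 1) (by omega) (by omega)
  refine (mono _ _ ?_).trans h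
  exact pow_le_pow_right₀ (by norm_num) (by omega)

/-- one dimensional cutoff -/
def tau (R : ℝ) (i : ℤ) : ℝ := max 0 (min 1 (2 - |(i:ℝ)| / R))

lemma tau_lip (R : ℝ) (hR : 0 < R) (i : ℤ) : |tau R (i+1) - tau R i| ≤ 1 / R := by
  unfold tau
  refine (abs_max_sub_max_le_max _ _ _ _).trans ?_
  rw [sub_self, abs_zero, max_le_iff]
  refine ⟨by positivity, (abs_min_sub_min_le_max _ _ _ _).trans ?_⟩
  rw [sub_self, abs_zero, max_le_iff]
  refine ⟨by positivity, ?_⟩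
  have : (2 - |((i+1 : ℤ):ℝ)| / R) - (2 - |(i:ℝ)| / R) = (|(i:ℝ)| - |((i+1:ℤ):ℝ)|) / R := by ring
  rw [this, abs_div, abs_of_pos hR]
  apply div_le_div_of_nonneg_right _ hR.le
  refine (abs_abs_sub_abs_le_abs_sub _ _).trans ?_
  push_cast; simp

def eta (R : ℝ) (x y i j : ℤ) : ℝ := min (tau R (i - x)) (tau R (j - y))

lemma tau_nonneg (R : ℝ) (i : ℤ) : 0 ≤ tau R i := le_max_left _ _

lemma eta_nonneg (R : ℝ) (x y i j : ℤ) : 0 ≤ eta R x y i j := le_min (tau_nonneg _ _) (tau_nonneg _ _)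

lemma eta_lip1 (R : ℝ) (hR : 0 < R) (x y i j : ℤ) : |eta R x y (i+1) j - eta R x y i j| ≤ 1 / R := by
  unfold eta
  refine (abs_min_sub_min_le_max _ _ _ _).trans ?_
  rw [sub_self, abs_zero, max_le_iff]
  refine ⟨?_, by positivity⟩
  have := tau_lip R hR (i - x)
  rwa [show i - x + 1 = i + 1 - x by ring] at this

lemma eta_lip2 (R : ℝ) (hR : 0 < R) (x y i j : ℤ) : |eta R x y i (j+1) - eta R x y i j| ≤ 1 / R := by
  unfold eta
  refine (abs_min_sub_min_le_max _ _ _ _).trans ?_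
  rw [sub_self, abs_zero, max_le_iff]
  refine ⟨by positivity, ?_⟩
  have := tau_lip R hR (j - y)
  rwa [show j - y + 1 = j + 1 - y by ring] at this

lemma tau_zero (R : ℝ) (hR : 0 < R) (i : ℤ) (h : 2 * R ≤ |(i:ℝ)|) : tau R i = 0 := by
  unfold tau
  apply max_eq_left
  refine (min_le_right _ _).trans ?_
  have : 2 ≤ |(i:ℝ)| / R := by rw [le_div_iff₀ hR]; exact h
  linarith

lemma tau_one (R : ℝ) (hR : 0 < R) (i : ℤ) (h : |(i:ℝ)| ≤ R) : tau R i = 1 := by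
  unfold tau
  have : |(i:ℝ)| / R ≤ 1 := by rw [div_le_one hR]; exact h
  rw [min_eq_left (by linarith)]; simp

lemma cac_pt (a B e e' δ K : ℝ) (hK : 0 < K) (he' : 0 ≤ e') (he : 0 ≤ e) (hd : |e' - e| ≤ δ) :
    |a * B * (e' ^ 2 - e ^ 2)| ≤ 1 / (2 * K) * (e' ^ 2 * B ^ 2) + δ ^ 2 * ((2 * K + 1) * a ^ 2 + B ^ 2) := by
  have hδ : 0 ≤ δ := (abs_nonneg _).trans hd
  have h1 : |e' ^ 2 - e ^ 2| ≤ δ * (2 * e' + δ) := by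
    rw [show e' ^ 2 - e ^ 2 = (e' - e) * (e' + e) by ring, abs_mul]
    have : |e' + e| ≤ 2 * e' + δ := by
      rw [abs_of_nonneg (by positivity)]
      have := (abs_le.1 hd).1; linarith
    exact mul_le_mul hd this (abs_nonneg _) hδ
  rw [abs_mul, abs_mul]
  have h2 : |a| * |B| * |e' ^ 2 - e ^ 2| ≤ |a| * |B| * (δ * (2 * e' + δ)) :=
    mul_le_mul_of_nonneg_left h1 (by positivity)
  refine h2.trans ?_
  rw [← sq_abs a, ← sq_abs B]
  set A := |a|; set b := |B|
  have hA : 0 ≤ A := abs_nonneg _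
  have hb : 0 ≤ b := abs_nonneg _
  have h3 : 2 * (A * δ) * (e' * b) ≤ 1 / (2 * K) * (e' * b) ^ 2 + 2 * K * (A * δ) ^ 2 := by
    have h0 := sq_nonneg ((e' * b) - 2 * K * (A * δ))
    have : 0 ≤ 1 / (2 * K) * ((e' * b) - 2 * K * (A * δ)) ^ 2 := by positivity
    have e : 1 / (2 * K) * ((e' * b) - 2 * K * (A * δ)) ^ 2 = 1 / (2 * K) * (e' * b) ^ 2 + 2 * K * (A * δ) ^ 2 - 2 * (A * δ) * (e' * b) := by
      field_simp; ring
    linarith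
  have h4 : δ ^ 2 * (A * b) ≤ δ ^ 2 * (A ^ 2 + b ^ 2) := by
    apply mul_le_mul_of_nonneg_left _ (by positivity)
    nlinarith [sq_nonneg (A - b)]
  nlinarith

lemma caccioppoli (K : ℝ) (hK : 0 < K) (w : ℤ → ℤ → ℝ) (x y : ℤ) (R : ℕ) (hR : 1 ≤ R) (S : ℝ)
    (hq : ∀ p ∈ box x y (2 * R), QC K w p.1 p.2)
    (hS : ∀ p ∈ box x y (2 * R + 1), |d1 w p.1 p.2| ≤ S ∧ |d2 w p.1 p.2| ≤ S) :
    Phi w x y R ≤ 100 * K * (2 * K + 5) * S ^ 2 := by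
  have hS0 : 0 ≤ S := (abs_nonneg _).trans (hS (x, y) (by rw [mem_box]; constructor <;> constructor <;> push_cast <;> omega)).1
  have hR0 : (0:ℝ) < R := by exact_mod_cast hR
  set z : ℤ → ℤ → ℝ := fun i j => eta R x y i j ^ 2 with hz
  have z1 : ∀ i j, z i j = 0 ∨ (|i - x| < 2 * R ∧ |j - y| < 2 * R) := by
    intro i j
    by_cases h1 : |i - x| < 2 * R
    · by_cases h2 : |j - y| < 2 * R
      · exact Or.inr ⟨h1, h2⟩
      · left
        have : tau R (j - y) = 0 := tau_zero R hR0 _ (by push Not at h2; exact_mod_cast h2)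
        simp only [hz, eta]; rw [this, min_eq_right (tau_nonneg _ _)]; simp
    · left
      have : tau R (i - x) = 0 := tau_zero R hR0 _ (by push Not at h1; exact_mod_cast h1)
      simp only [hz, eta]; rw [this, min_eq_left (tau_nonneg _ _)]; simp
  have z0 : ∀ i j, 0 ≤ z i j := fun i j => sq_nonneg _
  have hx1 : ∀ j, z (x - 2 * R) j = 0 := by
    intro j; rcases z1 (x - 2 * R) j with h | ⟨h, _⟩
    · exact h
    · rw [abs_lt] at h; omega
  have hx2 : ∀ j, z (x + 2 * R + 1) j = 0 := by
    intro j; rcases z1 (x + 2 * R + 1) j with h | ⟨h, _⟩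
    · exact h
    · rw [abs_lt] at h; omega
  have hy1 : ∀ i, z i (y - 2 * R) = 0 := by
    intro i; rcases z1 i (y - 2 * R) with h | ⟨_, h⟩
    · exact h
    · rw [abs_lt] at h; omega
  have hy2 : ∀ i, z i (y + 2 * R + 1) = 0 := by
    intro i; rcases z1 i (y + 2 * R + 1) with h | ⟨_, h⟩
    · exact h
    · rw [abs_lt] at h; omega
  have hfl := flux_cut w z (x - 2 * R) (x + 2 * R) (y - 2 * R) (y + 2 * R) (by omega) (by omega) hx1 hx2 hy1 hy2
  set Q := Finset.Icc (x - 2 * (R:ℤ)) (x + 2 * R) ×ˢ Finset.Icc (y - 2 * (R:ℤ)) (y + 2 * R) with hQ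
  have hQb : Q = box x y (2 * R) := rfl
  -- bound on the right hand side
  set I := ∑ p ∈ Q, z p.1 p.2 * en w p.1 p.2 with hI
  have hI1 : I ≤ K * ∑ p ∈ Q, z p.1 p.2 * (gC w p.1 p.2 ^ 2 - gA w p.1 p.2 * gB w p.1 p.2) := by
    rw [hI, Finset.mul_sum]
    apply Finset.sum_le_sum
    intro p hp
    have := mul_le_mul_of_nonneg_left (hq p hp) (z0 p.1 p.2)

    linarith
  set T := (1 / (R:ℝ)) ^ 2 * (2 * (2 * K + 5) * S ^ 2) with hT
  have hpt : ∀ p ∈ Q, (d1 w p.1 p.2 * gB w (p.1+1) p.2 * (z (p.1+1) p.2 - z p.1 p.2)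
          - d1 w p.1 (p.2+1) * gC w p.1 p.2 * (z p.1 (p.2+1) - z p.1 p.2)) ≤
      1 / (2 * K) * (z (p.1+1) p.2 * gB w (p.1+1) p.2 ^ 2) + 1 / (2 * K) * (z p.1 p.2 * gC w p.1 p.2 ^ 2) + T := by
    rintro ⟨i, j⟩ hp
    rw [hQb, mem_box] at hp
    simp only at hp ⊢
    have c1 := cac_pt (d1 w i j) (gB w (i+1) j) (eta R x y i j) (eta R x y (i+1) j) (1 / R) K hK (eta_nonneg _ _ _ _ _) (eta_nonneg _ _ _ _ _) (eta_lip1 R hR0 x y i j)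
    have c2 := cac_pt (d1 w i (j+1)) (gC w i j) (eta R x y i (j+1)) (eta R x y i j) (1 / R) K hK (eta_nonneg _ _ _ _ _) (eta_nonneg _ _ _ _ _) (by rw [abs_sub_comm]; exact eta_lip2 R hR0 x y i j)
    have a1 := (hS (i, j) (by rw [mem_box]; simp only; omega)).1
    have a2 := (hS (i, j+1) (by rw [mem_box]; simp only; omega)).1
    have b1 := (hS (i+1, j) (by rw [mem_box]; simp only; omega)).2
    have b2 := (hS (i+1, j-1) (by rw [mem_box]; simp only; omega)).2
    simp only at a1 a2 b1 b2
    have eB : gB w (i+1) j = d2 w (i+1) j - d2 w (i+1) (j-1) := by simp only [gB, d2, sub_add_cancel]; ring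
    have eC : gC w i j = d1 w i (j+1) - d1 w i j := by simp only [gC, d1]; ring
    have hB : gB w (i+1) j ^ 2 ≤ (2 * S) ^ 2 := by
      apply sq_le_sq'
      · rw [eB]; linarith [(abs_le.1 b1).1, (abs_le.1 b2).2]
      · rw [eB]; linarith [(abs_le.1 b1).2, (abs_le.1 b2).1]
    have hC : gC w i j ^ 2 ≤ (2 * S) ^ 2 := by
      apply sq_le_sq'
      · rw [eC]; linarith [(abs_le.1 a1).2, (abs_le.1 a2).1]
      · rw [eC]; linarith [(abs_le.1 a1).1, (abs_le.1 a2).2]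
    have ha1 : d1 w i j ^ 2 ≤ S ^ 2 := sq_le_sq' (by linarith [(abs_le.1 a1).1]) (abs_le.1 a1).2
    have ha2 : d1 w i (j+1) ^ 2 ≤ S ^ 2 := sq_le_sq' (by linarith [(abs_le.1 a2).1]) (abs_le.1 a2).2
    have t1 : (1 / (R:ℝ)) ^ 2 * ((2 * K + 1) * d1 w i j ^ 2 + gB w (i+1) j ^ 2) ≤ (1 / (R:ℝ)) ^ 2 * ((2 * K + 5) * S ^ 2) := by
      apply mul_le_mul_of_nonneg_left _ (by positivity)
      have := mul_le_mul_of_nonneg_left ha1 (show 0 ≤ 2 * K + 1 by positivity)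
      linarith
    have t2 : (1 / (R:ℝ)) ^ 2 * ((2 * K + 1) * d1 w i (j+1) ^ 2 + gC w i j ^ 2) ≤ (1 / (R:ℝ)) ^ 2 * ((2 * K + 5) * S ^ 2) := by
      apply mul_le_mul_of_nonneg_left _ (by positivity)
      have := mul_le_mul_of_nonneg_left ha2 (show 0 ≤ 2 * K + 1 by positivity)
      linarith
    have u1 := (le_abs_self _).trans c1
    have u2 := (le_abs_self _).trans c2
    have e2 : d1 w i (j+1) * gC w i j * (eta R x y i j ^ 2 - eta R x y i (j+1) ^ 2) = - (d1 w i (j+1) * gC w i j * (z i (j+1) - z i j)) := by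
      simp only [hz]; ring
    rw [e2] at u2
    simp only [hz] at u1 u2 ⊢
    rw [hT]
    linarith
  have hshift : ∑ p ∈ Q, z (p.1+1) p.2 * gB w (p.1+1) p.2 ^ 2 = ∑ p ∈ Q, z p.1 p.2 * gB w p.1 p.2 ^ 2 := by
    rw [← sub_eq_zero, ← Finset.sum_sub_distrib, hQ, Finset.sum_product_right]
    apply Finset.sum_eq_zero
    intro j _
    have := tele (fun i => z i j * gB w i j ^ 2) (x - 2 * R) (x + 2 * R) (by omega)
    simp only at this ⊢
    rw [this, hx1, hx2]; ring
  have hI2 : K * ∑ p ∈ Q, z p.1 p.2 * (gC w p.1 p.2 ^ 2 - gA w p.1 p.2 * gB w p.1 p.2) ≤ 1 / 2 * I + K * (Q.card * T) := by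
    rw [hfl]
    have h := Finset.sum_le_sum hpt
    rw [Finset.sum_add_distrib, Finset.sum_add_distrib, ← Finset.mul_sum, ← Finset.mul_sum, hshift, Finset.sum_const, nsmul_eq_mul, ← mul_add, ← Finset.sum_add_distrib] at h
    have h' : ∑ p ∈ Q, (z p.1 p.2 * gB w p.1 p.2 ^ 2 + z p.1 p.2 * gC w p.1 p.2 ^ 2) ≤ I := by
      apply Finset.sum_le_sum
      intro p _
      have : gB w p.1 p.2 ^ 2 + gC w p.1 p.2 ^ 2 ≤ en w p.1 p.2 := by
        unfold en; nlinarith [sq_nonneg (gA w p.1 p.2), sq_nonneg (gC w p.1 p.2)]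
      have := mul_le_mul_of_nonneg_left this (z0 p.1 p.2)
      linarith
    have h2 := mul_le_mul_of_nonneg_left h hK.le
    refine h2.trans ?_
    have h3 : K * (1 / (2 * K) * ∑ p ∈ Q, (z p.1 p.2 * gB w p.1 p.2 ^ 2 + z p.1 p.2 * gC w p.1 p.2 ^ 2)) = 1 / 2 * ∑ p ∈ Q, (z p.1 p.2 * gB w p.1 p.2 ^ 2 + z p.1 p.2 * gC w p.1 p.2 ^ 2) := by
      field_simp
    rw [mul_add, h3]
    linarith
  have hcard : (Q.card : ℝ) ≤ 25 * R ^ 2 := by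
    rw [hQ, Finset.card_product, Int.card_Icc, Int.card_Icc]
    have e1 : (x + 2 * (R:ℤ) + 1 - (x - 2 * R)).toNat = 4 * R + 1 := by omega
    have e2 : (y + 2 * (R:ℤ) + 1 - (y - 2 * R)).toNat = 4 * R + 1 := by omega
    rw [e1, e2]
    have : (4 * R + 1) * (4 * R + 1) ≤ 25 * R ^ 2 := by nlinarith
    exact_mod_cast this
  have hlow : Phi w x y R ≤ I := by
    unfold Phi
    calc ∑ p ∈ box x y R, en w p.1 p.2 = ∑ p ∈ box x y R, z p.1 p.2 * en w p.1 p.2 := by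
          apply Finset.sum_congr rfl
          intro p hp
          rw [mem_box] at hp
          have h1 : tau R (p.1 - x) = 1 := tau_one R hR0 _ (by
            have : |p.1 - x| ≤ R := by rw [abs_le]; omega
            exact_mod_cast this)
          have h2 : tau R (p.2 - y) = 1 := tau_one R hR0 _ (by
            have : |p.2 - y| ≤ R := by rw [abs_le]; omega
            exact_mod_cast this)
          simp [hz, eta, h1, h2]
      _ ≤ I := by
          apply Finset.sum_le_sum_of_subset_of_nonneg
          · rw [hQb]; intro p; simp only [mem_box]; omega
          · intro p _ _; exact mul_nonneg (z0 _ _) (en_nonneg _ _ _)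
  have hT0 : 0 ≤ T := by positivity
  have hfin : (Q.card:ℝ) * T ≤ 25 * R ^ 2 * T := mul_le_mul_of_nonneg_right hcard hT0
  have hTe : 25 * (R:ℝ) ^ 2 * T = 50 * (2 * K + 5) * S ^ 2 := by
    rw [hT]; field_simp; ring
  have := mul_le_mul_of_nonneg_left hfin hK.le
  rw [hTe] at this
  linarith

def sqr (x y n : ℤ) : Finset (ℤ × ℤ) := Finset.Icc x (x + n - 1) ×ˢ Finset.Icc y (y + n - 1)

def avg (f : ℤ → ℤ → ℝ) (x y n : ℤ) : ℝ := (∑ p ∈ sqr x y n, f p.1 p.2) / (n:ℝ) ^ 2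

def Ef (f : ℤ → ℤ → ℝ) (x y n : ℤ) : ℝ :=
  ∑ p ∈ sqr x y n, |d1 f p.1 p.2| + ∑ p ∈ sqr x y n, |d2 f p.1 p.2|

lemma card_seg (x n : ℤ) (hn : 0 ≤ n) : ((Finset.Icc x (x + n - 1)).card : ℝ) = n := by
  rw [Int.card_Icc, show x + n - 1 + 1 - x = n by ring]
  have : ((n.toNat : ℤ) : ℝ) = (n : ℝ) := by rw [Int.toNat_of_nonneg hn]
  rw [← this]; exact (Int.cast_natCast _).symm

lemma card_sq (x y n : ℤ) (hn : 0 ≤ n) : ((sqr x y n).card : ℝ) = (n:ℝ) ^ 2 := by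
  rw [sqr, Finset.card_product, Nat.cast_mul, card_seg _ _ hn, card_seg _ _ hn]; ring

lemma walk' (G : ℤ → ℝ) (m n i j : ℤ) (hi : m ≤ i) (hi' : i ≤ n + 1) (hj : m ≤ j) (hj' : j ≤ n + 1) :
    |G i - G j| ≤ ∑ l ∈ Finset.Icc m n, |G (l+1) - G l| := by
  rcases le_total i j with h | h
  · rw [abs_sub_comm]; exact walk G m n i j hi h hj'
  · exact walk G m n j i hj h hi'

lemma poincare (f : ℤ → ℤ → ℝ) (x y n x' y' m : ℤ) (hm : 1 ≤ m) (hx : x ≤ x') (hx' : x' + m ≤ x + n)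
    (hy : y ≤ y') (hy' : y' + m ≤ y + n) :
    |avg f x' y' m - avg f x y n| ≤ Ef f x y n / m := by
  have hmn : m ≤ n := by omega
  have hm0 : (0:ℝ) < m := by exact_mod_cast (by omega : 0 < m)
  have hn0 : (0:ℝ) < n := by exact_mod_cast (by omega : 0 < n)
  have hmn' : (m:ℝ) ≤ n := by exact_mod_cast hmn
  set E1 := ∑ p ∈ sqr x y n, |d1 f p.1 p.2| with hE1
  set E2 := ∑ p ∈ sqr x y n, |d2 f p.1 p.2| with hE2
  have hE2' : 0 ≤ E2 := Finset.sum_nonneg fun _ _ => abs_nonneg _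
  set Rw : ℤ → ℝ := fun j => ∑ i ∈ Finset.Icc x (x + n - 1), |d1 f i j| with hRw
  set Cl : ℤ → ℝ := fun i => ∑ j ∈ Finset.Icc y (y + n - 1), |d2 f i j| with hCl
  have hsum : (m:ℝ) ^ 2 * (n:ℝ) ^ 2 * (avg f x' y' m - avg f x y n)
      = ∑ p ∈ sqr x' y' m, ∑ q ∈ sqr x y n, (f p.1 p.2 - f q.1 q.2) := by
    simp only [Finset.sum_sub_distrib, Finset.sum_const, nsmul_eq_mul, ← Finset.mul_sum]
    rw [card_sq _ _ _ (by omega), card_sq _ _ _ (by omega)]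
    unfold avg
    field_simp
  have hpt : ∀ p ∈ sqr x' y' m, ∀ q ∈ sqr x y n, |f p.1 p.2 - f q.1 q.2| ≤ Rw p.2 + Cl q.1 := by
    intro p hp q hq
    simp only [sqr, Finset.mem_product, Finset.mem_Icc] at hp hq
    refine (abs_sub_le _ (f q.1 p.2) _).trans (add_le_add ?_ ?_)
    · exact walk' (fun i => f i p.2) x (x + n - 1) p.1 q.1 (by omega) (by omega) (by omega) (by omega)
    · exact walk' (fun j => f q.1 j) y (y + n - 1) p.2 q.2 (by omega) (by omega) (by omega) (by omega)
  have s1 : ∑ p ∈ sqr x' y' m, Rw p.2 ≤ m * E1 := by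
    rw [sqr, Finset.sum_product]
    simp only [Finset.sum_const, nsmul_eq_mul]
    rw [card_seg _ _ (by omega)]
    apply mul_le_mul_of_nonneg_left _ hm0.le
    rw [hE1, sqr, Finset.sum_product_right]
    apply Finset.sum_le_sum_of_subset_of_nonneg
    · intro z; simp only [Finset.mem_Icc]; omega
    · intros; exact Finset.sum_nonneg fun _ _ => abs_nonneg _
  have s2 : ∑ q ∈ sqr x y n, Cl q.1 = n * E2 := by
    rw [sqr, Finset.sum_product_right]
    simp only [Finset.sum_const, nsmul_eq_mul]
    rw [card_seg _ _ (by omega), hE2, sqr, Finset.sum_product]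
  have hb : |∑ p ∈ sqr x' y' m, ∑ q ∈ sqr x y n, (f p.1 p.2 - f q.1 q.2)| ≤ (n:ℝ) ^ 2 * (m * E1) + (m:ℝ) ^ 2 * (n * E2) := by
    calc _ ≤ ∑ p ∈ sqr x' y' m, ∑ q ∈ sqr x y n, |f p.1 p.2 - f q.1 q.2| :=
          (Finset.abs_sum_le_sum_abs _ _).trans (Finset.sum_le_sum fun p _ => Finset.abs_sum_le_sum_abs _ _)
      _ ≤ ∑ p ∈ sqr x' y' m, ∑ q ∈ sqr x y n, (Rw p.2 + Cl q.1) :=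
          Finset.sum_le_sum fun p hp => Finset.sum_le_sum fun q hq => hpt p hp q hq
      _ = (n:ℝ) ^ 2 * ∑ p ∈ sqr x' y' m, Rw p.2 + (m:ℝ) ^ 2 * (n * E2) := by
          simp only [Finset.sum_add_distrib, Finset.sum_const, nsmul_eq_mul, ← Finset.mul_sum]
          rw [card_sq _ _ _ (by omega), card_sq _ _ _ (by omega), s2]
      _ ≤ _ := by
          have := mul_le_mul_of_nonneg_left s1 (by positivity : 0 ≤ (n:ℝ) ^ 2)
          linarith
  rw [← hsum, abs_mul, abs_of_pos (by positivity)] at hb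
  have hfin : (m:ℝ) ^ 2 * (n:ℝ) ^ 2 * |avg f x' y' m - avg f x y n| ≤ (m:ℝ) ^ 2 * (n:ℝ) ^ 2 * (Ef f x y n / m) := by
    refine hb.trans ?_
    have : (m:ℝ) ^ 2 * (n:ℝ) ^ 2 * (Ef f x y n / m) = (n:ℝ) ^ 2 * (m * E1) + m * n * (n * E2) := by
      unfold Ef; rw [← hE1, ← hE2]; field_simp
    rw [this]
    have h1 : (m:ℝ) ^ 2 ≤ m * n := by nlinarith
    have := mul_le_mul_of_nonneg_right h1 (by positivity : 0 ≤ n * E2)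
    linarith
  exact le_of_mul_le_mul_left hfin (by positivity)

lemma camp (f : ℤ → ℤ → ℝ) (β T : ℝ) (hβ : 0 < β) (hβ1 : β < 1) (hT : 0 ≤ T) (n : ℕ) (x0 y0 : ℤ)
    (hE : ∀ l : ℕ, l ≤ n → ∀ x y : ℤ, |x - x0| ≤ 2 ^ n → |y - y0| ≤ 2 ^ n →
      Ef f x y (2 ^ l) ≤ 2 ^ l * (T * β ^ (n - l)))
    (j : ℕ) (hj : j + 1 ≤ n) (x y : ℤ) (hx : |x - x0| ≤ 2 ^ j) (hy : |y - y0| ≤ 2 ^ j) :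
    |f x y - f x0 y0| ≤ (4 / (1 - β) + 4 / β) * T * β ^ (n - j) := by
  have h1β : 0 < 1 - β := by linarith
  have step : ∀ l : ℕ, l + 1 ≤ n → ∀ a b c d : ℤ, |c - x0| ≤ 2 ^ n → |d - y0| ≤ 2 ^ n →
      c ≤ a → a ≤ c + 2 ^ l → d ≤ b → b ≤ d + 2 ^ l →
      |avg f a b (2 ^ l) - avg f c d (2 ^ (l+1))| ≤ 2 * T * β ^ (n - l - 1) := by
    intro l hl a b c d hc hd h1 h2 h3 h4
    have e : (2:ℤ) ^ (l+1) = 2 ^ l + 2 ^ l := by ring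
    have hp := poincare f c d (2 ^ (l+1)) a b (2 ^ l) (one_le_pow₀ (by norm_num)) h1 (by omega) h3 (by omega)
    refine hp.trans ?_
    push_cast
    rw [div_le_iff₀ (by positivity)]
    have := hE (l+1) hl c d hc hd
    refine this.trans (le_of_eq ?_)
    rw [show n - (l+1) = n - l - 1 by omega]; ring
  have chain : ∀ l : ℕ, l ≤ n → ∀ a b : ℤ, |a - x0| ≤ 2 ^ n → |b - y0| ≤ 2 ^ n →
      |f a b - avg f a b (2 ^ l)| ≤ 2 * T / (1 - β) * β ^ (n - l) := by
    intro l
    induction l with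
    | zero =>
      intro _ a b _ _
      have : avg f a b (2 ^ 0) = f a b := by simp [avg, sqr]
      rw [this, sub_self, abs_zero]; positivity
    | succ l ih =>
      intro hl a b ha hb
      have h1 := ih (by omega) a b ha hb
      have hp : (0:ℤ) ≤ 2 ^ l := by positivity
      have h2 := step l hl a b a b ha hb le_rfl (by omega) le_rfl (by omega)
      refine (abs_sub_le _ (avg f a b (2 ^ l)) _).trans ((add_le_add h1 h2).trans (le_of_eq ?_))
      rw [show n - l = (n - l - 1) + 1 by omega, show n - (l + 1) = n - l - 1 by omega, pow_succ]
      simp only [Nat.add_sub_cancel]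
      field_simp; ring
  have hjn : (2:ℤ) ^ j ≤ 2 ^ n := pow_le_pow_right₀ (by norm_num) (by omega)
  have hpj : (0:ℤ) < 2 ^ j := by positivity
  rw [abs_le] at hx hy
  have c1 := chain j (by omega) x y (by rw [abs_le]; omega) (by rw [abs_le]; omega)
  have c2 := chain j (by omega) x0 y0 (by rw [abs_le]; omega) (by rw [abs_le]; omega)
  have s1 := step j hj x y (min x x0) (min y y0) (by rw [abs_le]; omega) (by rw [abs_le]; omega) (by omega) (by omega) (by omega) (by omega)
  have s2 := step j hj x0 y0 (min x x0) (min y y0) (by rw [abs_le]; omega) (by rw [abs_le]; omega) (by omega) (by omega) (by omega) (by omega)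
  rw [abs_le] at c1 c2 s1 s2
  have hfin : 2 * (2 * T / (1 - β) * β ^ (n - j)) + 2 * (2 * T * β ^ (n - j - 1)) = (4 / (1 - β) + 4 / β) * T * β ^ (n - j) := by
    rw [show n - j = (n - j - 1) + 1 by omega, pow_succ]
    simp only [Nat.add_sub_cancel]
    field_simp; ring
  rw [← hfin, abs_le]
  constructor <;> linarith

lemma cs_sq (f : ℤ → ℤ → ℝ) (x y n : ℤ) (hn : 0 ≤ n) (P : ℝ) (hP : 0 ≤ P)
    (h : ∑ p ∈ sqr x y n, f p.1 p.2 ^ 2 ≤ P ^ 2) : ∑ p ∈ sqr x y n, |f p.1 p.2| ≤ n * P := by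
  have h1 := sq_sum_le_card_mul_sum_sq (s := sqr x y n) (f := fun p => |f p.1 p.2|)
  simp only [sq_abs] at h1
  rw [card_sq _ _ _ hn] at h1
  have hn' : (0:ℝ) ≤ n := by exact_mod_cast hn
  apply abs_le_of_sq_le_sq' _ (by positivity) |>.2
  refine h1.trans ?_
  rw [mul_pow]
  exact mul_le_mul_of_nonneg_left h (by positivity)

lemma sq_shift_le (w : ℤ → ℤ → ℝ) (g : ℤ → ℤ → ℝ) (x y n a b : ℤ) (ha : 0 ≤ a ∧ a ≤ 1) (hb : 0 ≤ b ∧ b ≤ 1)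
    (hg : ∀ i j, g i j ^ 2 ≤ en w (i + a) (j + b)) :
    ∑ p ∈ sqr x y n, g p.1 p.2 ^ 2 ≤ Phi w x y n := by
  calc ∑ p ∈ sqr x y n, g p.1 p.2 ^ 2 ≤ ∑ p ∈ sqr x y n, en w (p.1 + a) (p.2 + b) :=
        Finset.sum_le_sum fun p _ => hg _ _
    _ = ∑ p ∈ (sqr x y n).map ⟨fun p => (p.1 + a, p.2 + b), by
          intro p q h; simp only [Prod.mk.injEq, add_left_inj] at h; exact Prod.ext h.1 h.2⟩, en w p.1 p.2 := by
        rw [Finset.sum_map]; rfl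
    _ ≤ Phi w x y n := by
        apply Finset.sum_le_sum_of_subset_of_nonneg
        · intro p hp
          rw [Finset.mem_map] at hp
          obtain ⟨q, hq, rfl⟩ := hp
          simp only [sqr, Finset.mem_product, Finset.mem_Icc] at hq
          change (q.1 + a, q.2 + b) ∈ _
          rw [mem_box]; dsimp only; omega
        · intros; exact en_nonneg _ _ _

/-- Hölder estimate for a first difference `f` of `w` -/
lemma holder_w (K θ β : ℝ) (hK : 1 ≤ K) (hθ : θ = 256 * K / (1 + 256 * K)) (hβ : 0 < β) (hβ1 : β < 1)
    (hβθ : β ^ 2 = θ) (w f : ℤ → ℤ → ℝ) (x0 y0 : ℤ) (n : ℕ) (S : ℝ)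
    (hq : ∀ p ∈ box x0 y0 (2 ^ (n+2)), QC K w p.1 p.2)
    (hS : ∀ p ∈ box x0 y0 (2 ^ (n+2) + 1), |d1 w p.1 p.2| ≤ S ∧ |d2 w p.1 p.2| ≤ S)
    (hf : f = d1 w ∨ f = d2 w)
    (j : ℕ) (hj : j + 1 ≤ n) (x y : ℤ) (hx : |x - x0| ≤ 2 ^ j) (hy : |y - y0| ≤ 2 ^ j) :
    |f x y - f x0 y0| ≤ (4 / (1 - β) + 4 / β) * (2 * (1 + 100 * K * (2 * K + 5)) / β) * S * β ^ (n - j) := by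
  have hS0 : 0 ≤ S := (abs_nonneg _).trans (hS (x0, y0) (by
    rw [mem_box]
    have : (0:ℤ) < 2 ^ (n+2) := by positivity
    simp only; omega)).1
  set B := 1 + 100 * K * (2 * K + 5) with hB
  have hB1 : 1 ≤ B := by rw [hB]; nlinarith
  have hcac : Phi w x0 y0 (2 ^ (n+1)) ≤ (B * S) ^ 2 := by
    have e : (2:ℤ) * ((2 ^ (n+1) : ℕ) : ℤ) = 2 ^ (n+2) := by push_cast; ring
    have h := caccioppoli K (by linarith) w x0 y0 (2 ^ (n+1)) Nat.one_le_two_pow S (by rw [e]; exact hq) (by rw [e]; exact hS)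
    push_cast at h
    refine h.trans ?_
    rw [mul_pow]
    apply mul_le_mul_of_nonneg_right _ (sq_nonneg _)
    nlinarith
  have main : ∀ l : ℕ, l ≤ n → ∀ x y : ℤ, |x - x0| ≤ 2 ^ n → |y - y0| ≤ 2 ^ n →
      Phi w x y (2 ^ l) ≤ (B * S / β * β ^ (n - l)) ^ 2 := by
    intro l hl x y hx hy
    rw [abs_le] at hx hy
    have e : (2:ℤ) ^ (n+1) = 2 * 2 ^ n := by ring
    have e2 : (2:ℤ) ^ (n+2) = 4 * 2 ^ n := by ring
    have hp : (0:ℤ) < 2 ^ n := by positivity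
    have hbig : Phi w x y (2 ^ n) ≤ (B * S) ^ 2 := by
      refine (Phi_mono w ?_).trans hcac
      intro p; simp only [mem_box]; omega
    have hdec : Phi w x y (2 ^ l) ≤ θ ^ (n - l - 1) * (B * S) ^ 2 := by
      rcases Nat.lt_or_ge l n with h | h
      · refine (Phi_decay K θ (by linarith) hθ w x y n ?_ l h).trans ?_
        · intro p hp'
          apply hq
          rw [mem_box] at hp' ⊢; omega
        · apply mul_le_mul_of_nonneg_left hbig
          rw [← hβθ]; positivity
      · have : l = n := le_antisymm hl h
        subst this
        simpa using hbig
    refine hdec.trans ?_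
    rw [← hβθ, ← pow_mul, mul_comm 2, pow_mul, ← mul_pow]
    apply pow_le_pow_left₀ (by positivity)
    rcases Nat.lt_or_ge l n with h | h
    · rw [show n - l = (n - l - 1) + 1 by omega, pow_succ]
      simp only [Nat.add_sub_cancel]
      apply le_of_eq; field_simp
    · have : n - l = 0 := by omega
      rw [this]; simp only [Nat.zero_sub, pow_zero, one_mul, mul_one]
      rw [le_div_iff₀ hβ]
      have : 0 ≤ B * S := by positivity
      nlinarith
  have hE : ∀ l : ℕ, l ≤ n → ∀ x y : ℤ, |x - x0| ≤ 2 ^ n → |y - y0| ≤ 2 ^ n →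
      Ef f x y (2 ^ l) ≤ 2 ^ l * ((2 * B / β * S) * β ^ (n - l)) := by
    intro l hl x y hx hy
    have hm := main l hl x y hx hy
    have hp : (0:ℤ) ≤ 2 ^ l := by positivity
    have h1 : ∑ p ∈ sqr x y (2 ^ l), d1 f p.1 p.2 ^ 2 ≤ Phi w x y (2 ^ l) := by
      rcases hf with rfl | rfl
      · apply sq_shift_le w _ x y _ 1 0 (by norm_num) (by norm_num)
        intro i j
        refine le_trans (le_of_eq ?_) (sq_le_en w _ _).1
        simp only [d1, gA, add_sub_cancel_right, add_zero]; ring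
      · apply sq_shift_le w _ x y _ 0 0 (by norm_num) (by norm_num)
        intro i j
        refine le_trans (le_of_eq ?_) (sq_le_en w _ _).2.2
        simp only [d1, d2, gC, add_zero]; ring
    have h2 : ∑ p ∈ sqr x y (2 ^ l), d2 f p.1 p.2 ^ 2 ≤ Phi w x y (2 ^ l) := by
      rcases hf with rfl | rfl
      · apply sq_shift_le w _ x y _ 0 0 (by norm_num) (by norm_num)
        intro i j
        refine le_trans (le_of_eq ?_) (sq_le_en w _ _).2.2
        simp only [d1, d2, gC, add_zero]; ring
      · apply sq_shift_le w _ x y _ 0 1 (by norm_num) (by norm_num)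
        intro i j
        refine le_trans (le_of_eq ?_) (sq_le_en w _ _).2.1
        simp only [d2, gB, add_sub_cancel_right, add_zero]; ring
    have p0 : 0 ≤ B * S / β * β ^ (n - l) := by positivity
    have c1 := cs_sq (d1 f) x y _ hp _ p0 (h1.trans hm)
    have c2 := cs_sq (d2 f) x y _ hp _ p0 (h2.trans hm)
    unfold Ef
    push_cast at c1 c2
    refine (add_le_add c1 c2).trans (le_of_eq ?_)
    ring
  have := camp f β (2 * B / β * S) hβ hβ1 (by positivity) n x0 y0 hE j hj x y hx hy
  refine this.trans (le_of_eq ?_)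
  ring

def hm (v : ℤ → ℤ → ℝ) (i j : ℤ) : ℝ := |d1 (d1 v) i j| + |d1 (d2 v) i j| + |d2 (d2 v) i j|

lemma d21 (v : ℤ → ℤ → ℝ) : d2 (d1 v) = d1 (d2 v) := by
  funext i j; simp only [d1, d2]; ring

lemma hm_nonneg (v : ℤ → ℤ → ℝ) (i j : ℤ) : 0 ≤ hm v i j := by unfold hm; positivity

lemma hm_le (v : ℤ → ℤ → ℝ) (i j : ℤ) (m : ℝ)
    (h : ∀ a b : ℤ, 0 ≤ a → a ≤ 2 → 0 ≤ b → b ≤ 2 → |v (i+a) (j+b)| ≤ m) : hm v i j ≤ 12 * m := by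
  have h00 := abs_le.1 (h 0 0 (by norm_num) (by norm_num) (by norm_num) (by norm_num))
  have h10 := abs_le.1 (h 1 0 (by norm_num) (by norm_num) (by norm_num) (by norm_num))
  have h20 := abs_le.1 (h 2 0 (by norm_num) (by norm_num) (by norm_num) (by norm_num))
  have h01 := abs_le.1 (h 0 1 (by norm_num) (by norm_num) (by norm_num) (by norm_num))
  have h11 := abs_le.1 (h 1 1 (by norm_num) (by norm_num) (by norm_num) (by norm_num))
  have h02 := abs_le.1 (h 0 2 (by norm_num) (by norm_num) (by norm_num) (by norm_num))
  simp only [add_zero] at *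
  have e1 : |d1 (d1 v) i j| ≤ 4 * m := by
    simp only [d1, show i + 1 + 1 = i + 2 by ring]; rw [abs_le]; constructor <;> linarith
  have e2 : |d1 (d2 v) i j| ≤ 4 * m := by
    simp only [d1, d2]; rw [abs_le]; constructor <;> linarith
  have e3 : |d2 (d2 v) i j| ≤ 4 * m := by
    simp only [d2, show j + 1 + 1 = j + 2 by ring]; rw [abs_le]; constructor <;> linarith
  unfold hm; linarith

/-- summing second differences -/
lemma sum2 (G : ℤ → ℤ → ℝ) (l : ℕ) :
    ∑ a ∈ Finset.range l, ∑ b ∈ Finset.range l, (G (a+1) (b+1) - G a (b+1) - G (a+1) b + G a b)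
      = G l l - G 0 l - G l 0 + G 0 0 := by
  have h1 : ∀ a : ℕ, ∑ b ∈ Finset.range l, (G (a+1) (b+1) - G a (b+1) - G (a+1) b + G a b)
      = (G (a+1) l - G a l) - (G (a+1) 0 - G a 0) := by
    intro a
    have := Finset.sum_range_sub (fun b : ℕ => G (a+1) b - G a b) l
    push_cast at this
    rw [← this]
    apply Finset.sum_congr rfl; intros; ring
  simp only [h1]
  have := Finset.sum_range_sub (fun a : ℕ => G a l - G a 0) l
  push_cast at this
  rw [show G l l - G 0 l - G l 0 + G 0 0 = G l l - G l 0 - (G 0 l - G 0 0) by ring, ← this]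
  apply Finset.sum_congr rfl; intros; ring

lemma interp_gen (G : ℤ → ℤ → ℝ) (l : ℕ) (m ω h0 : ℝ)
    (hG : |G l l| ≤ m ∧ |G 0 l| ≤ m ∧ |G l 0| ≤ m ∧ |G 0 0| ≤ m)
    (h : ∀ a b : ℕ, a < l → b < l → |(G (a+1) (b+1) - G a (b+1) - G (a+1) b + G a b) - h0| ≤ ω) :
    (l:ℝ)^2 * |h0| ≤ 4 * m + (l:ℝ)^2 * ω := by
  have e := sum2 G l
  have e2 : ∑ a ∈ Finset.range l, ∑ b ∈ Finset.range l, ((G (a+1) (b+1) - G a (b+1) - G (a+1) b + G a b) - h0)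
      = (G l l - G 0 l - G l 0 + G 0 0) - (l:ℝ)^2 * h0 := by
    rw [← e]; simp only [Finset.sum_sub_distrib, Finset.sum_const, Finset.card_range, nsmul_eq_mul]; ring
  have e3 : |∑ a ∈ Finset.range l, ∑ b ∈ Finset.range l, ((G (a+1) (b+1) - G a (b+1) - G (a+1) b + G a b) - h0)| ≤ (l:ℝ)^2 * ω := by
    calc _ ≤ ∑ a ∈ Finset.range l, ∑ b ∈ Finset.range l, |(G (a+1) (b+1) - G a (b+1) - G (a+1) b + G a b) - h0| :=
          (Finset.abs_sum_le_sum_abs _ _).trans (Finset.sum_le_sum fun p _ => Finset.abs_sum_le_sum_abs _ _)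
      _ ≤ ∑ a ∈ Finset.range l, ∑ b ∈ Finset.range l, ω :=
          Finset.sum_le_sum fun a ha => Finset.sum_le_sum fun b hb => h a b (Finset.mem_range.1 ha) (Finset.mem_range.1 hb)
      _ = _ := by simp only [Finset.sum_const, Finset.card_range, nsmul_eq_mul]; ring
  rw [e2] at e3
  rw [abs_le] at e3
  obtain ⟨g1, g2, g3, g4⟩ := hG
  rw [abs_le] at g1 g2 g3 g4
  rw [show (l:ℝ)^2 * |h0| = |(l:ℝ)^2 * h0| by rw [abs_mul, abs_of_nonneg (sq_nonneg (l:ℝ))], abs_le]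
  constructor <;> linarith

def isH (v f : ℤ → ℤ → ℝ) : Prop := f = d1 (d1 v) ∨ f = d1 (d2 v) ∨ f = d2 (d2 v)

lemma interp (v f : ℤ → ℤ → ℝ) (hf : isH v f) (x y : ℤ) (l : ℕ) (m ω : ℝ)
    (hv : ∀ p ∈ box x y (2 * l), |v p.1 p.2| ≤ m)
    (h : ∀ a b : ℤ, |a - x| ≤ 2 * l → |b - y| ≤ 2 * l → |f a b - f x y| ≤ ω) :
    (l:ℝ)^2 * |f x y| ≤ 4 * m + (l:ℝ)^2 * ω := by
  have hv' : ∀ a b : ℤ, 0 ≤ a → a ≤ 2 * l → 0 ≤ b → b ≤ 2 * l → |v (x+a) (y+b)| ≤ m := by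
    intro a b h1 h2 h3 h4
    apply hv (x+a, y+b); rw [mem_box]; dsimp only; omega
  rcases hf with rfl | rfl | rfl
  · apply interp_gen (fun a b => v (x + (a + b)) (y + 0))
    · refine ⟨hv' _ _ ?_ ?_ ?_ ?_, hv' _ _ ?_ ?_ ?_ ?_, hv' _ _ ?_ ?_ ?_ ?_, hv' _ _ ?_ ?_ ?_ ?_⟩ <;> omega
    · intro a b ha hb
      refine le_trans (le_of_eq ?_) (h (x + (a + b)) (y + 0) (by rw [abs_le]; omega) (by rw [abs_le]; omega))
      congr 2
      simp only [d1, add_zero]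
      rw [show x + (a + b : ℤ) + 1 + 1 = x + (a + 1 + (b + 1)) by ring, show x + (a + 1 + (b:ℤ)) = x + (a + b : ℤ) + 1 by ring,
        show x + ((a:ℤ) + (b + 1)) = x + (a + b : ℤ) + 1 by ring]
      ring
  · apply interp_gen (fun a b => v (x + a) (y + b))
    · refine ⟨hv' _ _ ?_ ?_ ?_ ?_, hv' _ _ ?_ ?_ ?_ ?_, hv' _ _ ?_ ?_ ?_ ?_, hv' _ _ ?_ ?_ ?_ ?_⟩ <;> omega
    · intro a b ha hb
      refine le_trans (le_of_eq ?_) (h (x + a) (y + b) (by rw [abs_le]; omega) (by rw [abs_le]; omega))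
      congr 2
      simp only [d1, d2, add_assoc]
      ring
  · apply interp_gen (fun a b => v (x + 0) (y + (a + b)))
    · refine ⟨hv' _ _ ?_ ?_ ?_ ?_, hv' _ _ ?_ ?_ ?_ ?_, hv' _ _ ?_ ?_ ?_ ?_, hv' _ _ ?_ ?_ ?_ ?_⟩ <;> omega
    · intro a b ha hb
      refine le_trans (le_of_eq ?_) (h (x + 0) (y + (a + b)) (by rw [abs_le]; omega) (by rw [abs_le]; omega))
      congr 2
      simp only [d2, add_zero]
      rw [show y + (a + b : ℤ) + 1 + 1 = y + (a + 1 + (b + 1)) by ring, show y + (a + 1 + (b:ℤ)) = y + (a + b : ℤ) + 1 by ring,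
        show y + ((a:ℤ) + (b + 1)) = y + (a + b : ℤ) + 1 by ring]
      ring

lemma isH_le_hm (v f : ℤ → ℤ → ℝ) (hf : isH v f) (i j : ℤ) : |f i j| ≤ hm v i j := by
  have h1 := abs_nonneg (d1 (d1 v) i j)
  have h2 := abs_nonneg (d1 (d2 v) i j)
  have h3 := abs_nonneg (d2 (d2 v) i j)
  unfold hm
  rcases hf with rfl | rfl | rfl <;> linarith

lemma holder_H (K θ β : ℝ) (hK : 1 ≤ K) (hθ : θ = 256 * K / (1 + 256 * K)) (hβ : 0 < β) (hβ1 : β < 1)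
    (hβθ : β ^ 2 = θ) (v f : ℤ → ℤ → ℝ) (hf : isH v f) (x0 y0 : ℤ) (n : ℕ) (S : ℝ)
    (hq1 : ∀ p ∈ box x0 y0 (2 ^ (n+2)), QC K (d1 v) p.1 p.2)
    (hq2 : ∀ p ∈ box x0 y0 (2 ^ (n+2)), QC K (d2 v) p.1 p.2)
    (hS : ∀ p ∈ box x0 y0 (2 ^ (n+2) + 1), hm v p.1 p.2 ≤ S)
    (j : ℕ) (hj : j + 1 ≤ n) (x y : ℤ) (hx : |x - x0| ≤ 2 ^ j) (hy : |y - y0| ≤ 2 ^ j) :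
    |f x y - f x0 y0| ≤ (4 / (1 - β) + 4 / β) * (2 * (1 + 100 * K * (2 * K + 5)) / β) * S * β ^ (n - j) := by
  have b1 : ∀ p ∈ box x0 y0 (2 ^ (n+2) + 1), |d1 (d1 v) p.1 p.2| ≤ S ∧ |d2 (d1 v) p.1 p.2| ≤ S := by
    intro p hp
    rw [d21]
    exact ⟨(isH_le_hm v _ (Or.inl rfl) _ _).trans (hS p hp), (isH_le_hm v _ (Or.inr (Or.inl rfl)) _ _).trans (hS p hp)⟩
  have b2 : ∀ p ∈ box x0 y0 (2 ^ (n+2) + 1), |d1 (d2 v) p.1 p.2| ≤ S ∧ |d2 (d2 v) p.1 p.2| ≤ S := by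
    intro p hp
    exact ⟨(isH_le_hm v _ (Or.inr (Or.inl rfl)) _ _).trans (hS p hp), (isH_le_hm v _ (Or.inr (Or.inr rfl)) _ _).trans (hS p hp)⟩
  rcases hf with rfl | rfl | rfl
  · exact holder_w K θ β hK hθ hβ hβ1 hβθ (d1 v) _ x0 y0 n S hq1 b1 (Or.inl rfl) j hj x y hx hy
  · exact holder_w K θ β hK hθ hβ hβ1 hβθ (d2 v) _ x0 y0 n S hq2 b2 (Or.inl rfl) j hj x y hx hy
  · exact holder_w K θ β hK hθ hβ hβ1 hβθ (d2 v) _ x0 y0 n S hq2 b2 (Or.inr rfl) j hj x y hx hy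

/-- distance to the boundary of the box -/
def dd (cx cy R : ℤ) (p : ℤ × ℤ) : ℤ := R + 1 - max (max (p.1 - cx) (cx - p.1)) (max (p.2 - cy) (cy - p.2))

lemma dd_pos (cx cy R : ℤ) (p : ℤ × ℤ) : 1 ≤ dd cx cy R p ↔ p ∈ box cx cy R := by
  rw [mem_box]; unfold dd; omega

lemma dd_half (cx cy R : ℤ) (p q : ℤ × ℤ) (r : ℤ) (h : q ∈ box p.1 p.2 r) : dd cx cy R p - r ≤ dd cx cy R q := by
  rw [mem_box] at h; unfold dd; omega

/-- choosing a dyadic scale -/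
lemma scale (d : ℤ) (k : ℕ) (h : 2 ^ (k+4) ≤ d) : ∃ n : ℕ, k ≤ n ∧ 2 ^ (n+4) ≤ d ∧ d < 2 ^ (n+5) := by
  have hd : 0 < d := lt_of_lt_of_le (by positivity) h
  obtain ⟨e, rfl⟩ := Int.eq_ofNat_of_zero_le hd.le
  have he : e ≠ 0 := by rintro rfl; simp at hd
  have h' : 2 ^ (k+4) ≤ e := by exact_mod_cast h
  have hl : k + 4 ≤ Nat.log 2 e := (Nat.le_log_iff_pow_le (by norm_num) he).2 h'
  refine ⟨Nat.log 2 e - 4, by omega, ?_, ?_⟩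
  · rw [show Nat.log 2 e - 4 + 4 = Nat.log 2 e by omega]
    exact_mod_cast Nat.pow_log_le_self 2 he
  · rw [show Nat.log 2 e - 4 + 5 = Nat.log 2 e + 1 by omega]
    exact_mod_cast Nat.lt_pow_succ_log_self (by norm_num) e

lemma local_S (v : ℤ → ℤ → ℝ) (cx cy R : ℤ) (A : ℝ) (hA : ∀ p ∈ box cx cy R, (dd cx cy R p : ℝ)^2 * hm v p.1 p.2 ≤ A)
    (p : ℤ × ℤ) (n : ℕ) (hn : 2 ^ (n+4) ≤ dd cx cy R p) :
    (∀ q ∈ box p.1 p.2 (2 ^ (n+2) + 1), q ∈ box cx cy R) ∧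
    (∀ q ∈ box p.1 p.2 (2 ^ (n+2) + 1), hm v q.1 q.2 ≤ 4 * A / (dd cx cy R p : ℝ)^2) := by
  have e : (2:ℤ) ^ (n+4) = 16 * 2 ^ n := by ring
  have e2 : (2:ℤ) ^ (n+2) = 4 * 2 ^ n := by ring
  have hp : (1:ℤ) ≤ 2 ^ n := one_le_pow₀ (by norm_num)
  have key : ∀ q ∈ box p.1 p.2 (2 ^ (n+2) + 1), dd cx cy R p ≤ 2 * dd cx cy R q := by
    intro q hq
    have := dd_half cx cy R p q _ hq
    omega
  have k2 : ∀ q ∈ box p.1 p.2 (2 ^ (n+2) + 1), q ∈ box cx cy R := by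
    intro q hq
    rw [← dd_pos]; have := key q hq; omega
  refine ⟨k2, fun q hq => ?_⟩
  have h1 := hA q (k2 q hq)
  have h2 : (dd cx cy R p : ℝ) ≤ 2 * dd cx cy R q := by exact_mod_cast key q hq
  have h3 : (0:ℝ) < dd cx cy R p := by exact_mod_cast (by omega : 0 < dd cx cy R p)
  rw [le_div_iff₀ (by positivity)]
  have h4 : (dd cx cy R p : ℝ)^2 ≤ 4 * (dd cx cy R q : ℝ)^2 := by nlinarith
  have := mul_le_mul_of_nonneg_left h4 (hm_nonneg v q.1 q.2)
  nlinarith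

/-- weighted interior bound for the second differences -/
lemma weighted (K θ β : ℝ) (hK : 1 ≤ K) (hθ : θ = 256 * K / (1 + 256 * K)) (hβ : 0 < β) (hβ1 : β < 1)
    (hβθ : β ^ 2 = θ) : ∃ C : ℝ, 0 < C ∧ ∀ (v : ℤ → ℤ → ℝ) (cx cy R : ℤ) (m : ℝ), 0 ≤ R →
      (∀ p ∈ box cx cy R, QC K (d1 v) p.1 p.2 ∧ QC K (d2 v) p.1 p.2) →
      (∀ p ∈ box cx cy (R + 4), |v p.1 p.2| ≤ m) →
      ∀ p ∈ box cx cy R, (dd cx cy R p : ℝ)^2 * hm v p.1 p.2 ≤ C * m := by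
  set CE := (4 / (1 - β) + 4 / β) * (2 * (1 + 100 * K * (2 * K + 5)) / β) with hCE
  have h1β : 0 < 1 - β := by linarith
  have hCE0 : 0 < CE := by rw [hCE]; positivity
  obtain ⟨j0, hj00, hj0⟩ : ∃ j0 : ℕ, 1 ≤ j0 ∧ β ^ j0 < 1 / (24 * CE) := by
    obtain ⟨j, hj⟩ := exists_pow_lt_of_lt_one (by positivity : 0 < 1 / (24 * CE)) hβ1
    exact ⟨j + 1, by omega, lt_of_le_of_lt (pow_le_pow_of_le_one hβ.le hβ1.le (Nat.le_succ j)) hj⟩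
  have hj0' : 24 * CE * β ^ j0 ≤ 1 := by
    rw [lt_div_iff₀ (by positivity)] at hj0; linarith
  refine ⟨24 * 4 ^ (j0 + 6), by positivity, ?_⟩
  intro v cx cy R m hR hq hv
  have hm0 : 0 ≤ m := (abs_nonneg _).trans (hv (cx, cy) (by rw [mem_box]; dsimp only; omega))
  obtain ⟨p0, hp0, hmax⟩ := Finset.exists_max_image (box cx cy R)
    (fun p => (dd cx cy R p : ℝ)^2 * hm v p.1 p.2) ⟨(cx, cy), by rw [mem_box]; dsimp only; omega⟩
  intro p hp
  refine (hmax p hp).trans ?_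
  set d := dd cx cy R p0 with hd
  have hd1 : 1 ≤ d := (dd_pos _ _ _ _).2 hp0
  have hdR : (1:ℝ) ≤ d := by exact_mod_cast hd1
  by_cases hbig : 2 ^ (j0 + 1 + 4) ≤ d
  · obtain ⟨n, hn1, hn2, hn3⟩ := scale d (j0 + 1) hbig
    set A := (d : ℝ)^2 * hm v p0.1 p0.2 with hA
    have hA0 : 0 ≤ A := mul_nonneg (sq_nonneg _) (hm_nonneg _ _ _)
    obtain ⟨k1, k2⟩ := local_S v cx cy R A hmax p0 n hn2
    have hpn : (1:ℤ) ≤ 2 ^ n := one_le_pow₀ (by norm_num)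
    have ks : ∀ q ∈ box p0.1 p0.2 (2 ^ (n+2)), q ∈ box cx cy R := by
      intro q hq'; apply k1; rw [mem_box] at hq' ⊢; omega
    set l : ℕ := 2 ^ (n - j0 - 1) with hl
    have hl2 : (2:ℤ) * l = 2 ^ (n - j0) := by
      rw [hl]; push_cast; rw [← pow_succ', show n - j0 - 1 + 1 = n - j0 by omega]
    have hH : ∀ f, isH v f → (l:ℝ)^2 * |f p0.1 p0.2| ≤ 4 * m + (l:ℝ)^2 * (A / (6 * (d:ℝ)^2)) := by
      intro f hf
      apply interp v f hf
      · intro q hq'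
        apply hv
        have : (2:ℤ) ^ (n - j0) ≤ 2 ^ n := pow_le_pow_right₀ (by norm_num) (by omega)
        have e2 : (2:ℤ) ^ (n+2) = 4 * 2 ^ n := by ring
        have h3 := ks q (by rw [mem_box] at hq' ⊢; omega)
        rw [mem_box] at h3 ⊢; omega
      · intro a b ha hb
        rw [hl2] at ha hb
        have h := holder_H K θ β hK hθ hβ hβ1 hβθ v f hf p0.1 p0.2 n _ (fun q hq' => (hq q (ks q hq')).1)
          (fun q hq' => (hq q (ks q hq')).2) k2 (n - j0) (by omega) a b ha hb
        rw [← hCE, show n - (n - j0) = j0 by omega] at h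
        refine h.trans ?_
        rw [show CE * (4 * A / (d:ℝ)^2) * β ^ j0 = (24 * CE * β ^ j0) * (A / (6 * (d:ℝ)^2)) by field_simp; ring]
        exact mul_le_of_le_one_left (by positivity) hj0'
    have t1 := hH _ (Or.inl rfl)
    have t2 := hH _ (Or.inr (Or.inl rfl))
    have t3 := hH _ (Or.inr (Or.inr rfl))
    have tt : (l:ℝ)^2 * hm v p0.1 p0.2 ≤ 12 * m + (l:ℝ)^2 * (A / (2 * (d:ℝ)^2)) := by
      have : (l:ℝ)^2 * (A / (2 * (d:ℝ)^2)) = 3 * ((l:ℝ)^2 * (A / (6 * (d:ℝ)^2))) := by field_simp; ring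
      rw [this]; unfold hm; linarith
    have hl0 : (1:ℝ) ≤ l := by rw [hl]; push_cast; exact one_le_pow₀ (by norm_num)
    have hhm : hm v p0.1 p0.2 = A / (d:ℝ)^2 := by rw [hA]; field_simp
    rw [hhm] at tt
    have hdl : (d:ℝ) ≤ 2 ^ (j0 + 6) * l := by
      have : (d:ℝ) ≤ 2 ^ (n+5) := by exact_mod_cast hn3.le
      refine this.trans (le_of_eq ?_)
      rw [hl]; push_cast; rw [← pow_add]; congr 1; omega
    have h5 : (l:ℝ)^2 * A ≤ 24 * m * (d:ℝ)^2 := by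
      have : (l:ℝ)^2 * (A / (d:ℝ)^2) - (l:ℝ)^2 * (A / (2 * (d:ℝ)^2)) = (l:ℝ)^2 * A / (2 * (d:ℝ)^2) := by
        field_simp; ring
      have h6 : (l:ℝ)^2 * A / (2 * (d:ℝ)^2) ≤ 12 * m := by linarith
      rw [div_le_iff₀ (by positivity)] at h6
      linarith
    have h7 : (d:ℝ)^2 ≤ 4 ^ (j0+6) * (l:ℝ)^2 := by
      calc (d:ℝ)^2 ≤ (2 ^ (j0 + 6) * l)^2 := pow_le_pow_left₀ (by linarith) hdl 2
        _ = _ := by rw [mul_pow, ← pow_mul, mul_comm (j0+6) 2, pow_mul]; norm_num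
    have h8 : (l:ℝ)^2 * A ≤ (l:ℝ)^2 * (24 * 4 ^ (j0+6) * m) := by
      have := mul_le_mul_of_nonneg_left h7 (by positivity : 0 ≤ 24 * m)
      nlinarith
    exact le_of_mul_le_mul_left h8 (by positivity)
  · push Not at hbig
    have h1 : hm v p0.1 p0.2 ≤ 12 * m := by
      apply hm_le
      intro a b _ _ _ _
      apply hv (p0.1 + a, p0.2 + b)
      rw [mem_box] at hp0 ⊢; dsimp only; omega
    have h2 : (d:ℝ) ≤ 2 ^ (j0 + 6) := by
      have : d ≤ 2 ^ (j0+6) := hbig.le.trans (pow_le_pow_right₀ (by norm_num) (by omega))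
      exact_mod_cast this
    have h7 : (d:ℝ)^2 ≤ 4 ^ (j0+6) := by
      calc (d:ℝ)^2 ≤ (2 ^ (j0 + 6))^2 := pow_le_pow_left₀ (by linarith) h2 2
        _ = _ := by rw [← pow_mul, mul_comm (j0+6) 2, pow_mul]; norm_num
    have := mul_le_mul h7 h1 (hm_nonneg _ _ _) (by positivity)
    have h9 : 0 ≤ 4 ^ (j0+6) * m := by positivity
    linarith

def inn (cx cy R : ℤ) (p : ℤ × ℤ) : Prop :=
  (4 * (p.1 - cx) ≤ 3 * R ∧ 4 * (cx - p.1) ≤ 3 * R) ∧ (4 * (p.2 - cy) ≤ 3 * R ∧ 4 * (cy - p.2) ≤ 3 * R)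

lemma grad_interp (G : ℤ → ℝ) (x : ℤ) (l : ℕ) (m T : ℝ) (h0 : |G x| ≤ m) (h1 : |G (x + l)| ≤ m)
    (hT : ∀ a : ℕ, a < l → |G (x + a + 1 + 1) - 2 * G (x + a + 1) + G (x + a)| ≤ T) :
    (l:ℝ) * |G (x+1) - G x| ≤ 2 * m + (l:ℝ)^2 * T := by
  have hd : ∀ a : ℕ, a < l → |(G (x + a + 1) - G (x + a)) - (G (x+1) - G x)| ≤ a * T := by
    intro a
    induction a with
    | zero => intro _; simp
    | succ a ih =>
      intro ha
      have t1 := ih (by omega)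
      have t2 := hT a (by omega)
      push_cast
      rw [show x + ((a:ℤ) + 1) + 1 = x + a + 1 + 1 by ring, show x + ((a:ℤ) + 1) = x + a + 1 by ring]
      rw [abs_le] at t1 t2 ⊢
      constructor <;> linarith
  have e : ∑ a ∈ Finset.range l, (G (x + a + 1) - G (x + a)) = G (x + l) - G x := by
    have := Finset.sum_range_sub (fun a : ℕ => G (x + a)) l
    push_cast at this
    simpa [add_assoc] using this
  have e2 : |∑ a ∈ Finset.range l, ((G (x + a + 1) - G (x + a)) - (G (x+1) - G x))| ≤ (l:ℝ)^2 * T := by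
    calc _ ≤ ∑ a ∈ Finset.range l, |(G (x + a + 1) - G (x + a)) - (G (x+1) - G x)| := Finset.abs_sum_le_sum_abs _ _
      _ ≤ ∑ a ∈ Finset.range l, (l * T) := by
          apply Finset.sum_le_sum
          intro a ha
          rw [Finset.mem_range] at ha
          have hT0 : 0 ≤ T := (abs_nonneg _).trans (hT a ha)
          refine (hd a ha).trans (mul_le_mul_of_nonneg_right ?_ hT0)
          exact_mod_cast ha.le
      _ = _ := by simp only [Finset.sum_const, Finset.card_range, nsmul_eq_mul]; ring
  rw [Finset.sum_sub_distrib, e, Finset.sum_const, Finset.card_range, nsmul_eq_mul] at e2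
  rw [show (l:ℝ) * |G (x+1) - G x| = |(l:ℝ) * (G (x+1) - G x)| by rw [abs_mul, Nat.abs_cast]]
  rw [abs_le] at *
  constructor <;> linarith

set_option maxHeartbeats 1000000 in
theorem DT (K : ℝ) (hK : 1 ≤ K) : ∃ α C : ℝ, 0 < α ∧ α < 1 ∧ 0 < C ∧
    ∀ (v : ℤ → ℤ → ℝ) (cx cy R : ℤ) (m : ℝ), 64 ≤ R →
      (∀ p ∈ box cx cy R, QC K (d1 v) p.1 p.2 ∧ QC K (d2 v) p.1 p.2) →
      (∀ p ∈ box cx cy (R + 4), |v p.1 p.2| ≤ m) →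
      (∀ p, inn cx cy R p → |d1 v p.1 p.2| ≤ C * m / R ∧ |d2 v p.1 p.2| ≤ C * m / R ∧
        hm v p.1 p.2 ≤ C * m / R ^ 2) ∧
      (∀ f, isH v f → ∀ p q, inn cx cy R p → inn cx cy R q → ∀ s : ℕ, |p.1 - q.1| ≤ s → |p.2 - q.2| ≤ s →
        |f p.1 p.2 - f q.1 q.2| ≤ C * m / R ^ 2 * ((s:ℝ) / R) ^ α) := by
  set θ := 256 * K / (1 + 256 * K) with hθ
  have hθ1 : θ < 1 := by rw [hθ, div_lt_one (by positivity)]; linarith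
  have hθ2 : 1 / 4 < θ := by rw [hθ, lt_div_iff₀ (by positivity)]; linarith
  set β := Real.sqrt θ with hβd
  have hβθ : β ^ 2 = θ := Real.sq_sqrt (by linarith)
  have hβ : 0 < β := Real.sqrt_pos.2 (by linarith)
  have hβ1 : β < 1 := by nlinarith
  have hβ2 : 1 / 2 < β := by nlinarith
  obtain ⟨C1, hC1, hW⟩ := weighted K θ β hK hθ hβ hβ1 hβθ
  set CE := (4 / (1 - β) + 4 / β) * (2 * (1 + 100 * K * (2 * K + 5)) / β) with hCE
  have h1β : 0 < 1 - β := by linarith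
  have hCE0 : 0 < CE := by rw [hCE]; positivity
  set α := - Real.log β / Real.log 2 with hα
  have hlog2 : 0 < Real.log 2 := Real.log_pos (by norm_num)
  have hα0 : 0 < α := div_pos (by linarith [Real.log_neg hβ hβ1]) hlog2
  have hα1 : α < 1 := by
    rw [hα, div_lt_one hlog2]
    have := Real.log_lt_log (by norm_num) hβ2
    rw [one_div, Real.log_inv] at this; linarith
  have hβα : ∀ k : ℕ, β ^ k = ((1/2:ℝ) ^ k) ^ α := by
    intro k
    rw [← Real.rpow_natCast (1/2) k, ← Real.rpow_mul (by norm_num), mul_comm, Real.rpow_mul (by norm_num), Real.rpow_natCast]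
    congr 1
    rw [Real.rpow_def_of_pos (by norm_num), one_div, Real.log_inv, hα,
      show -Real.log 2 * (-Real.log β / Real.log 2) = Real.log β by field_simp, Real.exp_log hβ]
  set C := 32 + 8 * C1 + 16 * C1 + 2 * 16 * C1 * 256 + CE * (64 * C1) * 256 with hC
  refine ⟨α, C, hα0, hα1, by positivity, ?_⟩
  intro v cx cy R m hR hq hv
  have hm0 : 0 ≤ m := (abs_nonneg _).trans (hv (cx, cy) (by rw [mem_box]; dsimp only; omega))
  have hw := hW v cx cy R m (by omega) hq hv
  have hR0 : (64:ℝ) ≤ R := by exact_mod_cast hR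
  have hgen : ∀ (k : ℤ) (p : ℤ × ℤ), 0 < k → R ≤ k * dd cx cy R p → hm v p.1 p.2 ≤ (k:ℝ)^2 * (C1 * m) / R^2 := by
    intro k p hk hp
    have hd : 1 ≤ dd cx cy R p := by
      by_contra h
      push Not at h
      have : k * dd cx cy R p ≤ 0 := mul_nonpos_of_nonneg_of_nonpos hk.le (by omega)
      omega
    have h := hw p ((dd_pos _ _ _ _).1 hd)
    have hp' : (R:ℝ) ≤ k * dd cx cy R p := by exact_mod_cast hp
    have h2 : (R:ℝ)^2 ≤ (k * dd cx cy R p)^2 := pow_le_pow_left₀ (by linarith) hp' 2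
    rw [le_div_iff₀ (by positivity)]
    have h3 := mul_le_mul_of_nonneg_left h2 (hm_nonneg v p.1 p.2)
    have h4 := mul_le_mul_of_nonneg_left h (by positivity : 0 ≤ (k:ℝ)^2)
    nlinarith
  have hinn : ∀ p, inn cx cy R p → R ≤ 4 * dd cx cy R p := by
    intro p hp; unfold inn at hp; unfold dd; omega
  have hT : ∀ p, inn cx cy R p → hm v p.1 p.2 ≤ 16 * C1 * m / R^2 := by
    intro p hp
    have := hgen 4 p (by norm_num) (hinn p hp)
    push_cast at this
    refine this.trans (le_of_eq ?_); ring
  have hRl : ∃ l : ℕ, (R:ℝ) ≤ 16 * l ∧ 8 * (l:ℝ) ≤ R ∧ 8 * (l:ℤ) ≤ R := by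
    refine ⟨(R / 8).toNat, ?_, ?_, ?_⟩
    · have : R ≤ 16 * ((R/8).toNat : ℤ) := by omega
      exact_mod_cast this
    · have : 8 * ((R/8).toNat : ℤ) ≤ R := by omega
      exact_mod_cast this
    · omega
  obtain ⟨l, hl1, hl2, hl3⟩ := hRl
  have hgrad : ∀ g : ℝ, (l:ℝ) * |g| ≤ 2 * m + (l:ℝ)^2 * (64 * (C1 * m) / R^2) → |g| ≤ C * m / R := by
    intro g hg
    have hl0 : (0:ℝ) < l := by linarith
    rw [le_div_iff₀ (by linarith)]
    have e1 : (l:ℝ)^2 * (64 * (C1 * m) / R^2) ≤ C1 * m := by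
      have : (l:ℝ)^2 * 64 ≤ R^2 := by nlinarith
      rw [← mul_div_assoc, div_le_iff₀ (by positivity)]
      have := mul_le_mul_of_nonneg_left this (by positivity : 0 ≤ C1 * m)
      linarith
    have e2 : |g| * R ≤ 16 * (l * |g|) := by
      have := mul_le_mul_of_nonneg_left hl1 (abs_nonneg g); linarith
    have e3 : 32 * m + 16 * (C1 * m) ≤ C * m := by
      rw [hC]
      have : 0 ≤ C1 * m := by positivity
      have : 0 ≤ CE * (64 * C1) * 256 * m := by positivity
      linarith
    linarith
  constructor
  · intro p hp
    have hp' := hp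
    unfold inn at hp
    have hpbox : ∀ a b : ℤ, 0 ≤ a → a ≤ l → 0 ≤ b → b ≤ l → R ≤ 8 * dd cx cy R (p.1 + a, p.2 + b) ∧ |v (p.1 + a) (p.2 + b)| ≤ m := by
      intro a b h1 h2 h3 h4
      constructor
      · unfold dd; dsimp only; omega
      · apply hv (p.1 + a, p.2 + b); rw [mem_box]; dsimp only; omega
    have hh : ∀ a b : ℤ, 0 ≤ a → a ≤ l → 0 ≤ b → b ≤ l → hm v (p.1 + a) (p.2 + b) ≤ 64 * (C1 * m) / R^2 := by
      intro a b h1 h2 h3 h4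
      have := hgen 8 _ (by norm_num) (hpbox a b h1 h2 h3 h4).1
      push_cast at this
      refine this.trans (le_of_eq ?_); ring
    have z0 := (hpbox 0 0 le_rfl (by omega) le_rfl (by omega)).2
    have z1 := (hpbox l 0 (by omega) (by omega) le_rfl (by omega)).2
    have z2 := (hpbox 0 l le_rfl (by omega) (by omega) (by omega)).2
    simp only [add_zero] at z0 z1 z2
    refine ⟨?_, ?_, ?_⟩
    · apply hgrad
      apply grad_interp (fun i => v i p.2) p.1 l m _ z0 z1
      intro a ha
      refine le_trans (le_of_eq ?_) ((isH_le_hm v _ (Or.inl rfl) _ _).trans (hh a 0 (by omega) (by omega) le_rfl (by omega)))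
      simp only [d1, add_zero]; congr 1; ring
    · apply hgrad
      apply grad_interp (fun j => v p.1 j) p.2 l m _ z0 z2
      intro a ha
      refine le_trans (le_of_eq ?_) ((isH_le_hm v _ (Or.inr (Or.inr rfl)) _ _).trans (hh 0 a le_rfl (by omega) (by omega) (by omega)))
      simp only [d2, add_zero]; congr 1; ring
    · refine (hT p hp').trans ?_
      apply div_le_div_of_nonneg_right _ (by positivity)
      apply mul_le_mul_of_nonneg_right _ hm0
      rw [hC]
      have : 0 ≤ CE * (64 * C1) * 256 := by positivity
      linarith
  · intro f hf p q hp hq' s hs1 hs2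
    rcases Nat.eq_zero_or_pos s with rfl | hs
    · have h1 : p.1 = q.1 := by simpa [sub_eq_zero] using hs1
      have h2 : p.2 = q.2 := by simpa [sub_eq_zero] using hs2
      rw [h1, h2, sub_self, abs_zero]
      have : (0:ℝ) ≤ C := by positivity
      have : (0:ℝ) ≤ (R:ℝ) := by linarith
      positivity
    · set d := dd cx cy R q with hd
      have hd4 := hinn q hq'
      obtain ⟨n, -, hn2, hn3⟩ := scale d 0 (by norm_num; omega)
      obtain ⟨k1, k2⟩ := local_S v cx cy R _ hw q n hn2
      have ks : ∀ q' ∈ box q.1 q.2 (2 ^ (n+2)), q' ∈ box cx cy R := by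
        intro q' hq''; apply k1; rw [mem_box] at hq'' ⊢; omega
      -- choose j
      obtain ⟨j, hj1, hj2⟩ : ∃ j : ℕ, s ≤ 2 ^ j ∧ 2 ^ j ≤ 2 * s := by
        refine ⟨Nat.clog 2 s, Nat.le_pow_clog (by norm_num) s, ?_⟩
        rcases Nat.lt_or_ge 1 s with h1 | h1
        · have := Nat.pow_pred_clog_lt_self (b := 2) (by norm_num) h1
          have h2 : 0 < Nat.clog 2 s := Nat.clog_pos (by norm_num) h1
          obtain ⟨c, hc⟩ : ∃ c, Nat.clog 2 s = c + 1 := ⟨Nat.clog 2 s - 1, by omega⟩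
          rw [hc] at this ⊢
          simp only [Nat.pred_succ] at this
          rw [pow_succ]; omega
        · have : s = 1 := by omega
          subst this; simp
      have hRn : (R:ℝ) ≤ 128 * 2 ^ n := by
        have : R ≤ 128 * 2 ^ n := by
          have : (2:ℤ)^(n+5) = 32 * 2 ^ n := by ring
          omega
        exact_mod_cast this
      have hs' : (0:ℝ) < s := by exact_mod_cast hs
      have hjs : (2:ℝ)^j ≤ 2 * s := by exact_mod_cast hj2
      have hjs1 : (s:ℤ) ≤ 2 ^ j := by exact_mod_cast hj1
      have h256 : ∀ t : ℝ, 0 ≤ t → (256 * t) ^ α ≤ 256 * t ^ α := by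
        intro t ht
        rw [Real.mul_rpow (by norm_num) ht]
        apply mul_le_mul_of_nonneg_right _ (by positivity)
        calc (256:ℝ)^α ≤ 256 ^ (1:ℝ) := Real.rpow_le_rpow_of_exponent_le (by norm_num) hα1.le
          _ = 256 := Real.rpow_one _
      have hsR : 0 ≤ (s:ℝ) / R := by positivity
      have hP : 0 ≤ ((s:ℝ)/R)^α := by positivity
      have hCle1 : CE * (64 * C1) * 256 ≤ C := by rw [hC]; nlinarith
      have hCle2 : 2 * 16 * C1 * 256 ≤ C := by rw [hC]; have : 0 ≤ CE * (64 * C1) * 256 := by positivity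
                                               linarith
      by_cases hjn : j + 1 ≤ n
      · have h := holder_H K θ β hK hθ hβ hβ1 hβθ v f hf q.1 q.2 n _ (fun q'' hq'' => (hq q'' (ks q'' hq'')).1)
          (fun q'' hq'' => (hq q'' (ks q'' hq'')).2) k2 j hjn p.1 p.2 (hs1.trans hjs1) (hs2.trans hjs1)
        rw [← hCE] at h
        refine h.trans ?_
        have hS : 4 * (C1 * m) / (d:ℝ)^2 ≤ 64 * C1 * m / R^2 := by
          have h4 : (R:ℝ) ≤ 4 * d := by exact_mod_cast hd4
          have hdp : (0:ℝ) < d := by linarith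
          rw [div_le_div_iff₀ (by positivity) (by positivity)]
          have : (R:ℝ)^2 ≤ 16 * (d:ℝ)^2 := by nlinarith
          have := mul_le_mul_of_nonneg_left this (by positivity : 0 ≤ 4 * (C1 * m))
          linarith
        have hb : β ^ (n - j) ≤ 256 * ((s:ℝ)/R)^α := by
          rw [hβα]
          refine le_trans ?_ (h256 _ hsR)
          apply Real.rpow_le_rpow (by positivity) _ hα0.le
          have e : (1/2:ℝ)^(n-j) = 2^j / 2^n := by
            rw [one_div, inv_pow, eq_div_iff (by positivity), inv_mul_eq_iff_eq_mul₀ (by positivity), ← pow_add]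
            congr 1; omega
          rw [e, ← mul_div_assoc, div_le_div_iff₀ (by positivity) (by linarith)]
          have hp2 : (0:ℝ) < 2 ^ n := by positivity
          calc (2:ℝ)^j * R ≤ (2 * s) * (128 * 2 ^ n) := mul_le_mul hjs hRn (by linarith) (by positivity)
            _ = _ := by ring
        calc CE * (4 * (C1 * m) / (d:ℝ)^2) * β ^ (n - j) ≤ CE * (64 * C1 * m / R^2) * (256 * ((s:ℝ)/R)^α) := by
              gcongr
          _ = (CE * (64 * C1) * 256) * (m / R^2 * ((s:ℝ)/R)^α) := by ring
          _ ≤ C * (m / R^2 * ((s:ℝ)/R)^α) := mul_le_mul_of_nonneg_right hCle1 (by positivity)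
          _ = _ := by ring
      · have hnj : (2:ℝ)^n ≤ 2 ^ j := pow_le_pow_right₀ (by norm_num) (by omega)
        have h1 : 1 ≤ 256 * ((s:ℝ)/R)^α := by
          refine le_trans ?_ (h256 _ hsR)
          apply Real.one_le_rpow _ hα0.le
          rw [← mul_div_assoc, le_div_iff₀ (by linarith)]
          linarith
        have a1 := (isH_le_hm v f hf p.1 p.2).trans (hT p hp)
        have a2 := (isH_le_hm v f hf q.1 q.2).trans (hT q hq')
        calc |f p.1 p.2 - f q.1 q.2| ≤ 2 * (16 * C1 * m / R^2) := by
              have := abs_sub (f p.1 p.2) (f q.1 q.2); linarith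
          _ ≤ 2 * (16 * C1 * m / R^2) * (256 * ((s:ℝ)/R)^α) := le_mul_of_one_le_right (by positivity) h1
          _ = (2 * 16 * C1 * 256) * (m / R^2 * ((s:ℝ)/R)^α) := by ring
          _ ≤ C * (m / R^2 * ((s:ℝ)/R)^α) := mul_le_mul_of_nonneg_right hCle2 (by positivity)
          _ = _ := by ring

def tpq (t p q : ℝ) : Mat2 := !![(t+p)/2, q/2; q/2, (t-p)/2]

lemma tpq_herm (t p q : ℝ) : (tpq t p q).IsHermitian := by
  unfold tpq Matrix.IsHermitian
  ext i j; fin_cases i <;> fin_cases j <;> simp [Matrix.conjTranspose_apply]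

lemma tpq_sub (t p q t' p' q' : ℝ) : tpq t p q - tpq t' p' q' = tpq (t-t') (p-p') (q-q') := by
  unfold tpq
  ext i j; fin_cases i <;> fin_cases j <;> simp <;> ring

lemma eig (t p q : ℝ) : ∃ a b : ℝ, a + b = t ∧ (a - b)^2 = p^2 + q^2 ∧
    posNorm (tpq t p q) = max a 0 + max b 0 ∧ negNorm (tpq t p q) = max (-a) 0 + max (-b) 0 := by
  have h := tpq_herm t p q
  have h1 := h.trace_eq_sum_eigenvalues
  have h2 := h.det_eq_prod_eigenvalues
  simp only [Fin.sum_univ_two, Fin.prod_univ_two, RCLike.ofReal_real_eq_id, id] at h1 h2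
  have t1 : (tpq t p q).trace = t := by simp [tpq, Matrix.trace_fin_two]; ring
  have t2 : (tpq t p q).det = (t^2 - p^2 - q^2)/4 := by simp [tpq, Matrix.det_fin_two]; ring
  rw [t1] at h1
  rw [t2] at h2
  refine ⟨h.eigenvalues 0, h.eigenvalues 1, h1.symm, ?_, ?_, ?_⟩
  · have : (h.eigenvalues 0 - h.eigenvalues 1)^2 = (h.eigenvalues 0 + h.eigenvalues 1)^2 - 4 * (h.eigenvalues 0 * h.eigenvalues 1) := by ring
    rw [this, ← h1, ← h2]; ring
  · rw [posNorm, dif_pos h, Fin.sum_univ_two]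
  · rw [negNorm, dif_pos h, Fin.sum_univ_two]

lemma norms_diag (t : ℝ) : posNorm (tpq t 0 0) = max t 0 ∧ negNorm (tpq t 0 0) = max (-t) 0 := by
  obtain ⟨a, b, h1, h2, h3, h4⟩ := eig t 0 0
  have : a = b := by
    have : (a-b)^2 = 0 := by rw [h2]; ring
    have := pow_eq_zero_iff (two_ne_zero) |>.1 this
    linarith
  subst this
  rw [h3, h4, ← h1]
  constructor
  · rcases le_total a 0 with h | h
    · rw [max_eq_right h, max_eq_right (by linarith)]; ring
    · rw [max_eq_left h, max_eq_left (by linarith)]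
  · rcases le_total a 0 with h | h
    · rw [max_eq_left (by linarith), max_eq_left (by linarith)]; ring
    · rw [max_eq_right (by linarith), max_eq_right (by linarith)]; ring

section
variable {lam Lam : ℝ} {F : Mat2 → ℝ}

lemma F_diag (hlam : 0 < lam) (hF : UniformlyElliptic lam Lam F) (t s p q : ℝ) (h : s ≤ t) :
    lam * (t - s) ≤ F (tpq t p q) - F (tpq s p q) ∧ F (tpq t p q) - F (tpq s p q) ≤ Lam * (t - s) := by
  have h1 := hF _ _ (tpq_herm t p q) (tpq_herm s p q)
  have h2 := hF _ _ (tpq_herm s p q) (tpq_herm t p q)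
  rw [tpq_sub, sub_self, sub_self, (norms_diag _).1, (norms_diag _).2] at h1 h2
  rw [max_eq_left (by linarith), max_eq_right (by linarith)] at h1
  rw [max_eq_right (by linarith), max_eq_left (by linarith)] at h2
  constructor <;> linarith

lemma ell_key (hlam : 0 < lam) (hLam : lam ≤ Lam) (a b : ℝ) (hab : b ≤ a)
    (h1 : 0 ≤ Lam * (max a 0 + max b 0) - lam * (max (-a) 0 + max (-b) 0))
    (h2 : 0 ≤ Lam * (max (-a) 0 + max (-b) 0) - lam * (max a 0 + max b 0)) :
    (a+b)^2 * (Lam + lam)^2 ≤ (Lam - lam)^2 * (a-b)^2 := by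
  rcases le_total a 0 with ha | ha
  · rw [max_eq_right ha, max_eq_right (by linarith), max_eq_left (by linarith), max_eq_left (by linarith)] at h1
    have h3 : 0 ≤ a + b := nonneg_of_mul_nonneg_right (by linarith) hlam
    have : a = 0 := by linarith
    have : b = 0 := by linarith
    subst a b; simp
  · rcases le_total b 0 with hb | hb
    · rw [max_eq_left ha, max_eq_right hb, max_eq_right (by linarith), max_eq_left (by linarith)] at h1
      rw [max_eq_left ha, max_eq_right hb, max_eq_right (by linarith), max_eq_left (by linarith)] at h2
      rw [← mul_pow, ← mul_pow]
      apply sq_le_sq'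
      · linarith
      · linarith
    · rw [max_eq_left ha, max_eq_left hb, max_eq_right (by linarith), max_eq_right (by linarith)] at h2
      have h3 : 0 ≤ -(a + b) := nonneg_of_mul_nonneg_right (by linarith) hlam
      have : a = 0 := by linarith
      have : b = 0 := by linarith
      subst a b; simp

lemma F_zero_zero (hlam : 0 < lam) (hLam : lam ≤ Lam) (hF : UniformlyElliptic lam Lam F) (t p q t' p' q' : ℝ)
    (h : F (tpq t p q) = 0) (h' : F (tpq t' p' q') = 0) :
    (t - t')^2 ≤ ((Lam - lam)/(Lam + lam))^2 * ((p-p')^2 + (q-q')^2) := by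
  have h1 := hF _ _ (tpq_herm t p q) (tpq_herm t' p' q')
  have h2 := hF _ _ (tpq_herm t' p' q') (tpq_herm t p q)
  rw [tpq_sub, h, h'] at h1 h2
  obtain ⟨a, b, e1, e2, e3, e4⟩ := eig (t-t') (p-p') (q-q')
  obtain ⟨c, d, f1, f2, f3, f4⟩ := eig (t'-t) (p'-p) (q'-q)
  rw [e3, e4] at h1
  rw [f3, f4] at h2
  have hcd : max c 0 + max d 0 = max (-a) 0 + max (-b) 0 ∧ max (-c) 0 + max (-d) 0 = max a 0 + max b 0 := by
    have g0 : a * b = c * d := by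
      have g2 : (c+d)^2 = (a+b)^2 := by rw [e1, f1]; ring
      have g3 : (c-d)^2 = (a-b)^2 := by rw [e2, f2]; ring
      nlinarith
    have g1 : (c + a) * (c + b) = 0 := by
      have : c * (a + b) = c * (-(c+d)) := by rw [e1, f1]; ring
      linarith
    rcases mul_eq_zero.1 g1 with g | g
    · have : c = -a := by linarith
      have : d = -b := by linarith
      subst c d; simp
    · have : c = -b := by linarith
      have : d = -a := by linarith
      subst c d; simp [add_comm]
  rw [hcd.1, hcd.2] at h2
  rw [← e2, ← e1, div_pow, div_mul_eq_mul_div, le_div_iff₀ (pow_pos (by linarith) 2)]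
  rcases le_total b a with hab | hab
  · exact ell_key hlam hLam a b hab (by linarith) (by linarith)
  · have := ell_key hlam hLam b a hab (by linarith) (by linarith)
    rw [add_comm, ← neg_sub b a, neg_sq]; exact this

lemma exists_g (hlam : 0 < lam) (hLam : lam ≤ Lam) (hF : UniformlyElliptic lam Lam F) (h0 : F 0 = 0) :
    ∃ g : ℝ → ℝ → ℝ, (∀ p q, F (tpq (g p q) p q) = 0) ∧ g 0 0 = 0 ∧
      ∀ p q p' q', (g p q - g p' q')^2 ≤ ((Lam - lam)/(Lam + lam))^2 * ((p-p')^2 + (q-q')^2) := by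
  have hex : ∀ p q, ∃ t, F (tpq t p q) = 0 := by
    intro p q
    have hc : Continuous fun t => F (tpq t p q) := by
      have : LipschitzWith (Real.toNNReal Lam) fun t => F (tpq t p q) := by
        apply LipschitzWith.of_dist_le_mul
        intro t s
        rw [Real.coe_toNNReal _ (by linarith), Real.dist_eq, Real.dist_eq]
        rcases le_total s t with h | h
        · have := F_diag hlam hF t s p q h
          rw [abs_of_nonneg (by nlinarith), abs_of_nonneg (by linarith)]; exact this.2
        · have := F_diag hlam hF s t p q h
          rw [abs_sub_comm, abs_sub_comm t, abs_of_nonneg (by nlinarith), abs_of_nonneg (by linarith)]; exact this.2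
      exact this.continuous
    set T := |F (tpq 0 p q)| / lam with hT
    have hT0 : 0 ≤ T := by positivity
    have h1 := (F_diag hlam hF T 0 p q hT0).1
    have h2 := (F_diag hlam hF 0 (-T) p q (by linarith)).1
    have hTl : lam * T = |F (tpq 0 p q)| := by rw [hT]; field_simp
    have := intermediate_value_Icc (show -T ≤ T by linarith) hc.continuousOn
    obtain ⟨t, _, ht⟩ := this (show (0:ℝ) ∈ _ by
      rw [Set.mem_Icc]
      have := neg_abs_le (F (tpq 0 p q)); have := le_abs_self (F (tpq 0 p q))
      constructor <;> linarith)
    exact ⟨t, ht⟩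
  choose g hg using hex
  refine ⟨g, hg, ?_, fun p q p' q' => F_zero_zero hlam hLam hF _ _ _ _ _ _ (hg p q) (hg p' q')⟩
  have hm : tpq 0 0 0 = 0 := by
    unfold tpq; ext i j; fin_cases i <;> fin_cases j <;> simp
  have := F_zero_zero hlam hLam hF _ _ _ _ _ _ (hg 0 0) (show F (tpq 0 0 0) = 0 by rw [hm, h0])
  simp only [sub_self, sub_zero] at this
  have h3 : (g 0 0)^2 = 0 := le_antisymm (by linarith) (sq_nonneg _)
  exact pow_eq_zero_iff (two_ne_zero) |>.1 h3
end

/-- The equation for differences gives discrete quasiconformality. -/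
lemma QC_of_contr (k : ℝ) (hk0 : 0 ≤ k) (hk : k < 1) (w : ℤ → ℤ → ℝ) (i j : ℤ)
    (h : (gA w i j + gB w i j)^2 ≤ k^2 * ((gA w i j - gB w i j)^2 + (2 * gC w i j)^2)) :
    QC (2 * (1 + k^2)/(1 - k^2)) w i j := by
  unfold QC en
  have : 0 < 1 - k^2 := by nlinarith
  rw [div_mul_eq_mul_div, le_div_iff₀ this]
  nlinarith

lemma K_ge (k : ℝ) (hk0 : 0 ≤ k) (hk : k < 1) : 1 ≤ 2 * (1 + k^2)/(1 - k^2) := by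
  have : 0 < 1 - k^2 := by nlinarith
  rw [le_div_iff₀ this]; nlinarith

/-- extension by zero of a function on the interior vertices -/
def ext0 (N : ℕ) (f : EuclideanSpace ℝ (box 0 0 ((N:ℤ)-1))) (i j : ℤ) : ℝ :=
  if h : (i, j) ∈ box 0 0 ((N:ℤ)-1) then f ⟨(i,j), h⟩ else 0

lemma ext0_add (N : ℕ) (f f' : EuclideanSpace ℝ (box 0 0 ((N:ℤ)-1))) :
    ext0 N (f + f') = fun i j => ext0 N f i j + ext0 N f' i j := by
  funext i j; unfold ext0; split_ifs <;> simp

lemma ext0_smul (N : ℕ) (c : ℝ) (f : EuclideanSpace ℝ (box 0 0 ((N:ℤ)-1))) :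
    ext0 N (c • f) = fun i j => c * ext0 N f i j := by
  funext i j; unfold ext0; split_ifs <;> simp

lemma ext0_sub (N : ℕ) (f f' : EuclideanSpace ℝ (box 0 0 ((N:ℤ)-1))) :
    ext0 N (f - f') = fun i j => ext0 N f i j - ext0 N f' i j := by
  funext i j; unfold ext0; split_ifs <;> simp

lemma ext0_zero (N : ℕ) (f : EuclideanSpace ℝ (box 0 0 ((N:ℤ)-1))) (i j : ℤ)
    (h : i ≤ -N ∨ N ≤ i ∨ j ≤ -N ∨ N ≤ j) : ext0 N f i j = 0 := by
  unfold ext0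
  rw [dif_neg]
  rw [mem_box]; dsimp only; omega

lemma flux_zero (N : ℕ) (w : ℤ → ℤ → ℝ) (hw : ∀ i j : ℤ, (i ≤ -N ∨ N ≤ i ∨ j ≤ -N ∨ N ≤ j) → w i j = 0) :
    ∑ p ∈ box 0 0 (N:ℤ), gC w p.1 p.2 ^ 2 = ∑ p ∈ box 0 0 ((N:ℤ)-1), gA w p.1 p.2 * gB w p.1 p.2 := by
  have h := flux_box w 0 (0 - (N:ℤ)) (0 + N) (0 - (N:ℤ)) (0 + N) (by omega) (by omega)
  have hr : ∑ j ∈ Finset.Icc (0 - (N:ℤ)) (0 + N), ((d1 w (0 - (N:ℤ)-1) j - 0) * gB w (0 - (N:ℤ)) j - (d1 w (0 + N) j - 0) * gB w (0 + N+1) j)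
        + ∑ i ∈ Finset.Icc (0 - (N:ℤ)) (0 + N),
          ((d1 w i (0 + N+1) - 0) * gC w i (0 + N) - (d1 w i (0 - (N:ℤ)) - 0) * gC w i (0 - (N:ℤ)-1)) = 0 := by
    rw [Finset.sum_eq_zero, Finset.sum_eq_zero, add_zero]
    · intro i _
      have e1 : d1 w i (0 + N + 1) = 0 := by
        unfold d1; rw [hw (i+1) _ (by omega), hw i _ (by omega)]; ring
      have e2 : d1 w i (0 - N) = 0 := by
        unfold d1; rw [hw (i+1) _ (by omega), hw i _ (by omega)]; ring
      rw [e1, e2]; ring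
    · intro j _
      have e1 : gB w (0 - (N:ℤ)) j = 0 := by
        unfold gB; rw [hw _ (j+1) (by omega), hw _ j (by omega), hw _ (j-1) (by omega)]; ring
      have e2 : gB w (0 + N + 1) j = 0 := by
        unfold gB; rw [hw _ (j+1) (by omega), hw _ j (by omega), hw _ (j-1) (by omega)]; ring
      rw [e1, e2]; ring
  rw [hr, Finset.sum_sub_distrib, sub_eq_zero] at h
  unfold box
  rw [h]
  symm
  apply Finset.sum_subset
  · intro p; simp only [Finset.mem_product, Finset.mem_Icc]; omega
  · intro p hp hn
    simp only [Finset.mem_product, Finset.mem_Icc] at hp hn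
    have : (p.1 ≤ -N ∨ N ≤ p.1) ∨ (p.2 ≤ -N ∨ N ≤ p.2) := by omega
    rcases this with h | h
    · have : gB w p.1 p.2 = 0 := by
        unfold gB; rw [hw _ (p.2+1) (by omega), hw _ p.2 (by omega), hw _ (p.2-1) (by omega)]; ring
      rw [this, mul_zero]
    · have : gA w p.1 p.2 = 0 := by
        unfold gA; rw [hw (p.1+1) _ (by omega), hw p.1 _ (by omega), hw (p.1-1) _ (by omega)]; ring
      rw [this, zero_mul]

lemma energy (N : ℕ) (w : ℤ → ℤ → ℝ) (hw : ∀ i j : ℤ, (i ≤ -N ∨ N ≤ i ∨ j ≤ -N ∨ N ≤ j) → w i j = 0) :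
    ∑ p ∈ box 0 0 ((N:ℤ)-1), ((gA w p.1 p.2 - gB w p.1 p.2)^2 + (2 * gC w p.1 p.2)^2)
      ≤ ∑ p ∈ box 0 0 ((N:ℤ)-1), (gA w p.1 p.2 + gB w p.1 p.2)^2 ∧
    4 * ∑ p ∈ box 0 0 (N:ℤ), gC w p.1 p.2 ^ 2 ≤ ∑ p ∈ box 0 0 ((N:ℤ)-1), (gA w p.1 p.2 + gB w p.1 p.2)^2 := by
  have h := flux_zero N w hw
  have e : ∑ p ∈ box 0 0 ((N:ℤ)-1), (gA w p.1 p.2 + gB w p.1 p.2)^2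
      = ∑ p ∈ box 0 0 ((N:ℤ)-1), (gA w p.1 p.2 - gB w p.1 p.2)^2 + 4 * ∑ p ∈ box 0 0 (N:ℤ), gC w p.1 p.2 ^ 2 := by
    rw [h, Finset.mul_sum, ← Finset.sum_add_distrib]
    apply Finset.sum_congr rfl; intros; ring
  have hs : ∑ p ∈ box 0 0 ((N:ℤ)-1), gC w p.1 p.2 ^ 2 ≤ ∑ p ∈ box 0 0 (N:ℤ), gC w p.1 p.2 ^ 2 := by
    apply Finset.sum_le_sum_of_subset_of_nonneg
    · intro p; simp only [mem_box]; omega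
    · intros; positivity
  constructor
  · rw [Finset.sum_add_distrib]
    have : ∑ p ∈ box 0 0 ((N:ℤ)-1), (2 * gC w p.1 p.2)^2 = 4 * ∑ p ∈ box 0 0 ((N:ℤ)-1), gC w p.1 p.2 ^ 2 := by
      rw [Finset.mul_sum]; apply Finset.sum_congr rfl; intros; ring
    rw [this, e]; linarith
  · rw [e]
    have : 0 ≤ ∑ p ∈ box 0 0 ((N:ℤ)-1), (gA w p.1 p.2 - gB w p.1 p.2)^2 := Finset.sum_nonneg fun _ _ => sq_nonneg _
    linarith

lemma rect (w : ℤ → ℤ → ℝ) (x1 x2 y1 y2 : ℤ) (hx : x1 ≤ x2 + 1) (hy : y1 ≤ y2 + 1) :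
    ∑ p ∈ Finset.Icc x1 x2 ×ˢ Finset.Icc y1 y2, gC w p.1 p.2
      = w (x2+1) (y2+1) - w (x2+1) y1 - w x1 (y2+1) + w x1 y1 := by
  rw [Finset.sum_product]
  have : ∀ i, ∑ j ∈ Finset.Icc y1 y2, gC w i j = (w (i+1) (y2+1) - w (i+1) y1) - (w i (y2+1) - w i y1) := by
    intro i
    have := tele (fun j => w (i+1) j - w i j) y1 y2 hy
    rw [show (w (i+1) (y2+1) - w (i+1) y1) - (w i (y2+1) - w i y1) = w (i+1) (y2+1) - w i (y2+1) - (w (i+1) y1 - w i y1) by ring, ← this]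
    apply Finset.sum_congr rfl; intros; unfold gC; ring
  simp only [this]
  have := tele (fun i => w i (y2+1) - w i y1) x1 x2 hx
  rw [this]; ring

lemma corner (N : ℕ) (w : ℤ → ℤ → ℝ) (hw : ∀ i j : ℤ, (i ≤ -N ∨ N ≤ i ∨ j ≤ -N ∨ N ≤ j) → w i j = 0)
    (i j : ℤ) (hij : (i, j) ∈ box 0 0 (N:ℤ)) :
    w i j ^ 2 ≤ (i + N) * (j + N) * ∑ p ∈ box 0 0 (N:ℤ), gC w p.1 p.2 ^ 2 ∧
    w i j ^ 2 ≤ (N - i) * (N - j) * ∑ p ∈ box 0 0 (N:ℤ), gC w p.1 p.2 ^ 2 := by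
  rw [mem_box] at hij
  dsimp only at hij
  have gen : ∀ x1 x2 y1 y2 : ℤ, -N ≤ x1 → x2 ≤ N → -N ≤ y1 → y2 ≤ N → x1 ≤ x2 + 1 → y1 ≤ y2 + 1 →
      (∑ p ∈ Finset.Icc x1 x2 ×ˢ Finset.Icc y1 y2, gC w p.1 p.2)^2
        ≤ ((x2 + 1 - x1 : ℤ) : ℝ) * ((y2 + 1 - y1 : ℤ):ℝ) * ∑ p ∈ box 0 0 (N:ℤ), gC w p.1 p.2 ^ 2 := by
    intro x1 x2 y1 y2 h1 h2 h3 h4 h5 h6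
    have h := sq_sum_le_card_mul_sum_sq (s := Finset.Icc x1 x2 ×ˢ Finset.Icc y1 y2) (f := fun p => gC w p.1 p.2)
    refine h.trans ?_
    have hc : ((Finset.Icc x1 x2 ×ˢ Finset.Icc y1 y2).card : ℝ) = ((x2 + 1 - x1 : ℤ) : ℝ) * ((y2 + 1 - y1 : ℤ):ℝ) := by
      rw [Finset.card_product, Nat.cast_mul, Int.card_Icc, Int.card_Icc]
      congr 1
      · have : (((x2+1-x1).toNat : ℤ) : ℝ) = ((x2 + 1 - x1 : ℤ) : ℝ) := by rw [Int.toNat_of_nonneg (by omega)]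
        rw [← this]; exact (Int.cast_natCast _).symm
      · have : (((y2+1-y1).toNat : ℤ) : ℝ) = ((y2 + 1 - y1 : ℤ) : ℝ) := by rw [Int.toNat_of_nonneg (by omega)]
        rw [← this]; exact (Int.cast_natCast _).symm
    rw [← hc]
    apply mul_le_mul_of_nonneg_left _ (Nat.cast_nonneg _)
    apply Finset.sum_le_sum_of_subset_of_nonneg
    · intro p; simp only [mem_box, Finset.mem_product, Finset.mem_Icc]; omega
    · intros; positivity
  constructor
  · have h := gen (-N) (i-1) (-N) (j-1) (by omega) (by omega) (by omega) (by omega) (by omega) (by omega)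
    rw [rect _ _ _ _ _ (by omega) (by omega), hw (-N) _ (by omega), hw (-N) _ (by omega), hw _ (-N) (by omega)] at h
    simp only [sub_add_cancel, sub_zero, add_zero] at h
    push_cast at h
    simpa only [sub_neg_eq_add] using h
  · have h := gen i (N-1) j (N-1) (by omega) (by omega) (by omega) (by omega) (by omega) (by omega)
    rw [rect _ _ _ _ _ (by omega) (by omega), hw (N-1+1) _ (by omega), hw (N-1+1) _ (by omega), hw _ (N-1+1) (by omega)] at h
    push_cast at h
    simpa using h

/-- the discrete Laplacian -/
def lapL (N : ℕ) : EuclideanSpace ℝ (box 0 0 ((N:ℤ)-1)) →ₗ[ℝ] EuclideanSpace ℝ (box 0 0 ((N:ℤ)-1)) where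
  toFun f := WithLp.toLp 2 fun p => gA (ext0 N f) p.1.1 p.1.2 + gB (ext0 N f) p.1.1 p.1.2
  map_add' f f' := by
    ext p
    simp only [ext0_add, gA, gB, PiLp.add_apply]; ring
  map_smul' c f := by
    ext p
    simp only [ext0_smul, gA, gB, PiLp.smul_apply, RingHom.id_apply, smul_eq_mul]; ring

lemma lapL_apply (N : ℕ) (f) (p) : lapL N f p = gA (ext0 N f) p.1.1 p.1.2 + gB (ext0 N f) p.1.1 p.1.2 := rfl

lemma norm_sq_box (N : ℕ) (f : EuclideanSpace ℝ (box 0 0 ((N:ℤ)-1))) (G : ℤ → ℤ → ℝ)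
    (h : ∀ p, f p = G p.1.1 p.1.2) : ‖f‖^2 = ∑ p ∈ box 0 0 ((N:ℤ)-1), G p.1 p.2 ^ 2 := by
  have h1 := EuclideanSpace.norm_sq_eq f
  have h2 := Finset.sum_coe_sort (box 0 0 ((N:ℤ)-1)) (fun p => G p.1 p.2 ^ 2)
  rw [h1, ← h2]
  apply Finset.sum_congr rfl
  intro p _
  rw [h, Real.norm_eq_abs, sq_abs]

lemma lapL_inj (N : ℕ) : Function.Injective (lapL N) := by
  rw [← LinearMap.ker_eq_bot, LinearMap.ker_eq_bot']
  intro f hf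
  have h1 := (energy N (ext0 N f) (ext0_zero N f)).2
  rw [← norm_sq_box N (lapL N f) (fun i j => gA (ext0 N f) i j + gB (ext0 N f) i j) (lapL_apply N f), hf, norm_zero] at h1
  have h0 : ∑ p ∈ box 0 0 (N:ℤ), gC (ext0 N f) p.1 p.2 ^ 2 = 0 :=
    le_antisymm (by linarith) (Finset.sum_nonneg fun _ _ => sq_nonneg _)
  ext p
  have hp : (p.1.1, p.1.2) ∈ box 0 0 (N:ℤ) := by
    have := p.2; rw [mem_box] at this ⊢; dsimp only; omega
  have h2 := (corner N (ext0 N f) (ext0_zero N f) _ _ hp).1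
  rw [h0, mul_zero] at h2
  have h3 : ext0 N f p.1.1 p.1.2 = 0 := pow_eq_zero_iff (two_ne_zero) |>.1 (le_antisymm h2 (sq_nonneg _))
  unfold ext0 at h3
  rw [dif_pos p.2] at h3
  exact h3

theorem disc_exists (k : ℝ) (hk0 : 0 ≤ k) (hk : k < 1) (g : ℝ → ℝ → ℝ) (g0 : g 0 0 = 0)
    (hg : ∀ p q p' q', (g p q - g p' q')^2 ≤ k^2 * ((p-p')^2 + (q-q')^2))
    (P : ℤ → ℤ → ℝ) (N : ℕ) (hN : 1 ≤ N) (D : ℝ)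
    (hD : ∀ q ∈ box 0 0 ((N:ℤ)-1), |gA P q.1 q.2| ≤ D ∧ |gB P q.1 q.2| ≤ D ∧ |gC P q.1 q.2| ≤ D) :
    ∃ v : ℤ → ℤ → ℝ,
      (∀ q ∈ box 0 0 ((N:ℤ)-1), gA v q.1 q.2 + gB v q.1 q.2 = g (gA v q.1 q.2 - gB v q.1 q.2) (2 * gC v q.1 q.2)) ∧
      ∀ i j : ℤ, (i, j) ∈ box 0 0 (N:ℤ) →
        (v i j - P i j)^2 ≤ (i + N) * (j + N) * (5 * D * N / (1 - k))^2 ∧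
        (v i j - P i j)^2 ≤ (N - i) * (N - j) * (5 * D * N / (1 - k))^2 := by
  have hD0 : 0 ≤ D := (abs_nonneg _).trans (hD (0,0) (by rw [mem_box]; dsimp only; omega)).1
  have hk1 : 0 < 1 - k := by linarith
  let Le := LinearEquiv.ofInjectiveEndo (lapL N) (lapL_inj N)
  have hLe : ∀ f, lapL N (Le.symm f) = f := fun f => Le.apply_symm_apply f
  let vv : EuclideanSpace ℝ (box 0 0 ((N:ℤ)-1)) → ℤ → ℤ → ℝ := fun f i j => P i j + ext0 N (Le.symm f) i j
  let T : EuclideanSpace ℝ (box 0 0 ((N:ℤ)-1)) → EuclideanSpace ℝ (box 0 0 ((N:ℤ)-1)) := fun f =>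
    WithLp.toLp 2 fun p => g (gA (vv f) p.1.1 p.1.2 - gB (vv f) p.1.1 p.1.2) (2 * gC (vv f) p.1.1 p.1.2)
      - (gA P p.1.1 p.1.2 + gB P p.1.1 p.1.2)
  have hTd : ∀ f f', ‖T f - T f'‖ ≤ k * ‖f - f'‖ := by
    intro f f'
    apply abs_le_of_sq_le_sq' _ (by positivity) |>.2
    set w := ext0 N (Le.symm (f - f')) with hw
    have hwd : ∀ i j, w i j = ext0 N (Le.symm f) i j - ext0 N (Le.symm f') i j := by
      intro i j; rw [hw, map_sub, ext0_sub]
    have e1 : ‖f - f'‖^2 = ∑ p ∈ box 0 0 ((N:ℤ)-1), (gA w p.1 p.2 + gB w p.1 p.2)^2 := by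
      apply norm_sq_box N (f - f') (fun i j => gA w i j + gB w i j)
      intro p
      rw [← lapL_apply, hLe]
    have e2 := (energy N w (by rw [hw]; exact ext0_zero N _)).1
    rw [← e1] at e2
    have e3 : ‖T f - T f'‖^2 ≤ k^2 * ∑ p ∈ box 0 0 ((N:ℤ)-1), ((gA w p.1 p.2 - gB w p.1 p.2)^2 + (2 * gC w p.1 p.2)^2) := by
      rw [norm_sq_box N (T f - T f') (fun i j => g (gA (vv f) i j - gB (vv f) i j) (2 * gC (vv f) i j) -
        g (gA (vv f') i j - gB (vv f') i j) (2 * gC (vv f') i j)), Finset.mul_sum]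
      · apply Finset.sum_le_sum
        intro p _
        refine (hg _ _ _ _).trans (le_of_eq ?_)
        simp only [gA, gB, gC, hwd, vv]
        ring
      · intro p
        simp only [T, PiLp.sub_apply]; ring
    rw [mul_pow]
    exact e3.trans (mul_le_mul_of_nonneg_left e2 (sq_nonneg _))
  have hC : ContractingWith ⟨k, hk0⟩ T := by
    refine ⟨by exact_mod_cast hk, LipschitzWith.of_dist_le_mul ?_⟩
    intro f f'
    rw [dist_eq_norm, dist_eq_norm]
    exact hTd f f'
  set f := hC.fixedPoint T with hf
  have hfix : T f = f := hC.fixedPoint_isFixedPt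
  have hT0 : ‖T 0‖ ≤ 10 * D * N := by
    apply abs_le_of_sq_le_sq' _ (by positivity) |>.2
    rw [norm_sq_box N (T 0) (fun i j => g (gA P i j - gB P i j) (2 * gC P i j) - (gA P i j + gB P i j))]
    · calc _ ≤ ∑ p ∈ box 0 0 ((N:ℤ)-1), (5 * D)^2 := by
            apply Finset.sum_le_sum
            intro q hq
            obtain ⟨h1, h2, h3⟩ := hD q hq
            have h4 := hg (gA P q.1 q.2 - gB P q.1 q.2) (2 * gC P q.1 q.2) 0 0
            simp only [g0, sub_zero] at h4
            rw [abs_le] at h1 h2 h3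
            set a := gA P q.1 q.2
            set b := gB P q.1 q.2
            set c := gC P q.1 q.2
            have h5 : (a - b)^2 ≤ (2*D)^2 := sq_le_sq' (by linarith) (by linarith)
            have h6 : (2*c)^2 ≤ (2*D)^2 := sq_le_sq' (by linarith) (by linarith)
            have h7 : k^2 * ((a-b)^2 + (2*c)^2) ≤ 1 * ((a-b)^2 + (2*c)^2) :=
              mul_le_mul_of_nonneg_right (by nlinarith) (by positivity)
            have h8 : |g (a-b) (2*c)| ≤ 3 * D := abs_le_of_sq_le_sq (by nlinarith) (by positivity)
            rw [abs_le] at h8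
            apply sq_le_sq' <;> linarith
        _ ≤ _ := by
            rw [Finset.sum_const, nsmul_eq_mul]
            have hcard : ((box 0 0 ((N:ℤ)-1)).card : ℝ) ≤ 4 * (N:ℝ)^2 := by
              have : (box 0 0 ((N:ℤ)-1)).card ≤ (2 * N) * (2 * N) := by
                unfold box
                rw [Finset.card_product, Int.card_Icc]
                apply Nat.mul_le_mul <;> omega
              have h : ((box 0 0 ((N:ℤ)-1)).card : ℝ) ≤ (2 * N) * (2 * N) := by exact_mod_cast this
              linarith
            have := mul_le_mul_of_nonneg_right hcard (sq_nonneg (5 * D))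
            nlinarith
    · intro p
      have : ext0 N (Le.symm 0) = fun _ _ => 0 := by
        rw [map_zero]; funext i j; unfold ext0; split_ifs <;> simp
      simp only [T, vv, this, add_zero]
  have hfn : ‖f‖ ≤ 10 * D * N / (1 - k) := by
    rw [le_div_iff₀ hk1]
    have h1 := hTd f 0
    rw [hfix, sub_zero] at h1
    have h2 : ‖f‖ ≤ ‖f - T 0‖ + ‖T 0‖ := by
      have := norm_add_le (f - T 0) (T 0); rwa [sub_add_cancel] at this
    nlinarith
  refine ⟨vv f, ?_, ?_⟩
  · intro q hq
    have h1 : T f ⟨q, hq⟩ = f ⟨q, hq⟩ := by rw [hfix]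
    have h2 : lapL N (Le.symm f) ⟨q, hq⟩ = f ⟨q, hq⟩ := by rw [hLe]
    rw [lapL_apply] at h2
    simp only [T] at h1
    have h3 : gA (vv f) q.1 q.2 + gB (vv f) q.1 q.2 = gA P q.1 q.2 + gB P q.1 q.2 +
        (gA (ext0 N (Le.symm f)) q.1 q.2 + gB (ext0 N (Le.symm f)) q.1 q.2) := by
      simp only [vv, gA, gB]; ring
    rw [h3, h2, ← h1]; ring
  · intro i j hij
    have hz := ext0_zero N (Le.symm f)
    have h1 := corner N _ hz i j hij
    have h2 := (energy N _ hz).2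
    rw [← norm_sq_box N f (fun i j => gA (ext0 N (Le.symm f)) i j + gB (ext0 N (Le.symm f)) i j)
      (by intro p; rw [← lapL_apply, hLe])] at h2
    have h3 : ∑ p ∈ box 0 0 (N:ℤ), gC (ext0 N (Le.symm f)) p.1 p.2 ^ 2 ≤ (5 * D * N / (1 - k))^2 := by
      have : ‖f‖^2 ≤ (10 * D * N / (1 - k))^2 := pow_le_pow_left₀ (norm_nonneg _) hfn 2
      have e : (10 * D * N / (1 - k))^2 = 4 * (5 * D * N / (1 - k))^2 := by ring
      linarith
    have e : vv f i j - P i j = ext0 N (Le.symm f) i j := by simp only [vv]; ring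
    rw [mem_box] at hij
    dsimp only at hij
    have b1 : (0:ℝ) ≤ i + N := by exact_mod_cast (by omega : 0 ≤ i + N)
    have b2 : (0:ℝ) ≤ j + N := by exact_mod_cast (by omega : 0 ≤ j + N)
    have b3 : (0:ℝ) ≤ N - i := by exact_mod_cast (by omega : 0 ≤ N - i)
    have b4 : (0:ℝ) ≤ N - j := by exact_mod_cast (by omega : 0 ≤ N - j)
    rw [e]
    exact ⟨h1.1.trans (mul_le_mul_of_nonneg_left h3 (by positivity)), h1.2.trans (mul_le_mul_of_nonneg_left h3 (by positivity))⟩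

section
open Filter Topology

lemma lip1 (G : ℤ → ℝ) (i j : ℤ) (ω : ℝ) (h : ∀ l, min i j ≤ l → l ≤ max i j → |G (l+1) - G l| ≤ ω) :
    |G j - G i| ≤ |(j - i : ℤ)| * ω := by
  have h1 := walk' G (min i j) (max i j - 1) j i (by omega) (by omega) (by omega) (by omega)
  refine h1.trans ?_
  calc _ ≤ ∑ l ∈ Finset.Icc (min i j) (max i j - 1), ω := by
        apply Finset.sum_le_sum
        intro l hl
        rw [Finset.mem_Icc] at hl
        exact h l hl.1 (by omega)
    _ = _ := by
        rw [Finset.sum_const, nsmul_eq_mul, Int.card_Icc]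
        congr 1
        have : (((max i j - 1 + 1 - min i j).toNat : ℤ)) = |j - i| := by
          rcases le_total i j with h | h
          · rw [abs_of_nonneg (by omega)]; omega
          · rw [abs_of_nonpos (by omega)]; omega
        rw [← this]; exact (Int.cast_natCast _).symm

lemma lip2 (f : ℤ → ℤ → ℝ) (p q : ℤ × ℤ) (ω : ℝ)
    (h : ∀ z : ℤ × ℤ, min p.1 q.1 ≤ z.1 → z.1 ≤ max p.1 q.1 → min p.2 q.2 ≤ z.2 → z.2 ≤ max p.2 q.2 →
      |d1 f z.1 z.2| ≤ ω ∧ |d2 f z.1 z.2| ≤ ω) :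
    |f q.1 q.2 - f p.1 p.2| ≤ (|(q.1 - p.1 : ℤ)| + |(q.2 - p.2 : ℤ)| : ℝ) * ω := by
  have a1 := lip1 (fun i => f i p.2) p.1 q.1 ω (fun l h1 h2 => (h (l, p.2) h1 h2 (by dsimp only; omega) (by dsimp only; omega)).1)
  have a2 := lip1 (fun j => f q.1 j) p.2 q.2 ω (fun l h1 h2 => (h (q.1, l) (by dsimp only; omega) (by dsimp only; omega) h1 h2).2)
  have := abs_sub_le (f q.1 q.2) (f q.1 p.2) (f p.1 p.2)
  rw [add_mul]
  linarith

lemma step2 (f : ℤ → ℤ → ℝ) (p q : ℤ × ℤ) (ω : ℝ)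
    (h : ∀ z : ℤ × ℤ, min p.1 q.1 ≤ z.1 → z.1 ≤ max p.1 q.1 → min p.2 q.2 ≤ z.2 → z.2 ≤ max p.2 q.2 →
      |d1 f z.1 z.2 - d1 f p.1 p.2| ≤ ω ∧ |d2 f z.1 z.2 - d2 f p.1 p.2| ≤ ω) :
    |f q.1 q.2 - f p.1 p.2 - d1 f p.1 p.2 * (q.1 - p.1 : ℤ) - d2 f p.1 p.2 * (q.2 - p.2 : ℤ)|
      ≤ (|(q.1 - p.1 : ℤ)| + |(q.2 - p.2 : ℤ)| : ℝ) * ω := by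
  set a := d1 f p.1 p.2
  set b := d2 f p.1 p.2
  have := lip2 (fun i j => f i j - a * i - b * j) p q ω (by
    intro z h1 h2 h3 h4
    have := h z h1 h2 h3 h4
    simp only [d1, d2] at this ⊢
    push_cast
    rw [show f (z.1 + 1) z.2 - a * (z.1 + 1) - b * z.2 - (f z.1 z.2 - a * z.1 - b * z.2) = f (z.1 + 1) z.2 - f z.1 z.2 - a by ring,
      show f z.1 (z.2+1) - a * z.1 - b * (z.2 + 1) - (f z.1 z.2 - a * z.1 - b * z.2) = f z.1 (z.2 + 1) - f z.1 z.2 - b by ring]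
    exact this)
  refine le_trans (le_of_eq ?_) this
  congr 1
  push_cast; ring

/-- uniform regularity of a grid function of mesh `h` near a point -/
def GridReg (h : ℝ) (v : ℤ → ℤ → ℝ) (c1 c2 ρ M α : ℝ) : Prop :=
  (∀ p : ℤ × ℤ, |h * p.1 - c1| ≤ ρ → |h * p.2 - c2| ≤ ρ →
    |d1 v p.1 p.2| ≤ M * h ∧ |d2 v p.1 p.2| ≤ M * h ∧ hm v p.1 p.2 ≤ M * h^2) ∧
  (∀ f, isH v f → ∀ p q : ℤ × ℤ, |h * p.1 - c1| ≤ ρ → |h * p.2 - c2| ≤ ρ → |h * q.1 - c1| ≤ ρ → |h * q.2 - c2| ≤ ρ →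
    ∀ s : ℕ, |p.1 - q.1| ≤ s → |p.2 - q.2| ≤ s → |f p.1 p.2 - f q.1 q.2| ≤ M * h^2 * (h * s)^α)

lemma reg_between (h c ρ : ℝ) (hh : 0 < h) (a b l : ℤ) (ha : |h * a - c| ≤ ρ) (hb : |h * b - c| ≤ ρ)
    (h1 : min a b ≤ l) (h2 : l ≤ max a b) : |h * l - c| ≤ ρ := by
  rw [abs_le] at *
  rcases le_total a b with hab | hab
  · rw [min_eq_left hab] at h1; rw [max_eq_right hab] at h2
    have h1' : (a:ℝ) ≤ l := by exact_mod_cast h1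
    have h2' : (l:ℝ) ≤ b := by exact_mod_cast h2
    have := mul_le_mul_of_nonneg_left h1' hh.le
    have := mul_le_mul_of_nonneg_left h2' hh.le
    constructor <;> linarith
  · rw [min_eq_right hab] at h1; rw [max_eq_left hab] at h2
    have h1' : (b:ℝ) ≤ l := by exact_mod_cast h1
    have h2' : (l:ℝ) ≤ a := by exact_mod_cast h2
    have := mul_le_mul_of_nonneg_left h1' hh.le
    have := mul_le_mul_of_nonneg_left h2' hh.le
    constructor <;> linarith

lemma grid_jet (h : ℝ) (hh : 0 < h) (v : ℤ → ℤ → ℝ) (c1 c2 ρ M α : ℝ) (hα : 0 < α) (hM : 0 ≤ M)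
    (hv : GridReg h v c1 c2 ρ M α) (p q : ℤ × ℤ)
    (hp1 : |h * p.1 - c1| ≤ ρ) (hp2 : |h * p.2 - c2| ≤ ρ) (hq1 : |h * q.1 - c1| ≤ ρ) (hq2 : |h * q.2 - c2| ≤ ρ) (t : ℝ)
    (ht : t = |h * q.1 - h * p.1| + |h * q.2 - h * p.2|) :
    |v q.1 q.2 - v p.1 p.2 - d1 v p.1 p.2 / h * (h * q.1 - h * p.1) - d2 v p.1 p.2 / h * (h * q.2 - h * p.2)| ≤ M * (t * t) ∧
    (∀ g, (g = d1 v ∨ g = d2 v) → |g q.1 q.2 / h - g p.1 p.2 / h - d1 g p.1 p.2 / h^2 * (h * q.1 - h * p.1)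
      - d2 g p.1 p.2 / h^2 * (h * q.2 - h * p.2)| ≤ M * (t * t^α)) ∧
    (∀ f, isH v f → |f q.1 q.2 / h^2 - f p.1 p.2 / h^2| ≤ M * t^α) := by
  set s : ℕ := (q.1 - p.1).natAbs + (q.2 - p.2).natAbs with hs
  have e1 : |h * q.1 - h * p.1| = h * |(q.1 - p.1 : ℤ)| := by
    rw [← mul_sub, abs_mul, abs_of_pos hh]; push_cast; rfl
  have e2 : |h * q.2 - h * p.2| = h * |(q.2 - p.2 : ℤ)| := by
    rw [← mul_sub, abs_mul, abs_of_pos hh]; push_cast; rfl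
  have hsr : (s:ℝ) = (|(q.1 - p.1 : ℤ)| + |(q.2 - p.2 : ℤ)| : ℝ) := by
    rw [hs]; push_cast [Nat.cast_natAbs]; rfl
  have ht' : t = h * s := by rw [ht, e1, e2, hsr]; push_cast; ring
  have hs0 : (0:ℝ) ≤ s := Nat.cast_nonneg _
  have ht0 : 0 ≤ t := by rw [ht']; positivity
  have hz : ∀ z : ℤ × ℤ, min p.1 q.1 ≤ z.1 → z.1 ≤ max p.1 q.1 → min p.2 q.2 ≤ z.2 → z.2 ≤ max p.2 q.2 →
      |h * z.1 - c1| ≤ ρ ∧ |h * z.2 - c2| ≤ ρ ∧ |z.1 - p.1| ≤ s ∧ |z.2 - p.2| ≤ s := by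
    intro z h1 h2 h3 h4
    refine ⟨reg_between h c1 ρ hh _ _ _ hp1 hq1 h1 h2, reg_between h c2 ρ hh _ _ _ hp2 hq2 h3 h4, ?_, ?_⟩
    · rw [abs_le]; omega
    · rw [abs_le]; omega
  have hH : ∀ f, isH v f → ∀ z : ℤ × ℤ, min p.1 q.1 ≤ z.1 → z.1 ≤ max p.1 q.1 → min p.2 q.2 ≤ z.2 → z.2 ≤ max p.2 q.2 →
      |f z.1 z.2 - f p.1 p.2| ≤ M * h^2 * t^α := by
    intro f hf z h1 h2 h3 h4
    obtain ⟨k1, k2, k3, k4⟩ := hz z h1 h2 h3 h4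
    rw [ht']
    exact hv.2 f hf z p k1 k2 hp1 hp2 s k3 k4
  have hgr : ∀ g, (g = d1 v ∨ g = d2 v) → ∀ z : ℤ × ℤ, min p.1 q.1 ≤ z.1 → z.1 ≤ max p.1 q.1 → min p.2 q.2 ≤ z.2 → z.2 ≤ max p.2 q.2 →
      |g z.1 z.2 - g p.1 p.2| ≤ M * h * t := by
    intro g hg z h1 h2 h3 h4
    have := lip2 g p z (M * h^2) (by
      intro y g1 g2 g3 g4
      obtain ⟨k1, k2, -, -⟩ := hz y (by omega) (by omega) (by omega) (by omega)
      have hb := (hv.1 y k1 k2).2.2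
      rcases hg with rfl | rfl
      · rw [d21]
        exact ⟨(isH_le_hm v _ (Or.inl rfl) _ _).trans hb, (isH_le_hm v _ (Or.inr (Or.inl rfl)) _ _).trans hb⟩
      · exact ⟨(isH_le_hm v _ (Or.inr (Or.inl rfl)) _ _).trans hb, (isH_le_hm v _ (Or.inr (Or.inr rfl)) _ _).trans hb⟩)
    refine this.trans ?_
    have hb : (|(z.1 - p.1 : ℤ)| + |(z.2 - p.2 : ℤ)| : ℝ) ≤ s := by
      have : |z.1 - p.1| + |z.2 - p.2| ≤ (s:ℤ) := by
        rw [hs]; push_cast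
        have : |z.1 - p.1| ≤ |q.1 - p.1| := by
          rw [abs_le]; rcases le_total p.1 q.1 with h | h
          · rw [abs_of_nonneg (by omega)]; omega
          · rw [abs_of_nonpos (by omega)]; omega
        have : |z.2 - p.2| ≤ |q.2 - p.2| := by
          rw [abs_le]; rcases le_total p.2 q.2 with h | h
          · rw [abs_of_nonneg (by omega)]; omega
          · rw [abs_of_nonpos (by omega)]; omega
        omega
      exact_mod_cast this
    calc _ ≤ (s:ℝ) * (M * h^2) := mul_le_mul_of_nonneg_right hb (by positivity)
      _ = _ := by rw [ht']; ring
  refine ⟨?_, ?_, ?_⟩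
  · have := step2 v p q (M * h * t) (fun z h1 h2 h3 h4 => ⟨hgr _ (Or.inl rfl) z h1 h2 h3 h4, hgr _ (Or.inr rfl) z h1 h2 h3 h4⟩)
    rw [← hsr] at this
    refine le_trans (le_of_eq ?_) (this.trans (le_of_eq ?_))
    · congr 1; push_cast; field_simp
    · rw [show (s:ℝ) * (M * h * t) = M * (h * s * t) by ring, ← ht']
  · intro g hg
    have := step2 g p q (M * h^2 * t^α) (by
      intro z h1 h2 h3 h4
      rcases hg with rfl | rfl
      · rw [d21]
        exact ⟨hH _ (Or.inl rfl) z h1 h2 h3 h4, hH _ (Or.inr (Or.inl rfl)) z h1 h2 h3 h4⟩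
      · exact ⟨hH _ (Or.inr (Or.inl rfl)) z h1 h2 h3 h4, hH _ (Or.inr (Or.inr rfl)) z h1 h2 h3 h4⟩)
    rw [← hsr] at this
    have e : g q.1 q.2 / h - g p.1 p.2 / h - d1 g p.1 p.2 / h^2 * (h * q.1 - h * p.1) - d2 g p.1 p.2 / h^2 * (h * q.2 - h * p.2)
       = (g q.1 q.2 - g p.1 p.2 - d1 g p.1 p.2 * (q.1 - p.1 : ℤ) - d2 g p.1 p.2 * (q.2 - p.2 : ℤ)) / h := by
      push_cast; field_simp
    rw [e, abs_div, abs_of_pos hh, div_le_iff₀ hh]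
    refine this.trans (le_of_eq ?_)
    rw [show (s:ℝ) * (M * h^2 * t^α) = M * (h * s * t^α) * h by ring, ← ht']
  · intro f hf
    have := hH f hf q (by omega) (by omega) (by omega) (by omega)
    rw [← sub_div, abs_div, abs_of_pos (by positivity : 0 < h^2), div_le_iff₀ (by positivity)]
    linarith

/-- second order jet estimates, with respect to coordinates `X, Y` -/
def Jet (V G1 G2 H11 H12 H22 X Y : E2 → ℝ) (U : Set E2) (M α : ℝ) : Prop :=
  (∀ x ∈ U, |G1 x| ≤ M ∧ |G2 x| ≤ M ∧ |H11 x| ≤ M ∧ |H12 x| ≤ M ∧ |H22 x| ≤ M) ∧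
  ∀ x ∈ U, ∀ y ∈ U,
    |V y - V x - G1 x * (X y - X x) - G2 x * (Y y - Y x)|
      ≤ M * ((|X y - X x| + |Y y - Y x|) * (|X y - X x| + |Y y - Y x|)) ∧
    |G1 y - G1 x - H11 x * (X y - X x) - H12 x * (Y y - Y x)|
      ≤ M * ((|X y - X x| + |Y y - Y x|) * (|X y - X x| + |Y y - Y x|) ^ α) ∧
    |G2 y - G2 x - H12 x * (X y - X x) - H22 x * (Y y - Y x)|
      ≤ M * ((|X y - X x| + |Y y - Y x|) * (|X y - X x| + |Y y - Y x|) ^ α) ∧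
    |H11 y - H11 x| ≤ M * (|X y - X x| + |Y y - Y x|) ^ α ∧
    |H12 y - H12 x| ≤ M * (|X y - X x| + |Y y - Y x|) ^ α ∧
    |H22 y - H22 x| ≤ M * (|X y - X x| + |Y y - Y x|) ^ α

lemma ultra_lim (𝒰 : Ultrafilter ℕ) (a : ℕ → ℝ) (B : ℝ) (h : ∀ᶠ n in (𝒰 : Filter ℕ), |a n| ≤ B) :
    ∃ l, Tendsto a 𝒰 (𝓝 l) := by
  have : (𝒰.map a : Filter ℝ) ≤ 𝓟 (Icc (-B) B) := by
    rw [le_principal_iff]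
    change ∀ᶠ n in (𝒰 : Filter ℕ), a n ∈ Icc (-B) B
    filter_upwards [h] with n hn
    exact abs_le.1 hn
  obtain ⟨l, -, hl⟩ := isCompact_Icc.ultrafilter_le_nhds (𝒰.map a) this
  exact ⟨l, hl⟩

lemma ultra_limf (𝒰 : Ultrafilter ℕ) (a : ℕ → E2 → ℝ) (U : Set E2) (B : ℝ) (h : ∀ x ∈ U, ∀ᶠ n in (𝒰 : Filter ℕ), |a n x| ≤ B) :
    ∃ l : E2 → ℝ, ∀ x ∈ U, Tendsto (fun n => a n x) 𝒰 (𝓝 (l x)) := by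
  have : ∀ x, ∃ l, x ∈ U → Tendsto (fun n => a n x) 𝒰 (𝓝 l) := by
    intro x
    by_cases hx : x ∈ U
    · obtain ⟨l, hl⟩ := ultra_lim 𝒰 _ B (h x hx)
      exact ⟨l, fun _ => hl⟩
    · exact ⟨0, fun h => absurd h hx⟩
  choose l hl using this
  exact ⟨l, hl⟩

lemma jet_lim (𝒰 : Ultrafilter ℕ) (V G1 G2 H11 H12 H22 X Y : ℕ → E2 → ℝ) (V' X' Y' : E2 → ℝ) (U : Set E2)
    (M : ℕ → ℝ) (M' α : ℝ) (hα : 0 < α)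
    (hJ : ∀ᶠ n in (𝒰 : Filter ℕ), Jet (V n) (G1 n) (G2 n) (H11 n) (H12 n) (H22 n) (X n) (Y n) U (M n) α)
    (hM : Tendsto M 𝒰 (𝓝 M'))
    (hV : ∀ x ∈ U, Tendsto (fun n => V n x) 𝒰 (𝓝 (V' x)))
    (hX : ∀ x ∈ U, Tendsto (fun n => X n x) 𝒰 (𝓝 (X' x)))
    (hY : ∀ x ∈ U, Tendsto (fun n => Y n x) 𝒰 (𝓝 (Y' x))) :
    ∃ g1 g2 h11 h12 h22 : E2 → ℝ, Jet V' g1 g2 h11 h12 h22 X' Y' U M' α ∧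
      ∀ x ∈ U, Tendsto (fun n => H11 n x) 𝒰 (𝓝 (h11 x)) ∧ Tendsto (fun n => H12 n x) 𝒰 (𝓝 (h12 x)) ∧
        Tendsto (fun n => H22 n x) 𝒰 (𝓝 (h22 x)) := by
  have hMb : ∀ᶠ n in (𝒰 : Filter ℕ), M n ≤ M' + 1 := (hM.eventually_lt_const (by linarith)).mono fun n h => le_of_lt h
  have hb : ∀ᶠ n in (𝒰 : Filter ℕ), ∀ x ∈ U, |G1 n x| ≤ M' + 1 ∧ |G2 n x| ≤ M' + 1 ∧ |H11 n x| ≤ M' + 1 ∧ |H12 n x| ≤ M' + 1 ∧ |H22 n x| ≤ M' + 1 := by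
    filter_upwards [hJ, hMb] with n h1 h2 x hx
    obtain ⟨a, b, c, d, e⟩ := h1.1 x hx
    exact ⟨a.trans h2, b.trans h2, c.trans h2, d.trans h2, e.trans h2⟩
  obtain ⟨g1, k1⟩ := ultra_limf 𝒰 G1 U (M'+1) (fun x hx => hb.mono fun n h => (h x hx).1)
  obtain ⟨g2, k2⟩ := ultra_limf 𝒰 G2 U (M'+1) (fun x hx => hb.mono fun n h => (h x hx).2.1)
  obtain ⟨h11, k3⟩ := ultra_limf 𝒰 H11 U (M'+1) (fun x hx => hb.mono fun n h => (h x hx).2.2.1)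
  obtain ⟨h12, k4⟩ := ultra_limf 𝒰 H12 U (M'+1) (fun x hx => hb.mono fun n h => (h x hx).2.2.2.1)
  obtain ⟨h22, k5⟩ := ultra_limf 𝒰 H22 U (M'+1) (fun x hx => hb.mono fun n h => (h x hx).2.2.2.2)
  refine ⟨g1, g2, h11, h12, h22, ⟨?_, ?_⟩, fun x hx => ⟨k3 x hx, k4 x hx, k5 x hx⟩⟩
  · intro x hx
    refine ⟨?_, ?_, ?_, ?_, ?_⟩
    · exact le_of_tendsto_of_tendsto (k1 x hx).abs hM (hJ.mono fun n h => (h.1 x hx).1)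
    · exact le_of_tendsto_of_tendsto (k2 x hx).abs hM (hJ.mono fun n h => (h.1 x hx).2.1)
    · exact le_of_tendsto_of_tendsto (k3 x hx).abs hM (hJ.mono fun n h => (h.1 x hx).2.2.1)
    · exact le_of_tendsto_of_tendsto (k4 x hx).abs hM (hJ.mono fun n h => (h.1 x hx).2.2.2.1)
    · exact le_of_tendsto_of_tendsto (k5 x hx).abs hM (hJ.mono fun n h => (h.1 x hx).2.2.2.2)
  · intro x hx y hy
    have tx := (hX y hy).sub (hX x hx)
    have ty := (hY y hy).sub (hY x hx)
    have tt := tx.abs.add ty.abs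
    have ta := tt.rpow_const (p := α) (Or.inr hα.le)
    refine ⟨?_, ?_, ?_, ?_, ?_, ?_⟩
    · exact le_of_tendsto_of_tendsto ((((hV y hy).sub (hV x hx)).sub ((k1 x hx).mul tx)).sub ((k2 x hx).mul ty)).abs
        (hM.mul (tt.mul tt)) (hJ.mono fun n h => (h.2 x hx y hy).1)
    · exact le_of_tendsto_of_tendsto ((((k1 y hy).sub (k1 x hx)).sub ((k3 x hx).mul tx)).sub ((k4 x hx).mul ty)).abs
        (hM.mul (tt.mul ta)) (hJ.mono fun n h => (h.2 x hx y hy).2.1)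
    · exact le_of_tendsto_of_tendsto ((((k2 y hy).sub (k2 x hx)).sub ((k4 x hx).mul tx)).sub ((k5 x hx).mul ty)).abs
        (hM.mul (tt.mul ta)) (hJ.mono fun n h => (h.2 x hx y hy).2.2.1)
    · exact le_of_tendsto_of_tendsto ((k3 y hy).sub (k3 x hx)).abs
        (hM.mul ta) (hJ.mono fun n h => (h.2 x hx y hy).2.2.2.1)
    · exact le_of_tendsto_of_tendsto ((k4 y hy).sub (k4 x hx)).abs
        (hM.mul ta) (hJ.mono fun n h => (h.2 x hx y hy).2.2.2.2.1)
    · exact le_of_tendsto_of_tendsto ((k5 y hy).sub (k5 x hx)).abs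
        (hM.mul ta) (hJ.mono fun n h => (h.2 x hx y hy).2.2.2.2.2)

/-- grid index of a point -/
def ix (h : ℝ) (x : E2) : ℤ × ℤ := (⌊x 0 / h⌋, ⌊x 1 / h⌋)

lemma fl_bound (h a : ℝ) (hh : 0 < h) : |h * (⌊a / h⌋ : ℤ) - a| ≤ h := by
  have h1 := Int.floor_le (a / h)
  have h2 := Int.lt_floor_add_one (a / h)
  have e : h * (a / h) = a := by field_simp
  rw [abs_le]
  constructor
  · have := mul_lt_mul_of_pos_left h2 hh
    nlinarith
  · have := mul_le_mul_of_nonneg_left h1 hh.le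
    nlinarith

lemma jet_of_grid (h : ℝ) (hh : 0 < h) (v : ℤ → ℤ → ℝ) (c1 c2 ρ M α : ℝ) (hα : 0 < α) (hM : 0 ≤ M)
    (hv : GridReg h v c1 c2 ρ M α) (U : Set E2)
    (hU : ∀ x ∈ U, |h * (ix h x).1 - c1| ≤ ρ ∧ |h * (ix h x).2 - c2| ≤ ρ) :
    Jet (fun x => v (ix h x).1 (ix h x).2) (fun x => d1 v (ix h x).1 (ix h x).2 / h) (fun x => d2 v (ix h x).1 (ix h x).2 / h)
      (fun x => d1 (d1 v) (ix h x).1 (ix h x).2 / h^2) (fun x => d1 (d2 v) (ix h x).1 (ix h x).2 / h^2)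
      (fun x => d2 (d2 v) (ix h x).1 (ix h x).2 / h^2)
      (fun x => h * (ix h x).1) (fun x => h * (ix h x).2) U M α := by
  have hh2 : 0 < h^2 := by positivity
  constructor
  · intro x hx
    obtain ⟨u1, u2⟩ := hU x hx
    obtain ⟨a, b, c⟩ := hv.1 _ u1 u2
    simp only [abs_div, abs_of_pos hh, abs_of_pos hh2, div_le_iff₀ hh, div_le_iff₀ hh2]
    exact ⟨a, b, (isH_le_hm v _ (Or.inl rfl) _ _).trans c, (isH_le_hm v _ (Or.inr (Or.inl rfl)) _ _).trans c,
      (isH_le_hm v _ (Or.inr (Or.inr rfl)) _ _).trans c⟩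
  · intro x hx y hy
    obtain ⟨u1, u2⟩ := hU x hx
    obtain ⟨w1, w2⟩ := hU y hy
    obtain ⟨a, b, c⟩ := grid_jet h hh v c1 c2 ρ M α hα hM hv _ _ u1 u2 w1 w2 _ rfl
    have b1 := b _ (Or.inl rfl)
    rw [d21] at b1
    exact ⟨a, b1, b _ (Or.inr rfl), c _ (Or.inl rfl), c _ (Or.inr (Or.inl rfl)), c _ (Or.inr (Or.inr rfl))⟩

/-- the linear form `(a,b)` -/
def lin (a b : ℝ) : E2 →L[ℝ] ℝ := a • EuclideanSpace.proj 0 + b • EuclideanSpace.proj 1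

lemma lin_apply (a b : ℝ) (z : E2) : lin a b z = a * z 0 + b * z 1 := by
  simp [lin]

lemma coord_le (z : E2) (i : Fin 2) : |z i| ≤ ‖z‖ := by
  have := EuclideanSpace.norm_eq z
  have h := PiLp.norm_apply_le z i
  simpa using h

lemma nd_le (x y : E2) : |y 0 - x 0| + |y 1 - x 1| ≤ 2 * ‖y - x‖ := by
  have h0 := coord_le (y - x) 0
  have h1 := coord_le (y - x) 1
  simp only [PiLp.sub_apply] at h0 h1
  linarith

lemma norm_le_nd (z : E2) : ‖z‖ ≤ |z 0| + |z 1| := by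
  rw [EuclideanSpace.norm_eq, Fin.sum_univ_two]
  rw [Real.sqrt_le_left (by positivity)]
  simp only [Real.norm_eq_abs]
  nlinarith [mul_nonneg (abs_nonneg (z 0)) (abs_nonneg (z 1))]

lemma has_of_jet (f : E2 → ℝ) (U : Set E2) (hU : IsOpen U) (x : E2) (hx : x ∈ U) (a b M β : ℝ) (hβ : 0 < β)
    (h : ∀ y ∈ U, |f y - f x - a * (y 0 - x 0) - b * (y 1 - x 1)|
      ≤ M * ((|y 0 - x 0| + |y 1 - x 1|) * (|y 0 - x 0| + |y 1 - x 1|) ^ β)) :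
    HasFDerivAt f (lin a b) x := by
  rw [hasFDerivAt_iff_isLittleO, Asymptotics.isLittleO_iff]
  intro c hc
  have hcont : Continuous (fun y : E2 => 2 * (|M| * (|y 0 - x 0| + |y 1 - x 1|) ^ β)) := by
    refine continuous_const.mul (continuous_const.mul ?_)
    exact Continuous.rpow_const (by fun_prop) (fun _ => Or.inr hβ.le)
  have hlim : Tendsto (fun y : E2 => 2 * (|M| * (|y 0 - x 0| + |y 1 - x 1|) ^ β)) (𝓝 x) (𝓝 0) := by
    have := hcont.tendsto x
    simpa [Real.zero_rpow hβ.ne'] using this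
  filter_upwards [hU.mem_nhds hx, hlim.eventually_lt_const hc] with y hy hy2
  have := h y hy
  rw [Real.norm_eq_abs, lin_apply]
  simp only [PiLp.sub_apply]
  have e : f y - f x - (a * (y 0 - x 0) + b * (y 1 - x 1)) = f y - f x - a * (y 0 - x 0) - b * (y 1 - x 1) := by ring
  rw [e]
  refine this.trans ?_
  set t := |y 0 - x 0| + |y 1 - x 1|
  have ht : 0 ≤ t := by positivity
  have ht2 : t ≤ 2 * ‖y - x‖ := nd_le x y
  have htp : 0 ≤ t ^ β := Real.rpow_nonneg ht _
  have hM := le_abs_self M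
  calc M * (t * t^β) ≤ |M| * (t * t^β) := mul_le_mul_of_nonneg_right hM (by positivity)
    _ = t * (|M| * t^β) := by ring
    _ ≤ (2 * ‖y - x‖) * (|M| * t^β) := mul_le_mul_of_nonneg_right ht2 (by positivity)
    _ = (2 * (|M| * t^β)) * ‖y - x‖ := by ring
    _ ≤ c * ‖y - x‖ := mul_le_mul_of_nonneg_right hy2.le (norm_nonneg _)

/-- genuine jets -/
def TJet (V G1 G2 H11 H12 H22 : E2 → ℝ) (U : Set E2) (M α : ℝ) : Prop :=
  Jet V G1 G2 H11 H12 H22 (fun x => x 0) (fun x => x 1) U M α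

lemma TJet.hasV {V G1 G2 H11 H12 H22 : E2 → ℝ} {U : Set E2} {M α : ℝ} (h : TJet V G1 G2 H11 H12 H22 U M α) (hU : IsOpen U)
    {x : E2} (hx : x ∈ U) : HasFDerivAt V (lin (G1 x) (G2 x)) x :=
  has_of_jet V U hU x hx _ _ M 1 one_pos (fun y hy => by simpa using (h.2 x hx y hy).1)

lemma TJet.hasG1 {V G1 G2 H11 H12 H22 : E2 → ℝ} {U : Set E2} {M α : ℝ} (h : TJet V G1 G2 H11 H12 H22 U M α) (hU : IsOpen U) (hα : 0 < α)
    {x : E2} (hx : x ∈ U) : HasFDerivAt G1 (lin (H11 x) (H12 x)) x :=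
  has_of_jet G1 U hU x hx _ _ M α hα (fun y hy => (h.2 x hx y hy).2.1)

lemma TJet.hasG2 {V G1 G2 H11 H12 H22 : E2 → ℝ} {U : Set E2} {M α : ℝ} (h : TJet V G1 G2 H11 H12 H22 U M α) (hU : IsOpen U) (hα : 0 < α)
    {x : E2} (hx : x ∈ U) : HasFDerivAt G2 (lin (H12 x) (H22 x)) x :=
  has_of_jet G2 U hU x hx _ _ M α hα (fun y hy => (h.2 x hx y hy).2.2.1)

lemma cont_of_holder (f : E2 → ℝ) (U : Set E2) (M α : ℝ) (hα : 0 < α)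
    (h : ∀ x ∈ U, ∀ y ∈ U, |f y - f x| ≤ M * (|y 0 - x 0| + |y 1 - x 1|) ^ α) : ContinuousOn f U := by
  intro x hx
  have hcont : Continuous (fun y : E2 => M * (|y 0 - x 0| + |y 1 - x 1|) ^ α) := by
    refine continuous_const.mul ?_
    exact Continuous.rpow_const (by fun_prop) (fun _ => Or.inr hα.le)
  have hlim : Tendsto (fun y : E2 => M * (|y 0 - x 0| + |y 1 - x 1|) ^ α) (𝓝[U] x) (𝓝 0) := by
    have := hcont.tendsto x
    have h2 : Tendsto (fun y : E2 => M * (|y 0 - x 0| + |y 1 - x 1|) ^ α) (𝓝 x) (𝓝 0) := by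
      simpa [Real.zero_rpow hα.ne'] using this
    exact h2.mono_left nhdsWithin_le_nhds
  refine tendsto_iff_norm_sub_tendsto_zero.2 ?_
  refine squeeze_zero' (Eventually.of_forall fun _ => norm_nonneg _) ?_ hlim
  filter_upwards [self_mem_nhdsWithin] with y hy
  exact h x hx y hy

lemma contDiff_one_of (f a b : E2 → ℝ) (U : Set E2) (hU : IsOpen U) (ha : ContinuousOn a U) (hb : ContinuousOn b U)
    (h : ∀ x ∈ U, HasFDerivAt f (lin (a x) (b x)) x) (x : E2) (hx : x ∈ U) : ContDiffAt ℝ 1 f x := by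
  rw [contDiffAt_one_iff]
  refine ⟨fun y => lin (a y) (b y), U, hU.mem_nhds hx, ?_, h⟩
  unfold lin
  exact (ha.smul continuousOn_const).add (hb.smul continuousOn_const)

lemma TJet.contDiffAt {V G1 G2 H11 H12 H22 : E2 → ℝ} {U : Set E2} {M α : ℝ} (h : TJet V G1 G2 H11 H12 H22 U M α) (hU : IsOpen U) (hα : 0 < α)
    {x : E2} (hx : x ∈ U) : ContDiffAt ℝ 2 V x := by
  have c11 := cont_of_holder H11 U M α hα (fun x hx y hy => (h.2 x hx y hy).2.2.2.1)
  have c12 := cont_of_holder H12 U M α hα (fun x hx y hy => (h.2 x hx y hy).2.2.2.2.1)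
  have c22 := cont_of_holder H22 U M α hα (fun x hx y hy => (h.2 x hx y hy).2.2.2.2.2)
  have k1 := contDiff_one_of G1 _ _ U hU c11 c12 (fun x hx => h.hasG1 hU hα hx) x hx
  have k2 := contDiff_one_of G2 _ _ U hU c12 c22 (fun x hx => h.hasG2 hU hα hx) x hx
  have : ContDiffAt ℝ ((1:ℕ) + 1) V x := by
    rw [contDiffAt_succ_iff_hasFDerivAt]
    refine ⟨fun y => lin (G1 y) (G2 y), ⟨U, hU.mem_nhds hx, fun y hy => h.hasV hU hy⟩, ?_⟩
    unfold lin
    exact (k1.smul contDiffAt_const).add (k2.smul contDiffAt_const)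
  exact_mod_cast this

lemma hess_eq (V G1 G2 : E2 → ℝ) (x : E2) (a b c : ℝ) (h : ∀ᶠ y in 𝓝 x, HasFDerivAt V (lin (G1 y) (G2 y)) y)
    (h1 : HasFDerivAt G1 (lin a b) x) (h2 : HasFDerivAt G2 (lin b c) x) : hess V x = !![a, b; b, c] := by
  have e0 : (fun y => fderiv ℝ V y (EuclideanSpace.single 0 1)) =ᶠ[𝓝 x] G1 := by
    filter_upwards [h] with y hy
    rw [hy.fderiv, lin_apply]; simp
  have e1 : (fun y => fderiv ℝ V y (EuclideanSpace.single 1 1)) =ᶠ[𝓝 x] G2 := by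
    filter_upwards [h] with y hy
    rw [hy.fderiv, lin_apply]; simp
  have f0 := (h1.congr_of_eventuallyEq e0).fderiv
  have f1 := (h2.congr_of_eventuallyEq e1).fderiv
  ext i j
  fin_cases i <;> fin_cases j <;> simp [hess, f0, f1, lin_apply]

lemma TJet.hess {V G1 G2 H11 H12 H22 : E2 → ℝ} {U : Set E2} {M α : ℝ} (h : TJet V G1 G2 H11 H12 H22 U M α) (hU : IsOpen U) (hα : 0 < α)
    {x : E2} (hx : x ∈ U) : hess V x = !![H11 x, H12 x; H12 x, H22 x] :=
  hess_eq V G1 G2 x _ _ _ (by filter_upwards [hU.mem_nhds hx] with y hy using h.hasV hU hy) (h.hasG1 hU hα hx) (h.hasG2 hU hα hx)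

lemma has_sq (c : ℝ) (x : E2) : HasFDerivAt (fun y : E2 => c * (y 0 ^ 2 + y 1 ^ 2)) (lin (2 * c * x 0) (2 * c * x 1)) x := by
  apply has_of_jet _ univ isOpen_univ x (mem_univ _) _ _ (|c|) 1 one_pos
  intro y _
  rw [rpow_one]
  rw [show c * (y 0 ^ 2 + y 1 ^ 2) - c * (x 0 ^ 2 + x 1 ^ 2) - 2 * c * x 0 * (y 0 - x 0) - 2 * c * x 1 * (y 1 - x 1)
    = c * ((y 0 - x 0)^2 + (y 1 - x 1)^2) by ring, abs_mul]
  apply mul_le_mul_of_nonneg_left _ (abs_nonneg _)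
  rw [abs_of_nonneg (by positivity), ← sq_abs (y 0 - x 0), ← sq_abs (y 1 - x 1)]
  nlinarith [mul_nonneg (abs_nonneg (y 0 - x 0)) (abs_nonneg (y 1 - x 1))]

lemma has_lin (x : E2) (c d : ℝ) : HasFDerivAt (fun y : E2 => c * y 0 + d * y 1) (lin c d) x := by
  have := (lin c d).hasFDerivAt (x := x)
  refine this.congr_of_eventuallyEq ?_
  filter_upwards with y
  rw [lin_apply]

lemma TJet.hess_pert {V G1 G2 H11 H12 H22 : E2 → ℝ} {U : Set E2} {M α : ℝ} (h : TJet V G1 G2 H11 H12 H22 U M α) (hU : IsOpen U) (hα : 0 < α)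
    {x : E2} (hx : x ∈ U) (κ : ℝ) : _root_.hess (fun y => V y + κ * (y 0 ^ 2 + y 1 ^ 2)) x = !![H11 x + 2 * κ, H12 x; H12 x, H22 x + 2 * κ] := by
  have add : ∀ a b c d, lin a b + lin c d = lin (a + c) (b + d) := by
    intro a b c d; ext z; simp [lin_apply]; ring
  apply hess_eq _ (fun y => G1 y + 2 * κ * y 0) (fun y => G2 y + 2 * κ * y 1)
  · filter_upwards [hU.mem_nhds hx] with y hy
    rw [← add]
    exact (h.hasV hU hy).add (has_sq κ y)
  · have := (h.hasG1 hU hα hx).add (has_lin x (2 * κ) 0)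
    rw [add] at this
    simp only [zero_mul, add_zero, zero_add] at this
    exact this
  · have := (h.hasG2 hU hα hx).add (has_lin x 0 (2 * κ))
    rw [add] at this
    simp only [zero_mul, add_zero, zero_add] at this
    exact this

lemma hess_congr {f g : E2 → ℝ} {x : E2} (h : f =ᶠ[𝓝 x] g) : hess f x = hess g x := by
  have h2 := h.fderiv (𝕜 := ℝ)
  ext i j
  simp only [hess, Matrix.of_apply]
  have : (fun y => fderiv ℝ f y (EuclideanSpace.single j 1)) =ᶠ[𝓝 x] (fun y => fderiv ℝ g y (EuclideanSpace.single j 1)) := by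
    filter_upwards [h2] with y hy
    rw [hy]
  rw [this.fderiv_eq]

/-- extension of a locally `C²` function -/
lemma globalize (V : E2 → ℝ) (U : Set E2) (hU : IsOpen U) (hV : ∀ x ∈ U, ContDiffAt ℝ 2 V x) (x0 : E2) (hx : x0 ∈ U) :
    ∃ W : E2 → ℝ, ContDiff ℝ 2 W ∧ W =ᶠ[𝓝 x0] V := by
  obtain ⟨r, hr, hrU⟩ := Metric.nhds_basis_closedBall.mem_iff.1 (hU.mem_nhds hx)
  let f : ContDiffBump x0 := ⟨r/2, r, by positivity, by linarith⟩
  refine ⟨fun y => f y * V y, ?_, ?_⟩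
  · rw [contDiff_iff_contDiffAt]
    intro y
    by_cases hy : y ∈ closedBall x0 r
    · exact f.contDiff.contDiffAt.mul (hV y (hrU hy))
    · have : (fun y => f y * V y) =ᶠ[𝓝 y] fun _ => 0 := by
        filter_upwards [isClosed_closedBall.isOpen_compl.mem_nhds hy] with z hz
        have : f z = 0 := f.zero_of_le_dist (by
          simp only [mem_compl_iff, mem_closedBall, not_le] at hz
          exact hz.le)
        rw [this, zero_mul]
      exact contDiffAt_const.congr_of_eventuallyEq this
  · filter_upwards [f.eventuallyEq_one] with y hy
    rw [hy]; simp

/-- the open square -/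
def oQ (L : ℝ) : Set E2 := {x | |x 0| < L ∧ |x 1| < L}
/-- the closed square -/
def cQ (L : ℝ) : Set E2 := {x | |x 0| ≤ L ∧ |x 1| ≤ L}

lemma oQ_open (L : ℝ) : IsOpen (oQ L) := by
  apply IsOpen.inter
  · exact isOpen_lt (f := fun x : E2 => |x 0|) (by fun_prop) continuous_const
  · exact isOpen_lt (f := fun x : E2 => |x 1|) (by fun_prop) continuous_const

lemma cQ_compact (L : ℝ) : IsCompact (cQ L) := by
  apply Metric.isCompact_of_isClosed_isBounded
  · apply IsClosed.inter
    · exact isClosed_le (f := fun x : E2 => |x 0|) (by fun_prop) continuous_const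
    · exact isClosed_le (f := fun x : E2 => |x 1|) (by fun_prop) continuous_const
  · rw [isBounded_iff_forall_norm_le]
    refine ⟨2 * L, fun x hx => ?_⟩
    have := norm_le_nd x
    have h1 := hx.1
    have h2 := hx.2
    linarith

lemma cQ_ball {L : ℝ} (hL : L ≤ 7/10) : cQ L ⊆ ball (0 : E2) 1 := by
  intro x hx
  rw [mem_ball_zero_iff, EuclideanSpace.norm_eq, Fin.sum_univ_two]
  have h1 := hx.1
  have h2 := hx.2
  rw [Real.sqrt_lt' one_pos]
  simp only [Real.norm_eq_abs]
  nlinarith [abs_nonneg (x 0), abs_nonneg (x 1)]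

lemma oQ_sub_cQ (L : ℝ) : oQ L ⊆ cQ L := fun _ hx => ⟨hx.1.le, hx.2.le⟩

lemma cmp_aux (L : ℝ) (hL1 : L ≤ 7/10) (w : E2 → ℝ) (ε : ℝ) (hw : ContinuousOn w (oQ L))
    (hb : ∀ η > 0, ∃ δ > 0, ∀ x ∈ oQ L, (L - δ < |x 0| ∨ L - δ < |x 1|) → w x ≤ ε + η) (x1 : E2) (hx1 : x1 ∈ oQ L) (h1 : ε < w x1) :
    ∃ κ > 0, ∃ x0 ∈ oQ L, IsLocalMax (fun x => w x + κ * (x 0 ^ 2 + x 1 ^ 2)) x0 := by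
  set η := (w x1 - ε) / 3 with hη
  have hη0 : 0 < η := by rw [hη]; linarith
  obtain ⟨δ, hδ, hb⟩ := hb η hη0
  have hsq : ∀ x ∈ oQ L, 0 ≤ η * (x 0 ^ 2 + x 1 ^ 2) ∧ η * (x 0 ^ 2 + x 1 ^ 2) ≤ η := by
    intro x hx
    have a1 : x 0 ^ 2 ≤ 1/2 := by rw [← sq_abs]; nlinarith [hx.1, abs_nonneg (x 0)]
    have a2 : x 1 ^ 2 ≤ 1/2 := by rw [← sq_abs]; nlinarith [hx.2, abs_nonneg (x 1)]
    refine ⟨by positivity, by nlinarith⟩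
  have hout : ∀ x ∈ oQ L, x ∉ cQ (L - δ) → w x + η * (x 0 ^ 2 + x 1 ^ 2) < w x1 := by
    intro x hx hn
    have := hb x hx (by
      simp only [cQ, Set.mem_ofPred_eq, not_and_or, not_le] at hn
      exact hn)
    have := (hsq x hx).2
    linarith
  have hx1c : x1 ∈ cQ (L - δ) := by
    by_contra hn
    have := hout x1 hx1 hn
    have := (hsq x1 hx1).1
    linarith
  have hsub : cQ (L - δ) ⊆ oQ L := fun x hx => ⟨by linarith [hx.1], by linarith [hx.2]⟩
  have hcont : ContinuousOn (fun x : E2 => w x + η * (x 0 ^ 2 + x 1 ^ 2)) (cQ (L - δ)) :=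
    (hw.mono hsub).add (by fun_prop)
  obtain ⟨x0, hx0, hmax⟩ := (cQ_compact (L - δ)).exists_isMaxOn ⟨x1, hx1c⟩ hcont
  refine ⟨η, hη0, x0, hsub hx0, ?_⟩
  filter_upwards [(oQ_open L).mem_nhds (hsub hx0)] with x hx
  by_cases hxc : x ∈ cQ (L - δ)
  · exact hmax hxc
  · have a := hout x hx hxc
    have b := hmax hx1c
    have c := (hsq x1 hx1).1
    simp only [Set.mem_ofPred_eq] at b
    linarith

lemma F_pert {lam Lam : ℝ} (hlam : 0 < lam) {F : Mat2 → ℝ} (hF : UniformlyElliptic lam Lam F) (a b c κ : ℝ) (hκ : 0 < κ) :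
    F !![a, b; b, c] < F !![a + 2 * κ, b; b, c + 2 * κ] := by
  have e1 : !![a, b; b, c] = tpq (a + c) (a - c) (2 * b) := by
    unfold tpq; congr 1; ext i j; fin_cases i <;> fin_cases j <;> simp
  have e2 : !![a + 2 * κ, b; b, c + 2 * κ] = tpq (a + c + 4 * κ) (a - c) (2 * b) := by
    unfold tpq; congr 1; ext i j; fin_cases i <;> fin_cases j <;> simp <;> ring
  rw [e1, e2]
  have := (F_diag hlam hF (a + c + 4 * κ) (a + c) (a - c) (2 * b) (by linarith)).1
  nlinarith

lemma comparison {lam Lam : ℝ} (hlam : 0 < lam) {F : Mat2 → ℝ} (hF : UniformlyElliptic lam Lam F)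
    {u : E2 → ℝ} (hu : ContinuousOn u (closedBall (0 : E2) 1)) (hv : IsViscositySol F u (ball (0 : E2) 1))
    {L : ℝ} (hL1 : L ≤ 7/10) {α : ℝ} (hα : 0 < α) (V : E2 → ℝ)
    (hV : ∀ x0 ∈ oQ L, ∃ U, IsOpen U ∧ x0 ∈ U ∧ ∃ G1 G2 H11 H12 H22 M, TJet V G1 G2 H11 H12 H22 U M α ∧
      F !![H11 x0, H12 x0; H12 x0, H22 x0] = 0) (ε : ℝ)
    (hb : ∀ η > 0, ∃ δ > 0, ∀ x ∈ oQ L, (L - δ < |x 0| ∨ L - δ < |x 1|) → |u x - V x| ≤ ε + η) :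
    ∀ x ∈ oQ L, |u x - V x| ≤ ε := by
  have hsub : oQ L ⊆ ball (0 : E2) 1 := (oQ_sub_cQ L).trans (cQ_ball hL1)
  have hVc : ContinuousOn V (oQ L) := by
    intro x hx
    obtain ⟨U, hU, hxU, G1, G2, H11, H12, H22, M, hJ, -⟩ := hV x hx
    exact (hJ.hasV hU hxU).continuousAt.continuousWithinAt
  have huc : ContinuousOn u (oQ L) := hu.mono (hsub.trans ball_subset_closedBall)
  intro x hx
  rw [abs_le']
  constructor
  · by_contra hn
    push Not at hn
    obtain ⟨κ, hκ, x0, hx0, hmax⟩ := cmp_aux L hL1 (fun x => u x - V x) ε (huc.sub hVc) (by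
      intro η hη
      obtain ⟨δ, hδ, h⟩ := hb η hη
      exact ⟨δ, hδ, fun x hx hc => (le_abs_self _).trans (h x hx hc)⟩) x hx hn
    obtain ⟨U, hU, hxU, G1, G2, H11, H12, H22, M, hJ, hz⟩ := hV x0 hx0
    obtain ⟨W, hW, hWV⟩ := globalize V U hU (fun y hy => hJ.contDiffAt hU hα hy) x0 hxU
    have key := (hv (fun y => W y + (-κ) * (y 0 ^ 2 + y 1 ^ 2)) (hW.add (by fun_prop)) x0 (hsub hx0)).1 (by
      have h0 := hWV.self_of_nhds
      filter_upwards [hmax, hWV] with y hy hy2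
      rw [h0, hy2]
      linarith)
    have hh : hess (fun y => W y + (-κ) * (y 0 ^ 2 + y 1 ^ 2)) x0 = _ := (hess_congr (by
      filter_upwards [hWV] with y hy
      rw [hy])).trans (hJ.hess_pert hU hα hxU (-κ))
    rw [hh] at key
    have := F_pert hlam hF (H11 x0 + 2 * (-κ)) (H12 x0) (H22 x0 + 2 * (-κ)) κ hκ
    rw [show H11 x0 + 2 * (-κ) + 2 * κ = H11 x0 by ring, show H22 x0 + 2 * (-κ) + 2 * κ = H22 x0 by ring, hz] at this
    linarith
  · by_contra hn
    push Not at hn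
    obtain ⟨κ, hκ, x0, hx0, hmax⟩ := cmp_aux L hL1 (fun x => -(u x - V x)) ε (huc.sub hVc).neg (by
      intro η hη
      obtain ⟨δ, hδ, h⟩ := hb η hη
      exact ⟨δ, hδ, fun x hx hc => (neg_le_abs _).trans (h x hx hc)⟩) x hx hn
    obtain ⟨U, hU, hxU, G1, G2, H11, H12, H22, M, hJ, hz⟩ := hV x0 hx0
    obtain ⟨W, hW, hWV⟩ := globalize V U hU (fun y hy => hJ.contDiffAt hU hα hy) x0 hxU
    have key := (hv (fun y => W y + κ * (y 0 ^ 2 + y 1 ^ 2)) (hW.add (by fun_prop)) x0 (hsub hx0)).2 (by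
      have h0 := hWV.self_of_nhds
      filter_upwards [hmax, hWV] with y hy hy2
      rw [h0, hy2]
      linarith)
    have hh : hess (fun y => W y + κ * (y 0 ^ 2 + y 1 ^ 2)) x0 = _ := (hess_congr (by
      filter_upwards [hWV] with y hy
      rw [hy])).trans (hJ.hess_pert hU hα hxU κ)
    rw [hh] at key
    have := F_pert hlam hF (H11 x0) (H12 x0) (H22 x0) κ hκ
    rw [hz] at this
    linarith

lemma QC_d (k : ℝ) (hk0 : 0 ≤ k) (hk : k < 1) (g : ℝ → ℝ → ℝ)
    (hg : ∀ p q p' q', (g p q - g p' q')^2 ≤ k^2 * ((p-p')^2 + (q-q')^2)) (v : ℤ → ℤ → ℝ) (N : ℤ)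
    (hv : ∀ q ∈ box 0 0 (N-1), gA v q.1 q.2 + gB v q.1 q.2 = g (gA v q.1 q.2 - gB v q.1 q.2) (2 * gC v q.1 q.2))
    (p : ℤ × ℤ) (hp : p ∈ box 0 0 (N-2)) :
    QC (2 * (1 + k^2)/(1 - k^2)) (d1 v) p.1 p.2 ∧ QC (2 * (1 + k^2)/(1 - k^2)) (d2 v) p.1 p.2 := by
  obtain ⟨i, j⟩ := p
  rw [mem_box] at hp
  dsimp only at hp ⊢
  have h0 := hv (i, j) (by rw [mem_box]; dsimp only; omega)
  have h1 := hv (i+1, j) (by rw [mem_box]; dsimp only; omega)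
  have h2 := hv (i, j+1) (by rw [mem_box]; dsimp only; omega)
  dsimp only at h0 h1 h2
  have e1 : gA (d1 v) i j = gA v (i+1) j - gA v i j := by
    simp only [gA, d1]; rw [show i - 1 + 1 = i + 1 - 1 by ring]; ring
  have e2 : gB (d1 v) i j = gB v (i+1) j - gB v i j := by
    simp only [gB, d1]; ring
  have e3 : gC (d1 v) i j = gC v (i+1) j - gC v i j := by
    simp only [gC, d1]; ring
  have e4 : gA (d2 v) i j = gA v i (j+1) - gA v i j := by
    simp only [gA, d2]; ring
  have e5 : gB (d2 v) i j = gB v i (j+1) - gB v i j := by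
    simp only [gB, d2]; rw [show j - 1 + 1 = j + 1 - 1 by ring]; ring
  have e6 : gC (d2 v) i j = gC v i (j+1) - gC v i j := by
    simp only [gC, d2]; ring
  constructor
  · apply QC_of_contr k hk0 hk
    rw [e1, e2, e3]
    have := hg (gA v (i+1) j - gB v (i+1) j) (2 * gC v (i+1) j) (gA v i j - gB v i j) (2 * gC v i j)
    rw [← h0, ← h1] at this
    convert this using 1 <;> ring
  · apply QC_of_contr k hk0 hk
    rw [e4, e5, e6]
    have := hg (gA v i (j+1) - gB v i (j+1)) (2 * gC v i (j+1)) (gA v i j - gB v i j) (2 * gC v i j)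
    rw [← h0, ← h2] at this
    convert this using 1 <;> ring

lemma absI (h : ℝ) (hh : 0 < h) (a b : ℤ) : |h * a| ≤ h * b ↔ -b ≤ a ∧ a ≤ b := by
  rw [abs_mul, abs_of_pos hh, mul_le_mul_iff_right₀ hh, abs_le]
  constructor
  · rintro ⟨h1, h2⟩; exact ⟨by exact_mod_cast h1, by exact_mod_cast h2⟩
  · rintro ⟨h1, h2⟩; exact ⟨by exact_mod_cast h1, by exact_mod_cast h2⟩

theorem gridreg (k : ℝ) (hk0 : 0 ≤ k) (hk : k < 1) : ∃ α C : ℝ, 0 < α ∧ α < 1 ∧ 0 < C ∧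
    ∀ (g : ℝ → ℝ → ℝ), (∀ p q p' q', (g p q - g p' q')^2 ≤ k^2 * ((p-p')^2 + (q-q')^2)) →
    ∀ (h : ℝ) (N : ℕ) (v : ℤ → ℤ → ℝ), 0 < h →
    (∀ q ∈ box 0 0 ((N:ℤ)-1), gA v q.1 q.2 + gB v q.1 q.2 = g (gA v q.1 q.2 - gB v q.1 q.2) (2 * gC v q.1 q.2)) →
    ∀ c1 c2 θ m : ℝ, 0 < θ → θ ≤ 1 → 1000 * h ≤ θ → |c1| + θ + 7 * h ≤ h * N → |c2| + θ + 7 * h ≤ h * N →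
    (∀ p : ℤ × ℤ, |h * p.1 - c1| ≤ θ + 6 * h → |h * p.2 - c2| ≤ θ + 6 * h → |v p.1 p.2| ≤ m) →
    GridReg h v c1 c2 (74/100 * θ) (C * m / θ^3) α := by
  obtain ⟨α, C, hα, hα1, hC, H⟩ := DT _ (K_ge k hk0 hk)
  refine ⟨α, 8 * C, hα, hα1, by positivity, ?_⟩
  intro g hg h N v hh hv c1 c2 θ m hθ hθ1 hhθ hc1 hc2 hm
  set R : ℤ := ⌊θ / h⌋ with hR
  set cx : ℤ := ⌊c1 / h⌋ with hcx
  set cy : ℤ := ⌊c2 / h⌋ with hcy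
  have hRb := abs_le.1 (fl_bound h θ hh)
  have hxb := abs_le.1 (fl_bound h c1 hh)
  have hyb := abs_le.1 (fl_bound h c2 hh)
  rw [← hR] at hRb
  rw [← hcx] at hxb
  rw [← hcy] at hyb
  have hRle : h * R ≤ θ := by
    have := Int.floor_le (θ / h)
    rw [le_div_iff₀ hh] at this
    rw [mul_comm]; exact this
  have hR64 : (64:ℤ) ≤ R := by
    rw [hR, Int.le_floor, le_div_iff₀ hh]; push_cast; linarith
  have hR0 : (0:ℝ) < R := by exact_mod_cast (by omega : (0:ℤ) < R)
  have hm0 : 0 ≤ m := (abs_nonneg _).trans (hm (cx, cy) (by rw [abs_le]; constructor <;> linarith) (by rw [abs_le]; constructor <;> linarith))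
  -- points in the box
  have hbox : ∀ (c : ℝ) (cz : ℤ), -h ≤ h * cz - c → h * cz - c ≤ h → ∀ a r : ℤ, cz - r ≤ a → a ≤ cz + r → |h * a - c| ≤ h * r + h := by
    intro c cz h1 h2 a r h3 h4
    have h3' : ((cz - r : ℤ):ℝ) ≤ a := by exact_mod_cast h3
    have h4' : (a:ℝ) ≤ (cz + r : ℤ) := by exact_mod_cast h4
    push_cast at h3' h4'
    have := mul_le_mul_of_nonneg_left h3' hh.le
    have := mul_le_mul_of_nonneg_left h4' hh.le
    rw [abs_le]; constructor <;> nlinarith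
  obtain ⟨A, B⟩ := H v cx cy R m hR64 (by
    intro p hp
    rw [mem_box] at hp
    apply QC_d k hk0 hk g hg v N hv
    have b1 := hbox c1 cx hxb.1 hxb.2 p.1 R hp.1.1 hp.1.2
    have b2 := hbox c2 cy hyb.1 hyb.2 p.2 R hp.2.1 hp.2.2
    have f1 : |h * p.1| ≤ h * ((N:ℤ) - 2 : ℤ) := by
      push_cast
      have := abs_sub_abs_le_abs_sub (h * p.1) c1
      linarith
    have f2 : |h * p.2| ≤ h * ((N:ℤ) - 2 : ℤ) := by
      push_cast
      have := abs_sub_abs_le_abs_sub (h * p.2) c2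
      linarith
    rw [absI h hh] at f1 f2
    rw [mem_box]; omega) (by
    intro p hp
    rw [mem_box] at hp
    have b1 := hbox c1 cx hxb.1 hxb.2 p.1 (R+4) hp.1.1 hp.1.2
    have b2 := hbox c2 cy hyb.1 hyb.2 p.2 (R+4) hp.2.1 hp.2.2
    push_cast at b1 b2
    exact hm p (by linarith) (by linarith))
  have hinn : ∀ (c : ℝ) (cz : ℤ), -h ≤ h * cz - c → h * cz - c ≤ h → ∀ a : ℤ, |h * a - c| ≤ 74/100 * θ →
      4 * (a - cz) ≤ 3 * R ∧ 4 * (cz - a) ≤ 3 * R := by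
    intro c cz h1 h2 a h3
    rw [abs_le] at h3
    constructor
    · have : h * ((4 * (a - cz) : ℤ):ℝ) ≤ h * ((3 * R : ℤ):ℝ) := by push_cast; linarith
      exact_mod_cast le_of_mul_le_mul_left this hh
    · have : h * ((4 * (cz - a) : ℤ):ℝ) ≤ h * ((3 * R : ℤ):ℝ) := by push_cast; linarith
      exact_mod_cast le_of_mul_le_mul_left this hh
  -- scaling
  have hRθ : θ / 2 ≤ h * R := by linarith
  have hinv : 1 / (R:ℝ) ≤ 2 * h / θ := by
    rw [div_le_div_iff₀ hR0 hθ]; linarith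
  have hi0 : 0 ≤ 1 / (R:ℝ) := by positivity
  have hθi : 1 ≤ 1/θ := by rw [le_div_iff₀ hθ]; linarith
  have s1 : C * m / R ≤ 8 * C * m / θ^3 * h := by
    calc C * m / R = C * m * (1 / R) := by ring
      _ ≤ C * m * (2 * h / θ) := mul_le_mul_of_nonneg_left hinv (by positivity)
      _ = (2 * C * m * h * (1/θ)) * (1 * 1) := by ring
      _ ≤ (2 * C * m * h * (1/θ)) * ((1/θ) * (1/θ)) := by gcongr
      _ = 2 * (C * m / θ^3 * h) := by field_simp
      _ ≤ 8 * (C * m / θ^3 * h) := by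
        have : 0 ≤ C * m / θ^3 * h := by positivity
        linarith
      _ = _ := by ring
  have s2' : C * m / R^2 ≤ 4 * C * m / θ^2 * h^2 := by
    calc C * m / R^2 = C * m * (1 / R)^2 := by field_simp
      _ ≤ C * m * (2 * h / θ)^2 := by gcongr
      _ = _ := by field_simp; ring
  have s2 : C * m / R^2 ≤ 8 * C * m / θ^3 * h^2 := by
    refine s2'.trans ?_
    calc _ = (4 * C * m / θ^2 * h^2) * 1 := by ring
      _ ≤ (4 * C * m / θ^2 * h^2) * (1/θ) := by gcongr
      _ = 4 * (C * m / θ^3 * h^2) := by field_simp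
      _ ≤ 8 * (C * m / θ^3 * h^2) := by
        have : 0 ≤ C * m / θ^3 * h^2 := by positivity
        linarith
      _ = _ := by ring
  have s3 : ∀ s : ℕ, C * m / R^2 * ((s:ℝ)/R)^α ≤ 8 * C * m / θ^3 * h^2 * (h * s)^α := by
    intro s
    have hs0 : (0:ℝ) ≤ s := Nat.cast_nonneg _
    have : ((s:ℝ)/R)^α ≤ 2 / θ * (h * s)^α := by
      calc ((s:ℝ)/R)^α ≤ (2 / θ * (h * s))^α := by
            apply Real.rpow_le_rpow (by positivity) _ hα.le
            calc (s:ℝ)/R = s * (1 / R) := by ring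
              _ ≤ s * (2 * h / θ) := by gcongr
              _ = _ := by ring
        _ = (2/θ)^α * (h * s)^α := Real.mul_rpow (by positivity) (by positivity)
        _ ≤ (2/θ)^(1:ℝ) * (h * s)^α := by
            apply mul_le_mul_of_nonneg_right _ (by positivity)
            apply Real.rpow_le_rpow_of_exponent_le _ hα1.le
            rw [le_div_iff₀ hθ]; linarith
        _ = _ := by rw [rpow_one]
    calc C * m / R^2 * ((s:ℝ)/R)^α ≤ (4 * C * m / θ^2 * h^2) * (2 / θ * (h * s)^α) := by gcongr
      _ = _ := by field_simp; ring
  constructor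
  · intro p p1 p2
    obtain ⟨a, b, c⟩ := A p ⟨hinn c1 cx hxb.1 hxb.2 _ p1, hinn c2 cy hyb.1 hyb.2 _ p2⟩
    exact ⟨a.trans s1, b.trans s1, c.trans s2⟩
  · intro f hf p q p1 p2 q1 q2 s hs1 hs2
    exact (B f hf p q ⟨hinn c1 cx hxb.1 hxb.2 _ p1, hinn c2 cy hyb.1 hyb.2 _ p2⟩
      ⟨hinn c1 cx hxb.1 hxb.2 _ q1, hinn c2 cy hyb.1 hyb.2 _ q2⟩ s hs1 hs2).trans (s3 s)

lemma second_diff (φ : E2 → ℝ) (hφ : ContDiff ℝ 2 φ) : ∃ c : ℝ, 0 ≤ c ∧ ∀ x a b : E2, ‖x‖ ≤ 2 → ‖a‖ ≤ 1 → ‖b‖ ≤ 1 →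
    |φ (x + a + b) - φ (x + a) - φ (x + b) + φ x| ≤ c * ‖a‖ * ‖b‖ := by
  have hd : ContDiff ℝ 1 (fderiv ℝ φ) := hφ.fderiv_right (by norm_num)
  obtain ⟨K, hK⟩ := hd.contDiffOn (s := closedBall (0:E2) 4) |>.exists_lipschitzOnWith one_ne_zero (convex_closedBall _ _) (isCompact_closedBall _ _)
  refine ⟨K, K.2, ?_⟩
  intro x a b hx ha hb
  have hdiff : Differentiable ℝ φ := hφ.differentiable (by norm_num)
  have key := (convex_closedBall (0:E2) 3).norm_image_sub_le_of_norm_hasFDerivWithin_le (𝕜 := ℝ)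
    (f := fun y => φ (y + b) - φ y) (f' := fun y => fderiv ℝ φ (y + b) - fderiv ℝ φ y) (C := K * ‖b‖) (x := x) (y := x + a)
    (by
      intro y _
      apply HasFDerivAt.hasFDerivWithinAt
      have h1 : HasFDerivAt (fun y => φ (y + b)) (fderiv ℝ φ (y + b)) y := by
        have := (hdiff (y + b)).hasFDerivAt.comp y ((hasFDerivAt_id y).add_const b)
        rw [ContinuousLinearMap.comp_id] at this
        exact this
      exact h1.sub (hdiff y).hasFDerivAt)
    (by
      intro y hy
      rw [mem_closedBall_zero_iff] at hy
      have := hK.dist_le_mul (y + b) (by rw [mem_closedBall_zero_iff]; linarith [norm_add_le y b]) y (by rw [mem_closedBall_zero_iff]; linarith)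
      rw [dist_eq_norm, dist_eq_norm] at this
      simpa using this)
    (by rw [mem_closedBall_zero_iff]; linarith) (by rw [mem_closedBall_zero_iff]; linarith [norm_add_le x a])
  rw [Real.norm_eq_abs, add_sub_cancel_left] at key
  calc _ = |φ (x + a + b) - φ (x + a) - (φ (x + b) - φ x)| := by congr 1; ring
    _ ≤ _ := key
    _ = _ := by ring

/-- grid point -/
def pt (a b : ℝ) : E2 := !₂[a, b]

@[simp] lemma pt0 (a b : ℝ) : pt a b 0 = a := by simp [pt]
@[simp] lemma pt1 (a b : ℝ) : pt a b 1 = b := by simp [pt]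

lemma pt_norm (a b : ℝ) : ‖pt a b‖ ≤ |a| + |b| := by
  have := norm_le_nd (pt a b)
  simpa using this

lemma pt_add (a b c d : ℝ) : pt a b + pt c d = pt (a + c) (b + d) := by
  ext i; fin_cases i <;> simp [pt]

lemma pt_eta (x : E2) : pt (x 0) (x 1) = x := by
  ext i; fin_cases i <;> simp [pt]

lemma grid_second_diff (φ : E2 → ℝ) (hφ : ContDiff ℝ 2 φ) : ∃ c : ℝ, 0 ≤ c ∧ ∀ (h : ℝ) (i j : ℤ), 0 < h → h ≤ 1 → |h * i| ≤ 7/10 - h → |h * j| ≤ 7/10 - h →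
    |gA (fun i j => φ (pt (h * i) (h * j))) i j| ≤ c * h^2 ∧ |gB (fun i j => φ (pt (h * i) (h * j))) i j| ≤ c * h^2 ∧
      |gC (fun i j => φ (pt (h * i) (h * j))) i j| ≤ c * h^2 := by
  obtain ⟨c, hc, H⟩ := second_diff φ hφ
  refine ⟨c, hc, ?_⟩
  intro h i j hh h1 hi hj
  have n1 : ‖pt h 0‖ ≤ h := by have := pt_norm h 0; rwa [abs_of_pos hh, abs_zero, add_zero] at this
  have n2 : ‖pt 0 h‖ ≤ h := by have := pt_norm 0 h; rwa [abs_of_pos hh, abs_zero, zero_add] at this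
  have fin : ∀ a b : E2, ‖a‖ ≤ h → ‖b‖ ≤ h → c * ‖a‖ * ‖b‖ ≤ c * h^2 := by
    intro a b ha hb
    rw [mul_assoc, sq]
    gcongr
  rw [abs_le] at hi hj
  have nx : ∀ a b : ℝ, |a| ≤ 1 → |b| ≤ 1 → ‖pt a b‖ ≤ 2 := fun a b h1 h2 => (pt_norm a b).trans (by linarith)
  refine ⟨?_, ?_, ?_⟩
  · have := (H (pt (h * i - h) (h * j)) (pt h 0) (pt h 0) (nx _ _ (by rw [abs_le]; constructor <;> linarith) (by rw [abs_le]; constructor <;> linarith)) (n1.trans h1) (n1.trans h1)).trans (fin _ _ n1 n1)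
    refine le_trans (le_of_eq ?_) this
    simp only [gA, pt_add]; push_cast
    congr 1
    rw [show h * (i + 1 : ℝ) = h * i - h + h + h by ring, show h * (i - 1 : ℝ) = h * i - h by ring, add_zero, sub_add_cancel, add_zero]; ring
  · have := (H (pt (h * i) (h * j - h)) (pt 0 h) (pt 0 h) (nx _ _ (by rw [abs_le]; constructor <;> linarith) (by rw [abs_le]; constructor <;> linarith)) (n2.trans h1) (n2.trans h1)).trans (fin _ _ n2 n2)
    refine le_trans (le_of_eq ?_) this
    simp only [gB, pt_add]; push_cast
    congr 1
    rw [show h * (j + 1 : ℝ) = h * j - h + h + h by ring, show h * (j - 1 : ℝ) = h * j - h by ring, add_zero, sub_add_cancel, add_zero]; ring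
  · have := (H (pt (h * i) (h * j)) (pt h 0) (pt 0 h) (nx _ _ (by rw [abs_le]; constructor <;> linarith) (by rw [abs_le]; constructor <;> linarith)) (n1.trans h1) (n2.trans h1)).trans (fin _ _ n1 n2)
    refine le_trans (le_of_eq ?_) this
    simp only [gC, pt_add]; push_cast
    congr 1
    rw [show h * (i + 1 : ℝ) = h * i + h by ring, show h * (j + 1 : ℝ) = h * j + h by ring, add_zero, add_zero, add_zero]

lemma ix_tendsto (𝒰 : Ultrafilter ℕ) (h : ℕ → ℝ) (hh : ∀ n, 0 < h n) (h0 : Tendsto h 𝒰 (𝓝 0)) (x : E2) :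
    Tendsto (fun n => h n * ((ix (h n) x).1 : ℝ)) 𝒰 (𝓝 (x 0)) ∧ Tendsto (fun n => h n * ((ix (h n) x).2 : ℝ)) 𝒰 (𝓝 (x 1)) := by
  constructor
  · refine tendsto_iff_norm_sub_tendsto_zero.2 (squeeze_zero (fun _ => norm_nonneg _) (fun n => ?_) h0)
    exact fl_bound (h n) (x 0) (hh n)
  · refine tendsto_iff_norm_sub_tendsto_zero.2 (squeeze_zero (fun _ => norm_nonneg _) (fun n => ?_) h0)
    exact fl_bound (h n) (x 1) (hh n)

lemma grid_limit (𝒰 : Ultrafilter ℕ) (h : ℕ → ℝ) (hh : ∀ n, 0 < h n) (h0 : Tendsto h 𝒰 (𝓝 0)) (v : ℕ → ℤ → ℤ → ℝ)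
    (c1 c2 ρ ρ' M α : ℝ) (hα : 0 < α) (hM : 0 ≤ M) (hρ : ρ' < ρ)
    (hG : ∀ᶠ n in (𝒰 : Filter ℕ), GridReg (h n) (v n) c1 c2 ρ M α) (V : E2 → ℝ) (U : Set E2)
    (hU : ∀ x ∈ U, |x 0 - c1| ≤ ρ' ∧ |x 1 - c2| ≤ ρ')
    (hV : ∀ x ∈ U, Tendsto (fun n => v n (ix (h n) x).1 (ix (h n) x).2) 𝒰 (𝓝 (V x))) :
    ∃ G1 G2 H11 H12 H22, TJet V G1 G2 H11 H12 H22 U M α ∧ ∀ x ∈ U,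
      Tendsto (fun n => d1 (d1 (v n)) (ix (h n) x).1 (ix (h n) x).2 / h n ^ 2) 𝒰 (𝓝 (H11 x)) ∧
      Tendsto (fun n => d1 (d2 (v n)) (ix (h n) x).1 (ix (h n) x).2 / h n ^ 2) 𝒰 (𝓝 (H12 x)) ∧
      Tendsto (fun n => d2 (d2 (v n)) (ix (h n) x).1 (ix (h n) x).2 / h n ^ 2) 𝒰 (𝓝 (H22 x)) := by
  refine jet_lim 𝒰 (fun n x => v n (ix (h n) x).1 (ix (h n) x).2) (fun n x => d1 (v n) (ix (h n) x).1 (ix (h n) x).2 / h n)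
    (fun n x => d2 (v n) (ix (h n) x).1 (ix (h n) x).2 / h n) _ _ _
    (fun n x => h n * (ix (h n) x).1) (fun n x => h n * (ix (h n) x).2) V (fun x => x 0) (fun x => x 1) U (fun _ => M) M α hα ?_
    tendsto_const_nhds hV (fun x _ => (ix_tendsto 𝒰 h hh h0 x).1) (fun x _ => (ix_tendsto 𝒰 h hh h0 x).2)
  filter_upwards [hG, h0.eventually_lt_const (sub_pos.2 hρ)] with n hn hs
  apply jet_of_grid (h n) (hh n) (v n) c1 c2 ρ M α hα hM hn U
  intro x hx
  have a1 := fl_bound (h n) (x 0) (hh n)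
  have a2 := fl_bound (h n) (x 1) (hh n)
  obtain ⟨b1, b2⟩ := hU x hx
  have t1 := abs_sub_le (h n * (ix (h n) x).1) (x 0) c1
  have t2 := abs_sub_le (h n * (ix (h n) x).2) (x 1) c2
  simp only [ix] at t1 t2 ⊢
  constructor <;> linarith

lemma eq_limit (𝒰 : Ultrafilter ℕ) (h : ℕ → ℝ) (hh : ∀ n, 0 < h n) (h0 : Tendsto h 𝒰 (𝓝 0)) (v : ℕ → ℤ → ℤ → ℝ)
    (ρ M α : ℝ) (hα : 0 < α) (hρ : 0 < ρ) (x : E2)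
    (hG : ∀ᶠ n in (𝒰 : Filter ℕ), GridReg (h n) (v n) (x 0) (x 1) ρ M α)
    (k : ℝ) (g : ℝ → ℝ → ℝ) (hg : ∀ p q p' q', (g p q - g p' q')^2 ≤ k^2 * ((p-p')^2 + (q-q')^2))
    (heq : ∀ᶠ n in (𝒰 : Filter ℕ), gA (v n) (ix (h n) x).1 (ix (h n) x).2 + gB (v n) (ix (h n) x).1 (ix (h n) x).2
      = h n ^ 2 * g ((gA (v n) (ix (h n) x).1 (ix (h n) x).2 - gB (v n) (ix (h n) x).1 (ix (h n) x).2) / h n ^ 2)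
        (2 * gC (v n) (ix (h n) x).1 (ix (h n) x).2 / h n ^ 2))
    (a b c : ℝ) (ha : Tendsto (fun n => d1 (d1 (v n)) (ix (h n) x).1 (ix (h n) x).2 / h n ^ 2) 𝒰 (𝓝 a))
    (hb : Tendsto (fun n => d1 (d2 (v n)) (ix (h n) x).1 (ix (h n) x).2 / h n ^ 2) 𝒰 (𝓝 b))
    (hc : Tendsto (fun n => d2 (d2 (v n)) (ix (h n) x).1 (ix (h n) x).2 / h n ^ 2) 𝒰 (𝓝 c)) :
    a + c = g (a - c) (2 * b) := by
  have hpow : Tendsto (fun n => M * (h n * ((1:ℕ):ℝ)) ^ α) 𝒰 (𝓝 0) := by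
    have := ((h0.mul_const ((1:ℕ):ℝ)).rpow_const (p := α) (Or.inr hα.le)).const_mul M
    simpa [Real.zero_rpow hα.ne'] using this
  have hsm : ∀ᶠ n in (𝒰 : Filter ℕ), 2 * h n ≤ ρ := by
    have : Tendsto (fun n => 2 * h n) 𝒰 (𝓝 0) := by simpa using h0.const_mul 2
    exact (this.eventually_lt_const hρ).mono fun n h => le_of_lt h
  have shift : ∀ f : ℕ → ℤ → ℤ → ℝ, (∀ n, isH (v n) (f n)) → ∀ s1 s2 : ℤ, |s1| ≤ 1 → |s2| ≤ 1 → ∀ l : ℝ,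
      Tendsto (fun n => f n (ix (h n) x).1 (ix (h n) x).2 / h n ^ 2) 𝒰 (𝓝 l) →
      Tendsto (fun n => f n ((ix (h n) x).1 - s1) ((ix (h n) x).2 - s2) / h n ^ 2) 𝒰 (𝓝 l) := by
    intro f hf s1 s2 hs1 hs2 l hl
    have hd : Tendsto (fun n => f n ((ix (h n) x).1 - s1) ((ix (h n) x).2 - s2) / h n ^ 2 - f n (ix (h n) x).1 (ix (h n) x).2 / h n ^ 2) 𝒰 (𝓝 0) := by
      rw [tendsto_zero_iff_norm_tendsto_zero]
      refine squeeze_zero' (Eventually.of_forall fun _ => norm_nonneg _) ?_ hpow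
      filter_upwards [hG, hsm] with n hn hs
      have hp := hh n
      have a1 := fl_bound (h n) (x 0) hp
      have a2 := fl_bound (h n) (x 1) hp
      have hs1' : |(s1:ℝ)| ≤ 1 := by exact_mod_cast hs1
      have hs2' : |(s2:ℝ)| ≤ 1 := by exact_mod_cast hs2
      have key := hn.2 (f n) (hf n) ((ix (h n) x).1 - s1, (ix (h n) x).2 - s2) (ix (h n) x)
        (by
          simp only [ix]; push_cast
          rw [abs_le] at a1 hs1' ⊢
          constructor <;> nlinarith)
        (by
          simp only [ix]; push_cast
          rw [abs_le] at a2 hs2' ⊢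
          constructor <;> nlinarith)
        (by simp only [ix]; linarith) (by simp only [ix]; linarith) 1 (by simpa using hs1) (by simpa using hs2)
      rw [← sub_div, Real.norm_eq_abs, abs_div, abs_of_pos (by positivity : 0 < h n ^ 2), div_le_iff₀ (by positivity)]
      dsimp only at key
      linarith
    have := hd.add hl
    simpa using this
  have hA : Tendsto (fun n => gA (v n) (ix (h n) x).1 (ix (h n) x).2 / h n ^ 2) 𝒰 (𝓝 a) := by
    have := shift (fun n => d1 (d1 (v n))) (fun n => Or.inl rfl) 1 0 (by simp) (by simp) a ha
    convert this using 3 with n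
    simp only [gA, d1, sub_zero]
    rw [sub_add_cancel]; ring
  have hB : Tendsto (fun n => gB (v n) (ix (h n) x).1 (ix (h n) x).2 / h n ^ 2) 𝒰 (𝓝 c) := by
    have := shift (fun n => d2 (d2 (v n))) (fun n => Or.inr (Or.inr rfl)) 0 1 (by simp) (by simp) c hc
    convert this using 3 with n
    simp only [gB, d2, sub_zero]
    rw [sub_add_cancel]; ring
  have hC : Tendsto (fun n => gC (v n) (ix (h n) x).1 (ix (h n) x).2 / h n ^ 2) 𝒰 (𝓝 b) := by
    convert hb using 3 with n
    simp only [gC, d1, d2]; ring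
  have hS : Tendsto (fun n => g ((gA (v n) (ix (h n) x).1 (ix (h n) x).2 - gB (v n) (ix (h n) x).1 (ix (h n) x).2) / h n ^ 2)
        (2 * gC (v n) (ix (h n) x).1 (ix (h n) x).2 / h n ^ 2)) 𝒰 (𝓝 (a + c)) := by
    refine (hA.add hB).congr' ?_
    filter_upwards [heq] with n hn
    have hp := hh n
    rw [← add_div, hn]
    field_simp
  have hT : Tendsto (fun n => g ((gA (v n) (ix (h n) x).1 (ix (h n) x).2 - gB (v n) (ix (h n) x).1 (ix (h n) x).2) / h n ^ 2)
        (2 * gC (v n) (ix (h n) x).1 (ix (h n) x).2 / h n ^ 2)) 𝒰 (𝓝 (g (a - c) (2 * b))) := by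
    have lim : Tendsto (fun n => Real.sqrt (k^2 * (((gA (v n) (ix (h n) x).1 (ix (h n) x).2 / h n ^ 2 - gB (v n) (ix (h n) x).1 (ix (h n) x).2 / h n ^ 2) - (a - c))^2
        + (2 * (gC (v n) (ix (h n) x).1 (ix (h n) x).2 / h n ^ 2) - 2 * b)^2))) 𝒰 (𝓝 0) := by
      have := (((((hA.sub hB).sub_const (a - c)).pow 2).add (((hC.const_mul 2).sub_const (2 * b)).pow 2)).const_mul (k^2)).sqrt
      simpa using this
    refine tendsto_iff_norm_sub_tendsto_zero.2 (squeeze_zero (fun _ => norm_nonneg _) (fun n => ?_) lim)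
    rw [Real.norm_eq_abs]
    apply Real.abs_le_sqrt
    refine (hg _ _ _ _).trans (le_of_eq ?_)
    rw [sub_div, mul_div_assoc]
  exact tendsto_nhds_unique hS hT

lemma smooth_approx (u : E2 → ℝ) (hu : ContinuousOn u (closedBall (0 : E2) 1)) (ε : ℝ) (hε : 0 < ε) :
    ∃ φ : E2 → ℝ, ContDiff ℝ 2 φ ∧ ∀ x ∈ closedBall (0:E2) 1, |φ x - u x| ≤ ε := by
  obtain ⟨f, hf⟩ := ContinuousMap.exists_restrict_eq (isClosed_closedBall (x := (0:E2)) (ε := 1)) ⟨_, hu.domRestrict⟩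
  obtain ⟨φ, h1, h2, -⟩ := f.continuous.exists_contDiff_approx 2 (ε := fun _ => ε) continuous_const (fun _ => hε)
  refine ⟨φ, h1, fun x hx => ?_⟩
  have := h2 x
  have e : f x = u x := by
    have := DFunLike.congr_fun hf ⟨x, hx⟩
    simpa using this
  rw [e, Real.dist_eq] at this
  exact this.le

lemma scaled_lip (k : ℝ) (g : ℝ → ℝ → ℝ) (hg : ∀ p q p' q', (g p q - g p' q')^2 ≤ k^2 * ((p-p')^2 + (q-q')^2)) (h : ℝ) (hh : 0 < h) (p q p' q' : ℝ) :
    (h^2 * g (p/h^2) (q/h^2) - h^2 * g (p'/h^2) (q'/h^2))^2 ≤ k^2 * ((p-p')^2 + (q-q')^2) := by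
  have := mul_le_mul_of_nonneg_left (hg (p/h^2) (q/h^2) (p'/h^2) (q'/h^2)) (by positivity : 0 ≤ (h^2)^2)
  calc _ = (h^2)^2 * (g (p/h^2) (q/h^2) - g (p'/h^2) (q'/h^2))^2 := by ring
    _ ≤ _ := this
    _ = _ := by field_simp

/-- discrete approximating sequence -/
lemma seq_exists (k : ℝ) (hk0 : 0 ≤ k) (hk : k < 1) (g : ℝ → ℝ → ℝ) (g0 : g 0 0 = 0)
    (hg : ∀ p q p' q', (g p q - g p' q')^2 ≤ k^2 * ((p-p')^2 + (q-q')^2)) (φ : E2 → ℝ) (hφ : ContDiff ℝ 2 φ) :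
    ∃ (B : ℝ), 0 ≤ B ∧ ∀ n : ℕ, ∃ v : ℤ → ℤ → ℝ, ∀ h : ℝ, h = 7/10/((n:ℝ)+1) →
      (∀ q ∈ box 0 0 (((n+1:ℕ):ℤ)-1), gA v q.1 q.2 + gB v q.1 q.2 = h^2 * g ((gA v q.1 q.2 - gB v q.1 q.2)/h^2) (2 * gC v q.1 q.2/h^2)) ∧
      ∀ i j : ℤ, (i, j) ∈ box 0 0 ((n+1:ℕ):ℤ) →
        (v i j - φ (pt (h * i) (h * j)))^2 ≤ (h * i + 7/10) * (h * j + 7/10) * B^2 ∧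
        (v i j - φ (pt (h * i) (h * j)))^2 ≤ (7/10 - h * i) * (7/10 - h * j) * B^2 := by
  obtain ⟨c, hc, H⟩ := grid_second_diff φ hφ
  have hk1 : 0 < 1 - k := by linarith
  refine ⟨5 * c * (7/10) / (1 - k), by positivity, ?_⟩
  intro n
  set h : ℝ := 7/10/((n:ℝ)+1) with hh
  have hn : (0:ℝ) < (n:ℝ) + 1 := by positivity
  have h0 : 0 < h := by positivity
  have hN : h * ((n:ℝ) + 1) = 7/10 := by rw [hh]; field_simp
  have h1 : h ≤ 1 := by rw [hh, div_le_one hn]; have : (0:ℝ) ≤ n := Nat.cast_nonneg _; linarith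
  obtain ⟨v, hv1, hv2⟩ := disc_exists k hk0 hk (fun p q => h^2 * g (p/h^2) (q/h^2)) (by simp [g0]) (fun p q p' q' => scaled_lip k g hg h h0 p q p' q')
    (fun i j => φ (pt (h * i) (h * j))) (n+1) (by omega) (c * h^2) (by
      intro q hq
      rw [mem_box] at hq
      have f1 : |h * q.1| ≤ h * ((n:ℤ):ℝ) := by rw [absI h h0]; push_cast at hq; omega
      have f2 : |h * q.2| ≤ h * ((n:ℤ):ℝ) := by rw [absI h h0]; push_cast at hq; omega
      push_cast at f1 f2
      exact H h q.1 q.2 h0 h1 (by linarith) (by linarith))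
  refine ⟨v, ?_⟩
  intro h' hh'
  rw [hh']
  refine ⟨hv1, ?_⟩
  intro i j hij
  obtain ⟨a, b⟩ := hv2 i j hij
  have e : 5 * (c * h^2) * ((n+1:ℕ):ℝ) / (1 - k) = h * (5 * c * (7/10) / (1 - k)) := by
    rw [← hN]; push_cast; field_simp
  rw [e] at a b
  push_cast at a b
  constructor
  · refine a.trans (le_of_eq ?_)
    rw [← hN]; ring
  · refine b.trans (le_of_eq ?_)
    nth_rewrite 2 [← hN]
    nth_rewrite 2 [← hN]
    ring

lemma ix_box (n : ℕ) (h : ℝ) (h0 : 0 < h) (hN : h * ((n:ℝ) + 1) = 7/10) (x : E2) (hx : x ∈ oQ (7/10)) :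
    ix h x ∈ box 0 0 ((n+1:ℕ):ℤ) := by
  have key : ∀ a : ℝ, |a| < 7/10 → -((n:ℤ)+1) ≤ ⌊a / h⌋ ∧ ⌊a / h⌋ ≤ (n:ℤ)+1 := by
    intro a ha
    rw [abs_lt] at ha
    constructor
    · rw [Int.le_floor, le_div_iff₀ h0]; push_cast; linarith
    · have : ⌊a / h⌋ < (n:ℤ) + 1 := by
        rw [Int.floor_lt, div_lt_iff₀ h0]; push_cast; linarith
      exact this.le
  have k1 := key _ hx.1
  have k2 := key _ hx.2
  rw [mem_box]
  simp only [ix]; push_cast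
  omega

set_option maxHeartbeats 1000000 in
theorem approx (lam Lam : ℝ) (hlam : 0 < lam) (hLam : lam ≤ Lam) : ∃ α C : ℝ, 0 < α ∧ α < 1 ∧ 0 < C ∧
    ∀ (F : Mat2 → ℝ) (u : E2 → ℝ), UniformlyElliptic lam Lam F → F 0 = 0 →
      ContinuousOn u (closedBall (0 : E2) 1) → IsViscositySol F u (ball (0 : E2) 1) →
      ∀ S, (∀ x ∈ ball (0:E2) 1, |u x| ≤ S) → ∀ ε > 0, ∃ V G1 G2 H11 H12 H22 : E2 → ℝ,
        TJet V G1 G2 H11 H12 H22 (oQ (505/1000)) (C * (S + 2 * ε)) α ∧ ∀ x ∈ oQ (7/10), |u x - V x| ≤ ε := by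
  set k := (Lam - lam) / (Lam + lam) with hk
  have hs : 0 < Lam + lam := by linarith
  have hk0 : 0 ≤ k := div_nonneg (by linarith) hs.le
  have hk1 : k < 1 := by rw [hk, div_lt_one hs]; linarith
  obtain ⟨α, C, hα, hα1, hC, HG⟩ := gridreg k hk0 hk1
  refine ⟨α, C / (69/100)^3, hα, hα1, by positivity, ?_⟩
  intro F u hF hF0 hu hvis S hS ε hε
  have hS0 : 0 ≤ S := (abs_nonneg _).trans (hS 0 (by simp))
  obtain ⟨g, hgF, g0, hg⟩ := exists_g hlam hLam hF hF0
  obtain ⟨φ, hφ, hφu⟩ := smooth_approx u hu ε hε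
  obtain ⟨B, hB, hseq⟩ := seq_exists k hk0 hk1 g g0 hg φ hφ
  choose v hv using hseq
  let h : ℕ → ℝ := fun n => 7/10/((n:ℝ)+1)
  have hh : ∀ n, 0 < h n := fun n => by positivity
  have hN : ∀ n, h n * ((n:ℝ) + 1) = 7/10 := fun n => by
    have : (n:ℝ) + 1 ≠ 0 := by positivity
    simp only [h]; field_simp
  let 𝒰 : Ultrafilter ℕ := hyperfilter ℕ
  have h0 : Tendsto h 𝒰 (𝓝 0) := by
    have : Tendsto h atTop (𝓝 0) := by
      have := (tendsto_one_div_add_atTop_nhds_zero_nat (𝕜 := ℝ)).const_mul (7/10)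
      rw [mul_zero] at this
      refine this.congr fun n => ?_
      simp only [h]; ring
    exact this.mono_left (Nat.hyperfilter_le_atTop)
  have hsmall : ∀ d > 0, ∀ᶠ n in (𝒰 : Filter ℕ), h n ≤ d := fun d hd => (h0.eventually_lt_const hd).mono fun n h => le_of_lt h
  have heq : ∀ n, ∀ q ∈ box 0 0 (((n+1:ℕ):ℤ)-1), gA (v n) q.1 q.2 + gB (v n) q.1 q.2
      = (h n)^2 * g ((gA (v n) q.1 q.2 - gB (v n) q.1 q.2)/(h n)^2) (2 * gC (v n) q.1 q.2/(h n)^2) := fun n => (hv n (h n) rfl).1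
  have hest := fun n => (hv n (h n) rfl).2
  -- uniform bound
  obtain ⟨m0, hm0⟩ : ∃ m0, ∀ n, ∀ p : ℤ × ℤ, |h n * p.1| ≤ 7/10 → |h n * p.2| ≤ 7/10 → |v n p.1 p.2| ≤ m0 := by
    refine ⟨S + ε + 14/10 * B, ?_⟩
    intro n p h1 h2
    have hb : (p.1, p.2) ∈ box 0 0 ((n+1:ℕ):ℤ) := by
      have e : (7/10:ℝ) = h n * (((n:ℤ)+1 : ℤ):ℝ) := by push_cast; rw [hN]
      rw [e, absI _ (hh n)] at h1 h2
      rw [mem_box]; push_cast; omega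
    have q1 := (hest n p.1 p.2 hb).1
    rw [abs_le] at h1 h2
    have hle : (v n p.1 p.2 - φ (pt (h n * p.1) (h n * p.2)))^2 ≤ (14/10 * B)^2 := by
      refine q1.trans ?_
      calc _ ≤ (14/10 * (14/10)) * B^2 := by
            apply mul_le_mul_of_nonneg_right _ (by positivity)
            apply mul_le_mul <;> linarith
        _ = _ := by ring
    have hle2 := abs_le_of_sq_le_sq hle (by positivity)
    have hpt : pt (h n * p.1) (h n * p.2) ∈ ball (0:E2) 1 := cQ_ball le_rfl ⟨by rw [pt0, abs_le]; exact h1, by rw [pt1, abs_le]; exact h2⟩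
    have q2 := hφu _ (ball_subset_closedBall hpt)
    have q3 := hS _ hpt
    rw [abs_le] at *
    constructor <;> linarith
  have hm00 : 0 ≤ m0 := (abs_nonneg _).trans (hm0 0 (0,0) (by simp; norm_num) (by simp; norm_num))
  -- the limit
  have hixle : ∀ n, ∀ x ∈ oQ (7/10), |h n * (ix (h n) x).1| ≤ 7/10 ∧ |h n * (ix (h n) x).2| ≤ 7/10 := by
    intro n x hx
    have := ix_box n (h n) (hh n) (hN n) x hx
    rw [mem_box] at this
    have e : (7/10:ℝ) = h n * (((n:ℤ)+1 : ℤ):ℝ) := by push_cast; rw [hN]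
    rw [e, absI _ (hh n), absI _ (hh n)]
    push_cast at this
    omega
  obtain ⟨V, hV⟩ := ultra_limf 𝒰 (fun n x => v n (ix (h n) x).1 (ix (h n) x).2) (oQ (7/10)) m0 (fun x hx =>
    Eventually.of_forall fun n => hm0 n _ (hixle n x hx).1 (hixle n x hx).2)
  -- local regularity
  have hloc : ∀ x ∈ oQ (7/10), ∃ ρ M, 0 < ρ ∧ 0 ≤ M ∧ ρ < 7/10 - |x 0| ∧ ρ < 7/10 - |x 1| ∧
      ∀ᶠ n in (𝒰 : Filter ℕ), GridReg (h n) (v n) (x 0) (x 1) ρ M α := by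
    intro x hx
    set d := min (7/10 - |x 0|) (7/10 - |x 1|) with hd
    have hd0 : 0 < d := lt_min (by linarith [hx.1]) (by linarith [hx.2])
    have hd1 : d ≤ 7/10 - |x 0| := min_le_left _ _
    have hd2 : d ≤ 7/10 - |x 1| := min_le_right _ _
    have hdle : d ≤ 7/10 := by linarith [abs_nonneg (x 0)]
    refine ⟨74/100 * (d/2), C * m0 / (d/2)^3, by positivity, by positivity, by linarith, by linarith, ?_⟩
    filter_upwards [hsmall (d/2000) (by positivity)] with n hn
    have hhn := hh n
    refine HG (fun p q => (h n)^2 * g (p/(h n)^2) (q/(h n)^2)) (fun p q p' q' => scaled_lip k g hg (h n) (hh n) p q p' q') (h n) (n+1) (v n) (hh n) (heq n)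
      (x 0) (x 1) (d/2) m0 (by positivity) (by linarith) (by linarith) ?_ ?_ ?_
    · push_cast; rw [hN]; linarith
    · push_cast; rw [hN]; linarith
    · intro p h1 h2
      apply hm0 n p
      · have := abs_sub_abs_le_abs_sub (h n * p.1) (x 0); linarith
      · have := abs_sub_abs_le_abs_sub (h n * p.2) (x 1); linarith
  -- classical solution
  have hcl : ∀ x0 ∈ oQ (7/10), ∃ U, IsOpen U ∧ x0 ∈ U ∧ ∃ G1 G2 H11 H12 H22 M, TJet V G1 G2 H11 H12 H22 U M α ∧
      F !![H11 x0, H12 x0; H12 x0, H22 x0] = 0 := by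
    intro x0 hx0
    obtain ⟨ρ, M, hρ, hM, hρ1, hρ2, hG⟩ := hloc x0 hx0
    let U : Set E2 := {x | |x 0 - x0 0| < ρ/2} ∩ {x | |x 1 - x0 1| < ρ/2}
    have hU : IsOpen U := (isOpen_lt (f := fun x : E2 => |x 0 - x0 0|) (by fun_prop) continuous_const).inter
      (isOpen_lt (f := fun x : E2 => |x 1 - x0 1|) (by fun_prop) continuous_const)
    have hxU : x0 ∈ U := ⟨by simpa using hρ, by simpa using hρ⟩
    have hUQ : U ⊆ oQ (7/10) := by
      rintro x ⟨a, b⟩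
      simp only [Set.mem_ofPred_eq] at a b
      have := abs_sub_abs_le_abs_sub (x 0) (x0 0)
      have := abs_sub_abs_le_abs_sub (x 1) (x0 1)
      exact ⟨by linarith, by linarith⟩
    obtain ⟨G1, G2, H11, H12, H22, hJ, hT⟩ := grid_limit 𝒰 h hh h0 v (x0 0) (x0 1) ρ (ρ/2) M α hα hM (by linarith) hG V U
      (fun x hx => ⟨le_of_lt hx.1, le_of_lt hx.2⟩) (fun x hx => hV x (hUQ hx))
    refine ⟨U, hU, hxU, G1, G2, H11, H12, H22, M, hJ, ?_⟩
    obtain ⟨t1, t2, t3⟩ := hT x0 hxU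
    have he := eq_limit 𝒰 h hh h0 v ρ M α hα hρ x0 hG k g hg (by
      filter_upwards [hsmall (ρ/2) (by positivity)] with n hn
      apply heq n
      have hb := fl_bound (h n) (x0 0) (hh n)
      have hb2 := fl_bound (h n) (x0 1) (hh n)
      have f1 : |h n * (ix (h n) x0).1| ≤ h n * ((n:ℤ):ℝ) := by
        have e : h n * ((n:ℤ):ℝ) = 7/10 - h n := by rw [← hN n]; push_cast; ring
        rw [e]
        have := abs_sub_abs_le_abs_sub (h n * (ix (h n) x0).1) (x0 0)
        simp only [ix] at this ⊢; linarith
      have f2 : |h n * (ix (h n) x0).2| ≤ h n * ((n:ℤ):ℝ) := by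
        have e : h n * ((n:ℤ):ℝ) = 7/10 - h n := by rw [← hN n]; push_cast; ring
        rw [e]
        have := abs_sub_abs_le_abs_sub (h n * (ix (h n) x0).2) (x0 1)
        simp only [ix] at this ⊢; linarith
      rw [absI _ (hh n)] at f1 f2
      rw [mem_box]; push_cast; omega) _ _ _ t1 t2 t3
    have := hgF (H11 x0 - H22 x0) (2 * H12 x0)
    rw [← he] at this
    rw [← this]
    congr 1
    unfold tpq; congr 1; ext i j; fin_cases i <;> fin_cases j <;> simp
  -- boundary values
  have hbd : ∀ x ∈ oQ (7/10), (V x - φ x)^2 ≤ (x 0 + 7/10) * (x 1 + 7/10) * B^2 ∧ (V x - φ x)^2 ≤ (7/10 - x 0) * (7/10 - x 1) * B^2 := by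
    intro x hx
    obtain ⟨i1, i2⟩ := ix_tendsto 𝒰 h hh h0 x
    have hP : Tendsto (fun n => φ (pt (h n * (ix (h n) x).1) (h n * (ix (h n) x).2))) 𝒰 (𝓝 (φ x)) := by
      have hc : Continuous fun z : ℝ × ℝ => φ (pt z.1 z.2) := by
        apply hφ.continuous.comp
        unfold pt
        fun_prop
      have := (hc.tendsto (x 0, x 1)).comp (i1.prodMk_nhds i2)
      dsimp only at this
      rw [pt_eta] at this
      exact this
    have hl := ((hV x hx).sub hP).pow 2
    have hb := fun n => hest n _ _ (ix_box n (h n) (hh n) (hN n) x hx)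
    constructor
    · exact le_of_tendsto_of_tendsto' hl (((i1.add_const _).mul (i2.add_const _)).mul_const _) (fun n => (hb n).1)
    · exact le_of_tendsto_of_tendsto' hl (((i1.const_sub _).mul (i2.const_sub _)).mul_const _) (fun n => (hb n).2)
  have hcmp : ∀ x ∈ oQ (7/10), |u x - V x| ≤ ε := by
    apply comparison hlam hF hu hvis le_rfl hα V hcl ε
    intro η hη
    have hpos : 0 < 2 * B^2 + 1 := by positivity
    refine ⟨η^2 / (2 * B^2 + 1), by positivity, ?_⟩
    set δ := η^2 / (2 * B^2 + 1) with hδ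
    have hδe : δ * (2 * B^2 + 1) = η^2 := by rw [hδ]; field_simp
    have hδ0 : 0 ≤ δ := by positivity
    intro x hx hor
    have hfin : (V x - φ x)^2 ≤ η^2 := by
      obtain ⟨b1, b2⟩ := hbd x hx
      have e1 := abs_lt.1 hx.1
      have e2 := abs_lt.1 hx.2
      have conv : ∀ a b : ℝ, 0 ≤ a → 0 ≤ b → b ≤ 2 → a ≤ δ → a * b * B^2 ≤ η^2 := by
        intro a b ha hb hb2 had
        calc a * b * B^2 ≤ δ * 2 * B^2 := by gcongr
          _ ≤ η^2 := by rw [← hδe]; nlinarith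
      rcases hor with h1 | h1
      · rcases abs_cases (x 0) with ⟨e, -⟩ | ⟨e, -⟩
        · exact b2.trans (conv _ _ (by linarith) (by linarith) (by linarith) (by linarith))
        · exact b1.trans (conv _ _ (by linarith) (by linarith) (by linarith) (by linarith))
      · rcases abs_cases (x 1) with ⟨e, -⟩ | ⟨e, -⟩
        · rw [mul_comm (7/10 - x 0)] at b2
          exact b2.trans (conv _ _ (by linarith) (by linarith) (by linarith) (by linarith))
        · rw [mul_comm (x 0 + 7/10)] at b1
          exact b1.trans (conv _ _ (by linarith) (by linarith) (by linarith) (by linarith))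
    have q1 := abs_le_of_sq_le_sq hfin hη.le
    have q2 := hφu x (ball_subset_closedBall (cQ_ball le_rfl (oQ_sub_cQ _ hx)))
    rw [abs_le] at *
    constructor <;> linarith
  -- bound for the discrete functions
  have hdb : ∀ᶠ n in (𝒰 : Filter ℕ), ∀ p : ℤ × ℤ, |h n * p.1 - 0| ≤ 69/100 + 6 * h n → |h n * p.2 - 0| ≤ 69/100 + 6 * h n →
      |v n p.1 p.2| ≤ S + 2 * ε := by
    by_contra hcon
    have hcon2 := (Ultrafilter.eventually_not (f := 𝒰)).2 hcon
    have hex : ∀ n, ∃ p : ℤ × ℤ, (¬ ∀ p : ℤ × ℤ, |h n * p.1 - 0| ≤ 69/100 + 6 * h n → |h n * p.2 - 0| ≤ 69/100 + 6 * h n →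
      |v n p.1 p.2| ≤ S + 2 * ε) → |h n * p.1| ≤ 69/100 + 6 * h n ∧ |h n * p.2| ≤ 69/100 + 6 * h n ∧ S + 2 * ε < |v n p.1 p.2| := by
      intro n
      by_cases hc : ∀ p : ℤ × ℤ, |h n * p.1 - 0| ≤ 69/100 + 6 * h n → |h n * p.2 - 0| ≤ 69/100 + 6 * h n → |v n p.1 p.2| ≤ S + 2 * ε
      · exact ⟨0, fun h => absurd hc h⟩
      · have hc' := hc
        push Not at hc'
        obtain ⟨p, a, b, c⟩ := hc'
        rw [sub_zero] at a b
        exact ⟨p, fun _ => ⟨a, b, c⟩⟩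
    choose p hp using hex
    have hp2 : ∀ᶠ n in (𝒰 : Filter ℕ), |h n * (p n).1| ≤ 69/100 + 6 * h n ∧ |h n * (p n).2| ≤ 69/100 + 6 * h n ∧ S + 2 * ε < |v n (p n).1 (p n).2| := by
      filter_upwards [hcon2] with n hn using hp n hn
    have hrb : Tendsto (fun n => 69/100 + 6 * h n) 𝒰 (𝓝 (69/100)) := by
      have := (h0.const_mul 6).const_add (69/100)
      simpa using this
    obtain ⟨z1, hz1⟩ := ultra_lim 𝒰 (fun n => h n * (p n).1) 1 (by
      filter_upwards [hp2, hsmall (1/100) (by norm_num)] with n hn hs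
      linarith [hn.1])
    obtain ⟨z2, hz2⟩ := ultra_lim 𝒰 (fun n => h n * (p n).2) 1 (by
      filter_upwards [hp2, hsmall (1/100) (by norm_num)] with n hn hs
      linarith [hn.2.1])
    have hz1b : |z1| ≤ 69/100 := le_of_tendsto_of_tendsto hz1.abs hrb (hp2.mono fun n h => h.1)
    have hz2b : |z2| ≤ 69/100 := le_of_tendsto_of_tendsto hz2.abs hrb (hp2.mono fun n h => h.2.1)
    set x := pt z1 z2 with hx
    have x0 : x 0 = z1 := by rw [hx, pt0]
    have x1 : x 1 = z2 := by rw [hx, pt1]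
    have hxQ : x ∈ oQ (7/10) := ⟨by rw [x0]; linarith, by rw [x1]; linarith⟩
    obtain ⟨ρ, M, hρ, hM, -, -, hG⟩ := hloc x hxQ
    obtain ⟨i1, i2⟩ := ix_tendsto 𝒰 h hh h0 x
    have near : ∀ (a : ℕ → ℝ) (c : ℝ), Tendsto a 𝒰 (𝓝 c) → ∀ᶠ n in (𝒰 : Filter ℕ), |a n - c| ≤ ρ := by
      intro a c ha
      have := (ha.sub_const c).abs
      rw [sub_self, abs_zero] at this
      exact (this.eventually_lt_const hρ).mono fun n h => le_of_lt h
    rw [x0] at i1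
    rw [x1] at i2
    have hlim : Tendsto (fun n => v n (p n).1 (p n).2 - v n (ix (h n) x).1 (ix (h n) x).2) 𝒰 (𝓝 0) := by
      have hz : Tendsto (fun n => (|h n * (p n).1 - h n * (ix (h n) x).1| + |h n * (p n).2 - h n * (ix (h n) x).2|) * M) 𝒰 (𝓝 0) := by
        have := ((hz1.sub i1).abs.add (hz2.sub i2).abs).mul_const M
        simpa using this
      rw [tendsto_zero_iff_norm_tendsto_zero]
      refine squeeze_zero' (Eventually.of_forall fun _ => norm_nonneg _) ?_ hz
      filter_upwards [hG, near _ _ hz1, near _ _ hz2, near _ _ i1, near _ _ i2] with n hn n1 n2 n3 n4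
      rw [x0, x1] at hn
      have hpn := hh n
      have := lip2 (v n) (ix (h n) x) (p n) (M * h n) (by
        intro z g1 g2 g3 g4
        have r1 := reg_between (h n) z1 ρ hpn _ _ z.1 n3 n1 g1 g2
        have r2 := reg_between (h n) z2 ρ hpn _ _ z.2 n4 n2 g3 g4
        obtain ⟨a, b, -⟩ := hn.1 z r1 r2
        exact ⟨a, b⟩)
      rw [Real.norm_eq_abs]
      refine this.trans (le_of_eq ?_)
      rw [← mul_sub, ← mul_sub, abs_mul, abs_mul, abs_of_pos hpn]
      push_cast
      ring
    have hlim2 := (hlim.add (hV x hxQ)).abs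
    simp only [sub_add_cancel, zero_add] at hlim2
    have hge : S + 2 * ε ≤ |V x| := ge_of_tendsto hlim2 (hp2.mono fun n h => h.2.2.le)
    have c1 := hcmp x hxQ
    have c2 := hS x (cQ_ball le_rfl (oQ_sub_cQ _ hxQ))
    have c3 := abs_sub_abs_le_abs_sub (V x) (u x)
    rw [abs_sub_comm] at c3
    linarith
  -- conclusion
  have hGc : ∀ᶠ n in (𝒰 : Filter ℕ), GridReg (h n) (v n) 0 0 (74/100 * (69/100)) (C * (S + 2 * ε) / (69/100)^3) α := by
    filter_upwards [hdb, hsmall (1/10000) (by norm_num)] with n hn hsn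
    refine HG (fun p q => (h n)^2 * g (p/(h n)^2) (q/(h n)^2)) (fun p q p' q' => scaled_lip k g hg (h n) (hh n) p q p' q') (h n) (n+1) (v n) (hh n) (heq n)
      0 0 (69/100) (S + 2 * ε) (by norm_num) (by norm_num) (by linarith) ?_ ?_ hn
    · push_cast; rw [hN, abs_zero]; linarith
    · push_cast; rw [hN, abs_zero]; linarith
  obtain ⟨G1, G2, H11, H12, H22, hJ, -⟩ := grid_limit 𝒰 h hh h0 v 0 0 (74/100 * (69/100)) (505/1000) _ α hα (by positivity) (by norm_num) hGc V (oQ (505/1000))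
    (fun x hx => ⟨by rw [sub_zero]; exact hx.1.le, by rw [sub_zero]; exact hx.2.le⟩)
    (fun x hx => hV x ⟨by linarith [hx.1], by linarith [hx.2]⟩)
  refine ⟨V, G1, G2, H11, H12, H22, ?_, hcmp⟩
  rw [div_mul_eq_mul_div]
  exact hJ

lemma le_supAbs (u : E2 → ℝ) (hu : ContinuousOn u (closedBall (0 : E2) 1)) :
    ∀ x ∈ ball (0 : E2) 1, |u x| ≤ supAbs u (ball 0 1) := by
  intro x hx
  obtain ⟨B, hB⟩ := (isCompact_closedBall (0 : E2) 1).exists_bound_of_continuousOn hu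
  have hin : ∀ z ∈ ball (0 : E2) 1, (⨆ (_ : z ∈ ball (0 : E2) 1), |u z|) = |u z| := by
    intro z hz
    have : Nonempty (z ∈ ball (0 : E2) 1) := ⟨hz⟩
    exact ciSup_const
  have hbdd : BddAbove (range fun z : E2 => ⨆ (_ : z ∈ ball (0 : E2) 1), |u z|) := by
    refine ⟨max B 0, ?_⟩
    rintro _ ⟨z, rfl⟩
    by_cases hz : z ∈ ball (0 : E2) 1
    · dsimp only
      rw [hin z hz]
      exact (hB z (ball_subset_closedBall hz)).trans (le_max_left _ _)
    · have : IsEmpty (z ∈ ball (0 : E2) 1) := ⟨hz⟩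
      dsimp only
      rw [Real.iSup_of_isEmpty]
      exact le_max_right _ _
  have := le_ciSup hbdd x
  rw [hin x hx] at this
  exact this

lemma final_jet {lam Lam : ℝ} (hlam : 0 < lam) (hLam : lam ≤ Lam) :
    ∃ α C : ℝ, 0 < α ∧ α < 1 ∧ 0 < C ∧ ∀ (F : Mat2 → ℝ) (u : E2 → ℝ),
      UniformlyElliptic lam Lam F → F 0 = 0 → ContinuousOn u (closedBall (0 : E2) 1) →
      IsViscositySol F u (ball (0 : E2) 1) →
      ∃ g1 g2 h11 h12 h22 : E2 → ℝ,
        TJet u g1 g2 h11 h12 h22 (oQ (505/1000)) (C * supAbs u (ball 0 1)) α := by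
  obtain ⟨α, C, hα, hα1, hC, H⟩ := approx lam Lam hlam hLam
  refine ⟨α, C, hα, hα1, hC, ?_⟩
  intro F u hF hF0 hu hv
  set S := supAbs u (ball 0 1) with hS
  have hpos : ∀ n : ℕ, (0:ℝ) < 1 / ((n:ℝ)+1) := fun n => by positivity
  choose V G1 G2 H11 H12 H22 hJ hV using
    fun n : ℕ => H F u hF hF0 hu hv S (le_supAbs u hu) (1 / ((n:ℝ)+1)) (hpos n)
  have ht : Tendsto (fun n : ℕ => 1 / ((n:ℝ)+1)) (hyperfilter ℕ : Filter ℕ) (𝓝 0) :=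
    tendsto_one_div_add_atTop_nhds_zero_nat.mono_left Nat.hyperfilter_le_atTop
  have hM : Tendsto (fun n : ℕ => C * (S + 2 * (1 / ((n:ℝ)+1)))) (hyperfilter ℕ : Filter ℕ) (𝓝 (C * S)) := by
    have := ((ht.const_mul 2).const_add S).const_mul C
    simpa using this
  have hVl : ∀ x ∈ oQ (505/1000), Tendsto (fun n => V n x) (hyperfilter ℕ : Filter ℕ) (𝓝 (u x)) := by
    intro x hx
    rw [tendsto_iff_dist_tendsto_zero]
    refine squeeze_zero (fun _ => dist_nonneg) (fun n => ?_) ht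
    rw [dist_comm, Real.dist_eq]
    exact hV n x ⟨hx.1.trans (by norm_num), hx.2.trans (by norm_num)⟩
  obtain ⟨g1, g2, h11, h12, h22, hj, -⟩ := jet_lim (hyperfilter ℕ) V G1 G2 H11 H12 H22
    (fun _ x => x 0) (fun _ x => x 1) u (fun x => x 0) (fun x => x 1) (oQ (505/1000))
    _ _ α hα (Eventually.of_forall hJ) hM hVl (fun _ _ => tendsto_const_nhds)
    (fun _ _ => tendsto_const_nhds)
  exact ⟨g1, g2, h11, h12, h22, hj⟩

lemma half_sub_oQ : closedBall (0 : E2) (1 / 2) ⊆ oQ (505/1000) := by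
  intro x hx
  rw [mem_closedBall_zero_iff] at hx
  have h0 := coord_le x 0
  have h1 := coord_le x 1
  exact ⟨by linarith, by linarith⟩

lemma lin_norm (a b M : ℝ) (ha : |a| ≤ M) (hb : |b| ≤ M) : ‖lin a b‖ ≤ 2 * M := by
  have hM : 0 ≤ M := (abs_nonneg a).trans ha
  refine ContinuousLinearMap.opNorm_le_bound _ (by linarith) fun z => ?_
  rw [lin_apply, Real.norm_eq_abs]
  have h0 := mul_le_mul ha (coord_le z 0) (abs_nonneg _) hM
  have h1 := mul_le_mul hb (coord_le z 1) (abs_nonneg _) hM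
  have := abs_add_le (a * z 0) (b * z 1)
  rw [abs_mul, abs_mul] at this
  linarith

end

/-- Interior `C^{2,ᾱ}` regularity for viscosity solutions of `F(D²u) = 0` in the unit disk
`B₁ ⊂ ℝ²`: there are universal constants `ᾱ ∈ (0,1)` and `C > 0` depending only on
`lam, Lam` such that any continuous viscosity solution `u` is `C^{2,ᾱ}` on `B̄_{1/2}` with
`‖u‖_{C^{2,ᾱ}(B̄_{1/2})} ≤ C ‖u‖_{L^∞(B₁)}`. -/
theorem interior_C2alpha_viscosity (lam Lam : ℝ) (hlam : 0 < lam) (hLam : lam ≤ Lam) :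
    ∃ α C : ℝ, α ∈ Set.Ioo (0 : ℝ) 1 ∧ 0 < C ∧
      ∀ (F : Mat2 → ℝ) (u : E2 → ℝ),
        UniformlyElliptic lam Lam F → F 0 = 0 →
        ContinuousOn u (closedBall (0 : E2) 1) →
        IsViscositySol F u (ball (0 : E2) 1) →
        (∀ x ∈ closedBall (0 : E2) (1 / 2), ContDiffAt ℝ 2 u x) ∧
        (∀ x ∈ closedBall (0 : E2) (1 / 2),
          |u x| ≤ C * supAbs u (ball 0 1) ∧
          ‖fderiv ℝ u x‖ ≤ C * supAbs u (ball 0 1) ∧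
          matNorm (hess u x) ≤ C * supAbs u (ball 0 1)) ∧
        (∀ x ∈ closedBall (0 : E2) (1 / 2), ∀ y ∈ closedBall (0 : E2) (1 / 2),
          matNorm (hess u x - hess u y) ≤ C * supAbs u (ball 0 1) * ‖x - y‖ ^ α) := by
  obtain ⟨α, C, hα, hα1, hC, H⟩ := final_jet hlam hLam
  refine ⟨α, 8 * C + 1, ⟨hα, hα1⟩, by positivity, ?_⟩
  intro F u hF hF0 hu hv
  obtain ⟨g1, g2, h11, h12, h22, hj⟩ := H F u hF hF0 hu hv
  have hle := le_supAbs u hu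
  generalize supAbs u (ball 0 1) = S at *
  have hS : 0 ≤ S := (abs_nonneg _).trans (hle 0 (by simp))
  have hCS : 0 ≤ C * S := by positivity
  have hop := oQ_open (505/1000)
  refine ⟨fun x hx => hj.contDiffAt hop hα (half_sub_oQ hx), fun x hx => ⟨?_, ?_, ?_⟩, ?_⟩
  · have : |u x| ≤ S := hle x (closedBall_subset_ball (by norm_num) hx)
    nlinarith
  · obtain ⟨b1, b2, -⟩ := hj.1 x (half_sub_oQ hx)
    rw [(hj.hasV hop (half_sub_oQ hx)).fderiv]
    have := lin_norm _ _ _ b1 b2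
    nlinarith
  · obtain ⟨-, -, b1, b2, b3⟩ := hj.1 x (half_sub_oQ hx)
    rw [hj.hess hop hα (half_sub_oQ hx)]
    simp only [matNorm, Fin.sum_univ_two, Matrix.of_apply, Matrix.cons_val', Matrix.cons_val_zero,
      Matrix.cons_val_one, Matrix.cons_val_fin_one]
    nlinarith
  · intro x hx y hy
    obtain ⟨-, -, -, b1, b2, b3⟩ := hj.2 y (half_sub_oQ hy) x (half_sub_oQ hx)
    rw [hj.hess hop hα (half_sub_oQ hx), hj.hess hop hα (half_sub_oQ hy)]
    simp only [matNorm, Fin.sum_univ_two, Matrix.sub_apply, Matrix.of_apply, Matrix.cons_val', Matrix.cons_val_zero,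
      Matrix.cons_val_one, Matrix.cons_val_fin_one]
    have hk : (|x 0 - y 0| + |x 1 - y 1|) ^ α ≤ 2 * ‖x - y‖ ^ α := by
      calc (|x 0 - y 0| + |x 1 - y 1|) ^ α ≤ (2 * ‖x - y‖) ^ α :=
            Real.rpow_le_rpow (by positivity) (nd_le y x) hα.le
        _ = 2 ^ α * ‖x - y‖ ^ α := Real.mul_rpow (by norm_num) (norm_nonneg _)
        _ ≤ 2 * ‖x - y‖ ^ α := by
            have : (2:ℝ) ^ α ≤ 2 ^ (1:ℝ) := Real.rpow_le_rpow_of_exponent_le (by norm_num) hα1.le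
            rw [Real.rpow_one] at this
            exact mul_le_mul_of_nonneg_right this (by positivity)
    have hk2 := mul_le_mul_of_nonneg_left hk hCS
    have hn : 0 ≤ S * ‖x - y‖ ^ α := by positivity
    linarith
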